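/- arXiv:1710.08403 — 5 statements merged into one kernel-verified Lean document; each statement's English description precedes it below -/
import Mathlib

section
/- Let N_CB(x) be the number of ternary integers n = pqr ≤ x (with 3 ≤ p < q < r odd primes) with h(Φ_n) ≤ 2p/3, and let N_T(x) be the number of ternary integers ≤ x. Then liminf_{x→∞} N_CB(x)/N_T(x) ≥ 25/27; in particular the relative density of ternary integers satisfying the corrected Sister Beiter conjecture is at least 0.925. -/
open Real Filter Polynomial

/-- The height of a polynomial over `ℤ`: the maximum of the absolute values of
its coefficients. -/
noncomputable def polyHeight (f : Polynomial ℤ) : ℕ :=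
  f.support.sup fun k => (f.coeff k).natAbs

/-- `N_CB(x)`: the number of ternary `n = pqr ≤ x` (with `3 ≤ p < q < r` odd primes)
with `h(Φ_n) ≤ 2p/3`, where `p` is the smallest prime factor of `n`. -/
noncomputable def NCBcount (x : ℝ) : ℕ :=
  {n : ℕ | ∃ p q r : ℕ, p.Prime ∧ q.Prime ∧ r.Prime ∧
    3 ≤ p ∧ p < q ∧ q < r ∧ n = p * q * r ∧ (n : ℝ) ≤ x ∧
    (polyHeight (Polynomial.cyclotomic n ℤ) : ℝ) ≤ 2 * (p : ℝ) / 3}.ncard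

/-- `N_T(x)`: the number of ternary integers `n ≤ x`. -/
noncomputable def NTcount (x : ℝ) : ℕ :=
  {n : ℕ | ∃ p q r : ℕ, p.Prime ∧ q.Prime ∧ r.Prime ∧
    3 ≤ p ∧ p < q ∧ q < r ∧ n = p * q * r ∧ (n : ℝ) ≤ x}.ncard

namespace NCB

theorem cyc_identity {p q r : ℕ} (hp : p.Prime) (hq : q.Prime) (hr : r.Prime)
    (hpq : p ≠ q) (hpr : p ≠ r) (hqr : q ≠ r) :
    cyclotomic (p * q * r) ℤ * (X ^ (p * q * r) - 1) ^ 2 =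
      (∑ i ∈ Finset.range p, X ^ i) * (X ^ q - 1) * (X ^ r - 1) *
        ((∑ a ∈ Finset.range p, X ^ (a * (q * r))) * (∑ b ∈ Finset.range q, X ^ (b * (p * r))) *
          (∑ c ∈ Finset.range r, X ^ (c * (p * q)))) := by
  have h0 : cyclotomic p ℤ * (X - 1) = X ^ p - 1 := by
    have := Fact.mk hp
    exact cyclotomic_prime_mul_X_sub_one ℤ p
  have h1 : expand ℤ q (cyclotomic p ℤ) = cyclotomic (p * q) ℤ * cyclotomic p ℤ :=
    cyclotomic_expand_eq_cyclotomic_mul hq (fun h => hpq ((Nat.prime_dvd_prime_iff_eq hq hp).1 h).symm) ℤ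
  have hnd : ¬ r ∣ p * q := by
    intro h
    rcases (Nat.Prime.dvd_mul hr).1 h with h | h
    · exact hpr ((Nat.prime_dvd_prime_iff_eq hr hp).1 h).symm
    · exact hqr ((Nat.prime_dvd_prime_iff_eq hr hq).1 h).symm
  have h2 : expand ℤ r (cyclotomic (p * q) ℤ) = cyclotomic (p * q * r) ℤ * cyclotomic (p * q) ℤ :=
    cyclotomic_expand_eq_cyclotomic_mul hr hnd ℤ
  have h3 : expand ℤ q (cyclotomic p ℤ) * (X ^ q - 1) = X ^ (p * q) - 1 := by
    have := congrArg (expand ℤ q) h0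
    simpa [← pow_mul, mul_comm] using this
  have h4 : cyclotomic (p * q) ℤ * (X ^ p - 1) * (X ^ q - 1) = (X ^ (p * q) - 1) * (X - 1) := by
    rw [← h0, ← h3, h1]; ring
  have h5 : expand ℤ r (cyclotomic (p * q) ℤ) * (X ^ (p * r) - 1) * (X ^ (q * r) - 1)
      = (X ^ (p * q * r) - 1) * (X ^ r - 1) := by
    have := congrArg (expand ℤ r) h4
    simpa [← pow_mul, mul_comm, mul_left_comm, mul_assoc] using this
  have hne : ∀ n : ℕ, 0 < n → (X ^ n - 1 : ℤ[X]) ≠ 0 := fun n hn => X_pow_sub_C_ne_zero hn 1 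
  have g : ∀ n m : ℕ, (∑ a ∈ Finset.range n, (X : ℤ[X]) ^ (a * m)) * (X ^ m - 1) = X ^ (n * m) - 1 := by
    intro n m
    have := geom_sum_mul ((X : ℤ[X]) ^ m) n
    simpa [← pow_mul, mul_comm] using this
  have g1 := g p (q * r)
  have g2 := g q (p * r)
  have g3 := g r (p * q)
  have g0 := g p 1
  simp only [mul_one, pow_one] at g0
  rw [show p * (q * r) = p * q * r by ring] at g1
  rw [show q * (p * r) = p * q * r by ring] at g2
  rw [show r * (p * q) = p * q * r by ring] at g3
  set Ga := ∑ a ∈ Finset.range p, (X : ℤ[X]) ^ (a * (q * r))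
  set Gb := ∑ a ∈ Finset.range q, (X : ℤ[X]) ^ (a * (p * r))
  set Gc := ∑ a ∈ Finset.range r, (X : ℤ[X]) ^ (a * (p * q))
  set G0 := ∑ a ∈ Finset.range p, (X : ℤ[X]) ^ a
  set Φ := cyclotomic (p * q * r) ℤ
  set Ψ := cyclotomic (p * q) ℤ
  have hpp := hp.pos
  have hqp := hq.pos
  have hrp := hr.pos
  have h6 : Φ * (X - 1) * (X ^ (p * q) - 1) * (X ^ (p * r) - 1) * (X ^ (q * r) - 1)
      = (X ^ (p * q * r) - 1) * (X ^ p - 1) * (X ^ q - 1) * (X ^ r - 1) := by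
    rw [h2] at h5
    calc _ = Φ * (X ^ (p * r) - 1) * (X ^ (q * r) - 1) * ((X ^ (p * q) - 1) * (X - 1)) := by ring
      _ = (Φ * Ψ * (X ^ (p * r) - 1) * (X ^ (q * r) - 1)) * ((X ^ p - 1) * (X ^ q - 1)) := by
          rw [← h4]; ring
      _ = _ := by rw [h5]; ring
  have hX1 : (X - 1 : ℤ[X]) ≠ 0 := by simpa using hne 1 one_pos
  apply mul_right_cancel₀ (b := (X - 1) * (X ^ (p * q * r) - 1)) 
    (mul_ne_zero hX1 (hne _ (by positivity)))
  calc _ = (Φ * (X - 1) * (X ^ (p * q) - 1) * (X ^ (p * r) - 1) * (X ^ (q * r) - 1)) * (Ga * Gb * Gc) := by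
        calc _ = Φ * (X - 1) * ((X ^ (p * q * r) - 1) * (X ^ (p * q * r) - 1) * (X ^ (p * q * r) - 1)) := by ring
          _ = Φ * (X - 1) * ((Ga * (X ^ (q * r) - 1)) * (Gb * (X ^ (p * r) - 1)) * (Gc * (X ^ (p * q) - 1))) := by
            rw [g1, g2, g3]
          _ = _ := by ring
    _ = _ := by rw [h6, ← g0]; ring

/-- number of representations -/
def rho (p q r : ℕ) (m : ℤ) : ℤ :=
  ∑ a ∈ Finset.range p, ∑ b ∈ Finset.range q, ∑ c ∈ Finset.range r,
    if m = a * (q * r) + b * (p * r) + c * (p * q) then 1 else 0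

theorem coeff_formula {p q r : ℕ} (hp : p.Prime) (hq : q.Prime) (hr : r.Prime)
    (hpq : p ≠ q) (hpr : p ≠ r) (hqr : q ≠ r) (k : ℕ) (hk : k < p * q * r) :
    (cyclotomic (p * q * r) ℤ).coeff k =
      ∑ i ∈ Finset.range p, (rho p q r (k - i) - rho p q r (k - i - q) - rho p q r (k - i - r)
        + rho p q r (k - i - q - r)) := by
  have h := congrArg (fun f => coeff f k) (cyc_identity hp hq hr hpq hpr hqr)
  have hL : (cyclotomic (p * q * r) ℤ * (X ^ (p * q * r) - 1) ^ 2).coeff k =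
      (cyclotomic (p * q * r) ℤ).coeff k := by
    rw [show cyclotomic (p * q * r) ℤ * (X ^ (p * q * r) - 1) ^ 2 = cyclotomic (p * q * r) ℤ
      + X ^ (p * q * r) * (cyclotomic (p * q * r) ℤ * (X ^ (p * q * r) - 2)) by ring]
    rw [coeff_add, coeff_X_pow_mul', if_neg (by omega), add_zero]
  rw [← hL, h]
  have hR : (∑ i ∈ Finset.range p, (X : ℤ[X]) ^ i) * (X ^ q - 1) * (X ^ r - 1) *
        ((∑ a ∈ Finset.range p, X ^ (a * (q * r))) * (∑ b ∈ Finset.range q, X ^ (b * (p * r))) *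
          (∑ c ∈ Finset.range r, X ^ (c * (p * q)))) =
      ∑ i ∈ Finset.range p, ∑ a ∈ Finset.range p, ∑ b ∈ Finset.range q, ∑ c ∈ Finset.range r,
        ((X : ℤ[X]) ^ (i + (a * (q * r) + b * (p * r) + c * (p * q))) 
         - X ^ (i + q + (a * (q * r) + b * (p * r) + c * (p * q)))
         - X ^ (i + r + (a * (q * r) + b * (p * r) + c * (p * q)))
         + X ^ (i + q + r + (a * (q * r) + b * (p * r) + c * (p * q)))) := by
    rw [Finset.sum_mul, Finset.sum_mul, Finset.sum_mul]
    apply Finset.sum_congr rfl; intro i _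
    rw [Finset.sum_mul_sum, Finset.sum_mul, Finset.mul_sum]
    apply Finset.sum_congr rfl; intro a _
    rw [Finset.sum_mul, Finset.mul_sum]
    apply Finset.sum_congr rfl; intro b _
    rw [Finset.mul_sum, Finset.mul_sum]
    apply Finset.sum_congr rfl; intro c _
    ring
  rw [hR]
  simp only [rho, finsetSum_coeff, ← Finset.sum_sub_distrib, ← Finset.sum_add_distrib]
  apply Finset.sum_congr rfl; intro i _
  apply Finset.sum_congr rfl; intro a _
  apply Finset.sum_congr rfl; intro b _
  apply Finset.sum_congr rfl; intro c _
  simp only [coeff_add, coeff_sub, coeff_X_pow]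
  congr 1
  · congr 1
    · congr 1
      · exact if_congr (by zify; constructor <;> intro h <;> linarith) rfl rfl
      · exact if_congr (by zify; constructor <;> intro h <;> linarith) rfl rfl
    · exact if_congr (by zify; constructor <;> intro h <;> linarith) rfl rfl
  · exact if_congr (by zify; constructor <;> intro h <;> linarith) rfl rfl

end NCB

namespace NCB

/-- residue data attached to three pairwise coprime moduli -/
structure Data (p q r : ℕ) (x y : ℤ) where
  A : ℤ → ℤ
  B : ℤ → ℤ
  C : ℤ → ℤ
  F : ℤ → ℤ
  p1 : ℤ
  p2 : ℤ
  hp1 : p * p1 + q * x = p * q + 1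
  hp2 : p * p2 + r * y = p * r + 1
  A0 : ∀ m, 0 ≤ A m
  B0 : ∀ m, 0 ≤ B m
  C0 : ∀ m, 0 ≤ C m
  A1 : ∀ m, A m < p
  B1 : ∀ m, B m < q
  C1 : ∀ m, C m < r
  hF : ∀ m, A m * (q * r) + B m * (p * r) + C m * (p * q) = m + F m * (p * q * r)
  Aq : ∀ m, A (m - q) = A m - y + if A m < y then (p : ℤ) else 0
  Ar : ∀ m, A (m - r) = A m - x + if A m < x then (p : ℤ) else 0
  Bq : ∀ m, B (m - q) = B m
  Br : ∀ m, B (m - r) = B m - p1 + if B m < p1 then (q : ℤ) else 0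
  Cr : ∀ m, C (m - r) = C m
  Cq : ∀ m, C (m - q) = C m - p2 + if C m < p2 then (r : ℤ) else 0
  inj : ∀ m m', A m = A m' → (p : ℤ) ∣ m - m'

theorem emod_uniq {n z d : ℤ} (h0 : 0 ≤ z) (h1 : z < d) (h : d ∣ n - z) : n % d = z := by
  rw [← Int.emod_eq_of_lt h0 h1]
  exact Int.emod_eq_emod_iff_emod_sub_eq_zero.2 (Int.emod_eq_zero_of_dvd h)

theorem emod_shift {n s d t : ℤ} (hd : 0 < d) (h0 : 0 ≤ t) (h1 : t < d) (h : d ∣ s - t) :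
    (n - s) % d = n % d - t + if n % d < t then d else 0 := by
  have e0 := Int.emod_nonneg n hd.ne'
  have e1 := Int.emod_lt_of_pos n hd
  have e2 : d ∣ n - n % d := Int.dvd_self_sub_emod
  apply emod_uniq
  · split_ifs <;> omega
  · split_ifs <;> omega
  · obtain ⟨u, hu⟩ := h
    obtain ⟨w, hw⟩ := e2
    split_ifs
    · exact ⟨w - u - 1, by linear_combination hw - hu⟩
    · exact ⟨w - u, by linear_combination hw - hu⟩

theorem exists_inv_pair {p q : ℕ} (hp : 1 < p) (hq : 1 < q) (hc : Nat.Coprime p q) (x : ℤ) (hx0 : 0 < x) (hx1 : x < p)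
    (hx : (p : ℤ) ∣ q * x - 1) : ∃ p1 : ℤ, p * p1 + q * x = p * q + 1 ∧ 0 < p1 ∧ p1 < q := by
  obtain ⟨u, hu⟩ := hx
  refine ⟨q - u, by linear_combination hu, ?_, ?_⟩
  · have : (p : ℤ) * u < p * q := by rw [← hu]; nlinarith
    have := lt_of_mul_lt_mul_left this (by positivity)
    omega
  · have : (0 : ℤ) < p * u := by rw [← hu]; nlinarith
    have := (pos_iff_pos_of_mul_pos this).1 (by positivity)
    omega

theorem exists_inverse {a n : ℕ} (h : Nat.Coprime a n) : ∃ b : ℤ, (n : ℤ) ∣ a * b - 1 := by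
  have := Int.isCoprime_iff_gcd_eq_one.2 (by simpa using h : Int.gcd a n = 1)
  obtain ⟨u, v, huv⟩ := this
  exact ⟨u, -v, by linear_combination huv⟩

theorem exists_data {p q r : ℕ} (hp : 1 < p) (hq : 1 < q) (hr : 1 < r)
    (hpq : Nat.Coprime p q) (hpr : Nat.Coprime p r) (hqr : Nat.Coprime q r) (x y : ℤ)
    (hx0 : 0 < x) (hx1 : x < p) (hy0 : 0 < y) (hy1 : y < p)
    (hx : (p : ℤ) ∣ q * x - 1) (hy : (p : ℤ) ∣ r * y - 1) : Nonempty (Data p q r x y) := by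
  obtain ⟨p1, hp1, hp1a, hp1b⟩ := exists_inv_pair hp hq hpq x hx0 hx1 hx
  obtain ⟨p2, hp2, hp2a, hp2b⟩ := exists_inv_pair hp hr hpr y hy0 hy1 hy
  obtain ⟨r', hr'⟩ := exists_inverse hqr.symm
  obtain ⟨q', hq'⟩ := exists_inverse hqr
  have pp : (0 : ℤ) < p := by omega
  have pq : (0 : ℤ) < q := by omega
  have pr : (0 : ℤ) < r := by omega
  have hdiv : ∀ m : ℤ, ∃ f : ℤ, (m * (x * y)) % p * (q * r) + (m * (p1 * r')) % q * (p * r)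
      + (m * (p2 * q')) % r * (p * q) = m + f * (p * q * r) := by
    intro m
    set A := (m * (x * y)) % p
    set B := (m * (p1 * r')) % q
    set C := (m * (p2 * q')) % r
    obtain ⟨u, hu⟩ : (p : ℤ) ∣ (m * (x * y)) - A := Int.dvd_self_sub_emod
    obtain ⟨v, hv⟩ : (q : ℤ) ∣ (m * (p1 * r')) - B := Int.dvd_self_sub_emod
    obtain ⟨w, hw⟩ : (r : ℤ) ∣ (m * (p2 * q')) - C := Int.dvd_self_sub_emod
    have d1 : (p : ℤ) ∣ A * (q * r) + B * (p * r) + C * (p * q) - m := by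
      obtain ⟨s, hs⟩ := hx
      obtain ⟨t, ht⟩ := hy
      exact ⟨B * r + C * q - u * (q * r) + m * (s * r * y + t), by
        linear_combination (-1 : ℤ) * (q * r : ℤ) * hu + m * r * y * hs + m * ht⟩
    have d2 : (q : ℤ) ∣ A * (q * r) + B * (p * r) + C * (p * q) - m := by
      obtain ⟨s, hs⟩ := hr'
      exact ⟨A * r + C * p - v * (p * r) + m * (r * r' * (p - x) + s), by
        linear_combination (-1 : ℤ) * (p * r : ℤ) * hv + m * r * r' * hp1 + m * hs⟩
    have d3 : (r : ℤ) ∣ A * (q * r) + B * (p * r) + C * (p * q) - m := by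
      obtain ⟨s, hs⟩ := hq'
      exact ⟨A * q + B * p - w * (p * q) + m * (q * q' * (p - y) + s), by
        linear_combination (-1 : ℤ) * (p * q : ℤ) * hw + m * q * q' * hp2 + m * hs⟩
    have c1 : IsCoprime (p : ℤ) q := Nat.isCoprime_iff_coprime.2 hpq
    have c2 : IsCoprime (p * q : ℤ) r := IsCoprime.mul_left (Nat.isCoprime_iff_coprime.2 hpr) (Nat.isCoprime_iff_coprime.2 hqr)
    obtain ⟨f, hf⟩ := c2.mul_dvd (c1.mul_dvd d1 d2) d3
    exact ⟨f, by linear_combination hf⟩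
  choose F hF using hdiv
  refine ⟨⟨fun m => (m * (x * y)) % p, fun m => (m * (p1 * r')) % q, fun m => (m * (p2 * q')) % r, F,
    p1, p2, hp1, hp2, fun m => Int.emod_nonneg _ pp.ne', fun m => Int.emod_nonneg _ pq.ne',
    fun m => Int.emod_nonneg _ pr.ne', fun m => Int.emod_lt_of_pos _ pp, fun m => Int.emod_lt_of_pos _ pq,
    fun m => Int.emod_lt_of_pos _ pr, hF, ?_, ?_, ?_, ?_, ?_, ?_, ?_⟩⟩
  · intro m
    rw [sub_mul]
    refine emod_shift pp hy0.le hy1 ?_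
    obtain ⟨s, hs⟩ := hx
    exact ⟨s * y, by linear_combination y * hs⟩
  · intro m
    rw [sub_mul]
    refine emod_shift pp hx0.le hx1 ?_
    obtain ⟨s, hs⟩ := hy
    exact ⟨s * x, by linear_combination x * hs⟩
  · intro m
    rw [sub_mul, Int.sub_emod, Int.mul_emod_right]; simp
  · intro m
    rw [sub_mul]
    refine emod_shift pq hp1a.le hp1b ?_
    obtain ⟨s, hs⟩ := hr'
    exact ⟨s * p1, by linear_combination p1 * hs⟩
  · intro m
    rw [sub_mul, Int.sub_emod, Int.mul_emod_right]; simp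
  · intro m
    rw [sub_mul]
    refine emod_shift pr hp2a.le hp2b ?_
    obtain ⟨s, hs⟩ := hq'
    exact ⟨s * p2, by linear_combination p2 * hs⟩
  · intro m m' h
    have h1 : (p : ℤ) ∣ m * (x * y) - m' * (x * y) := Int.dvd_of_emod_eq_zero
      (Int.emod_eq_emod_iff_emod_sub_eq_zero.1 h)
    obtain ⟨s, hs⟩ := hx
    obtain ⟨t, ht⟩ := hy
    obtain ⟨u, hu⟩ := h1
    exact ⟨u * (q * r) - (m - m') * (s * r * y + t), by
      linear_combination (q * r : ℤ) * hu - (m - m') * r * y * hs - (m - m') * ht⟩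

variable {p q r : ℕ} {x y : ℤ}

theorem Data.F_q (D : Data p q r x y) (hp : 1 < p) (hq : 1 < q) (hr : 1 < r) (m : ℤ) :
    D.F (m - q) = D.F m - 1 + (if D.A m < y then 1 else 0) + (if D.C m < D.p2 then 1 else 0) := by
  have h1 := D.hF m
  have h2 := D.hF (m - q)
  have h3 := D.hp2
  rw [D.Aq, D.Bq, D.Cq] at h2
  have hpos : (p * q * r : ℤ) ≠ 0 := by positivity
  apply mul_right_cancel₀ hpos
  split_ifs at h2 ⊢ <;> linear_combination h1 - h2 - q * h3

theorem Data.F_r (D : Data p q r x y) (hp : 1 < p) (hq : 1 < q) (hr : 1 < r) (m : ℤ) :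
    D.F (m - r) = D.F m - 1 + (if D.A m < x then 1 else 0) + (if D.B m < D.p1 then 1 else 0) := by
  have h1 := D.hF m
  have h2 := D.hF (m - r)
  have h3 := D.hp1
  rw [D.Ar, D.Br, D.Cr] at h2
  have hpos : (p * q * r : ℤ) ≠ 0 := by positivity
  apply mul_right_cancel₀ hpos
  split_ifs at h2 ⊢ <;> linear_combination h1 - h2 - r * h3

theorem Data.F_nonneg (D : Data p q r x y) (m : ℤ) (hm : m < p * q * r) : 0 ≤ D.F m := by
  have h1 := D.hF m
  have := D.A0 m
  have := D.B0 m
  have := D.C0 m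
  have h2 : 0 ≤ D.A m * (q * r) + D.B m * (p * r) + D.C m * (p * q) := by positivity
  by_contra h
  have : D.F m * (p * q * r) ≤ -1 * (p * q * r) := by gcongr; omega
  linarith

theorem Data.F_le (D : Data p q r x y) (m : ℤ) (hm : -(q * r + p * r + p * q : ℤ) < m) : D.F m ≤ 2 := by
  have h1 := D.hF m
  have a1 : D.A m * (q * r) ≤ (p - 1) * (q * r) := by gcongr; have := D.A1 m; omega
  have a2 : D.B m * (p * r) ≤ (q - 1) * (p * r) := by gcongr; have := D.B1 m; omega
  have a3 : D.C m * (p * q) ≤ (r - 1) * (p * q) := by gcongr; have := D.C1 m; omega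
  by_contra h
  have : 3 * (p * q * r : ℤ) ≤ D.F m * (p * q * r) := by gcongr; omega
  nlinarith

theorem Data.rho_eq (D : Data p q r x y) (hp : 1 < p) (hq : 1 < q) (hr : 1 < r)
    (hpq : Nat.Coprime p q) (hpr : Nat.Coprime p r) (hqr : Nat.Coprime q r) (m : ℤ) :
    rho p q r m = if D.F m = 0 then 1 else 0 := by
  have key : ∀ a ∈ Finset.range p, ∀ b ∈ Finset.range q, ∀ c ∈ Finset.range r,
      (m = a * (q * r) + b * (p * r) + c * (p * q) ↔
        ((a = (D.A m).toNat ∧ b = (D.B m).toNat ∧ c = (D.C m).toNat) ∧ D.F m = 0)) := by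
    intro a ha b hb c hc
    rw [Finset.mem_range] at ha hb hc
    have h1 := D.hF m
    have hA0 := D.A0 m
    have hB0 := D.B0 m
    have hC0 := D.C0 m
    have hA1 := D.A1 m
    have hB1 := D.B1 m
    have hC1 := D.C1 m
    constructor
    · intro h
      have e : (D.A m - a) * (q * r) + (D.B m - b) * (p * r) + (D.C m - c) * (p * q) = D.F m * (p * q * r) := by
        linear_combination h1 + h
      have dvd_small : ∀ (n : ℕ) (u v : ℤ), 0 ≤ u → u < n → 0 ≤ v → v < n → (n : ℤ) ∣ u - v → u = v := by
        intro n u v h1 h2 h3 h4 h5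
        have := Int.eq_zero_of_abs_lt_dvd h5 (by rw [abs_lt]; constructor <;> linarith)
        linarith
      have ea : D.A m = a := by
        apply dvd_small p _ _ hA0 hA1 (by positivity) (by exact_mod_cast ha)
        have c2 : IsCoprime (p : ℤ) (q * r) := IsCoprime.mul_right (Nat.isCoprime_iff_coprime.2 hpq) (Nat.isCoprime_iff_coprime.2 hpr)
        apply c2.dvd_of_dvd_mul_right
        exact ⟨D.F m * (q * r) - (D.B m - b) * r - (D.C m - c) * q, by linear_combination e⟩
      have eb : D.B m = b := by
        apply dvd_small q _ _ hB0 hB1 (by positivity) (by exact_mod_cast hb)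
        have c2 : IsCoprime (q : ℤ) (p * r) := IsCoprime.mul_right (Nat.isCoprime_iff_coprime.2 hpq.symm) (Nat.isCoprime_iff_coprime.2 hqr)
        apply c2.dvd_of_dvd_mul_right
        exact ⟨D.F m * (p * r) - (D.A m - a) * r - (D.C m - c) * p, by linear_combination e⟩
      have ec : D.C m = c := by
        apply dvd_small r _ _ hC0 hC1 (by positivity) (by exact_mod_cast hc)
        have c2 : IsCoprime (r : ℤ) (p * q) := IsCoprime.mul_right (Nat.isCoprime_iff_coprime.2 hpr.symm) (Nat.isCoprime_iff_coprime.2 hqr.symm)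
        apply c2.dvd_of_dvd_mul_right
        exact ⟨D.F m * (p * q) - (D.A m - a) * q - (D.B m - b) * p, by linear_combination e⟩
      refine ⟨⟨by omega, by omega, by omega⟩, ?_⟩
      rw [ea, eb, ec] at e
      have hpos : (p * q * r : ℤ) ≠ 0 := by positivity
      have : D.F m * (p * q * r : ℤ) = 0 := by linear_combination -e
      exact (mul_eq_zero.1 this).resolve_right hpos
    · rintro ⟨⟨rfl, rfl, rfl⟩, h⟩
      rw [Int.toNat_of_nonneg hA0, Int.toNat_of_nonneg hB0, Int.toNat_of_nonneg hC0]
      rw [h] at h1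
      linear_combination -h1
  have hA0 := D.A0 m
  have hB0 := D.B0 m
  have hC0 := D.C0 m
  have hA1 := D.A1 m
  have hB1 := D.B1 m
  have hC1 := D.C1 m
  unfold rho
  rw [Finset.sum_congr rfl (fun a ha => Finset.sum_congr rfl (fun b hb => Finset.sum_congr rfl
    (fun c hc => if_congr (key a ha b hb c hc) rfl rfl)))]
  by_cases h : D.F m = 0
  · simp only [h, and_true, if_true]
    rw [Finset.sum_eq_single_of_mem (D.A m).toNat (by rw [Finset.mem_range]; omega)]
    · rw [Finset.sum_eq_single_of_mem (D.B m).toNat (by rw [Finset.mem_range]; omega)]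
      · rw [Finset.sum_eq_single_of_mem (D.C m).toNat (by rw [Finset.mem_range]; omega)]
        · simp
        · intro b _ hb
          simp [hb]
      · intro b _ hb
        simp [hb]
    · intro b _ hb
      simp [hb]
  · simp [h]

theorem Data.card_window (D : Data p q r x y) (k : ℤ) (P : ℤ → Prop) [DecidablePred P] (lo hi : ℤ)
    (hle : lo ≤ hi)
    (h : ∀ i : ℕ, i < p → P (k - i) → lo ≤ D.A (k - i) ∧ D.A (k - i) < hi) :
    ∑ i ∈ Finset.range p, (if P (k - i) then (1 : ℤ) else 0) ≤ hi - lo := by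
  rw [← Finset.sum_filter, Finset.sum_const, nsmul_eq_mul, mul_one]
  have : ((Finset.range p).filter (fun i : ℕ => P (k - i))).card ≤ (Finset.Ico lo hi).card := by
    apply Finset.card_le_card_of_injOn (fun i : ℕ => D.A (k - i))
    · intro i hi
      simp only [Finset.coe_filter, Finset.mem_range, Set.mem_ofPred_eq] at hi
      simpa using h i hi.1 hi.2
    · intro i hi j hj hij
      simp only [Finset.coe_filter, Finset.mem_range, Set.mem_ofPred_eq] at hi hj
      have h1 := D.inj _ _ hij
      have := Int.eq_zero_of_abs_lt_dvd h1 (by rw [abs_lt]; constructor <;> omega)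
      omega
  rw [Int.card_Ico] at this
  omega

end NCB

namespace NCB

theorem pt_all {a a' x y p b p1 c p2 f f1 f2 f3 : ℤ} (hxy : x ≤ y) (hyp : y < p)
    (ha0 : 0 ≤ a) (ha1 : a < p) (ha' : a' = a - y + if a < y then p else 0)
    (h1 : f1 = f - 1 + (if a < y then 1 else 0) + (if c < p2 then 1 else 0))
    (h2 : f2 = f - 1 + (if a < x then 1 else 0) + (if b < p1 then 1 else 0))
    (h3 : f3 = f1 - 1 + (if a' < x then 1 else 0) + (if b < p1 then 1 else 0))
    (ff : 0 ≤ f ∧ f ≤ 2 ∧ 0 ≤ f1 ∧ f1 ≤ 2 ∧ 0 ≤ f2 ∧ f2 ≤ 2 ∧ 0 ≤ f3 ∧ f3 ≤ 2) (t : ℤ)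
    (ht : t = (if f = 0 then (1 : ℤ) else 0) - (if f1 = 0 then 1 else 0) - (if f2 = 0 then 1 else 0)
      + (if f3 = 0 then 1 else 0)) :
    (x + y ≤ p → (t ≤ (if 0 ≤ a ∧ a < x then (1 : ℤ) else 0)
        + (if x + y ≤ a ∧ p1 ≤ b ∧ p2 ≤ c ∧ f = 2 then (1 : ℤ) else 0)) ∧
      -t ≤ (if y ≤ a ∧ a < x + y then (1 : ℤ) else 0)
        + (if (x ≤ a ∧ a < y) ∧ p1 ≤ b ∧ c < p2 ∧ f = 1 then (1 : ℤ) else 0)) ∧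
    (p < x + y → (t ≤ (if x + y - p ≤ a ∧ a < x then (1 : ℤ) else 0)
        + (if a < x + y - p ∧ b < p1 ∧ c < p2 ∧ f = 0 then (1 : ℤ) else 0)) ∧
      -t ≤ (if y ≤ a ∧ a < p then (1 : ℤ) else 0)
        + (if (x ≤ a ∧ a < y) ∧ p1 ≤ b ∧ c < p2 ∧ f = 1 then (1 : ℤ) else 0)) := by
  have ht' : ∀ P : Prop, [Decidable P] → (0 : ℤ) ≤ (if P then (1 : ℤ) else 0) := by
    intro P _; split_ifs <;> norm_num
  by_cases c1 : a < y <;> by_cases c2 : a < x <;> by_cases c3 : a' < x <;> by_cases c4 : b < p1 <;>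
    by_cases c5 : c < p2 <;> simp only [c1, c2, c3, c4, c5, if_true, if_false] at h1 h2 h3 ha' <;>
    first
    | (exfalso; omega)
    | (have hf : f = 0 ∨ f = 1 ∨ f = 2 := by omega
       rcases hf with rfl | rfl | rfl <;> norm_num at h1 h2 h3 <;> subst h1 h2 h3 <;> norm_num at ht <;>
       (subst ht; refine ⟨fun hs => ⟨?_, ?_⟩, fun hs => ⟨?_, ?_⟩⟩ <;> split_ifs <;> omega))

set_option maxHeartbeats 2000000 in
theorem Data.coeff_bounds {p q r : ℕ} {x y : ℤ} (D : Data p q r x y) (hp : p.Prime) (hq : q.Prime) (hr : r.Prime)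
    (hpq : p ≠ q) (hpr : p ≠ r) (hqr : q ≠ r) (hx0 : 0 < x) (hy1 : y < p) (hxy : x ≤ y)
    (k : ℕ) (hk : k < p * q * r) (K : ℤ) (hK : K = (cyclotomic (p * q * r) ℤ).coeff k) :
    (x + y ≤ p → K ≤ p - y ∧ K ≤ 2 * x + y ∧ -K ≤ y ∧ -K ≤ 2 * x + (p - y)) ∧
    (p < x + y → K ≤ x ∧ K ≤ 2 * (p - y) + (p - x) ∧ -K ≤ p - x ∧ -K ≤ 2 * (p - y) + x) := by
  have cpq := (Nat.coprime_primes hp hq).2 hpq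
  have cpr := (Nat.coprime_primes hp hr).2 hpr
  have cqr := (Nat.coprime_primes hq hr).2 hqr
  have h1p := hp.one_lt
  have h1q := hq.one_lt
  have h1r := hr.one_lt
  have zp : (2 : ℤ) ≤ p := by exact_mod_cast hp.two_le
  have zq : (2 : ℤ) ≤ q := by exact_mod_cast hq.two_le
  have zr : (2 : ℤ) ≤ r := by exact_mod_cast hr.two_le
  rw [coeff_formula hp hq hr hpq hpr hqr k hk] at hK
  simp only [D.rho_eq h1p h1q h1r cpq cpr cqr] at hK
  -- ranges
  have mrange : ∀ i : ℕ, i < p → ((k : ℤ) - i < p * q * r) ∧ -(q * r + p * r + p * q : ℤ) < (k : ℤ) - i - q - r := by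
    intro i hi
    have h1 : (k : ℤ) < p * q * r := by exact_mod_cast hk
    constructor
    · linarith [(Nat.cast_nonneg i : (0 : ℤ) ≤ i)]
    · have h2 : (i : ℤ) < p := by exact_mod_cast hi
      have h3 : (0 : ℤ) ≤ k := Nat.cast_nonneg k
      nlinarith
  have facts : ∀ i : ℕ, i < p → ∀ m : ℤ, m = (k : ℤ) - i →
      0 ≤ D.F m ∧ D.F m ≤ 2 ∧ 0 ≤ D.F (m - q) ∧ D.F (m - q) ≤ 2 ∧ 0 ≤ D.F (m - r) ∧ D.F (m - r) ≤ 2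
      ∧ 0 ≤ D.F (m - q - r) ∧ D.F (m - q - r) ≤ 2 := by
    rintro i hi m rfl
    obtain ⟨h1, h2⟩ := mrange i hi
    refine ⟨D.F_nonneg _ ?_, D.F_le _ ?_, D.F_nonneg _ ?_, D.F_le _ ?_, D.F_nonneg _ ?_, D.F_le _ ?_,
      D.F_nonneg _ ?_, D.F_le _ ?_⟩ <;> linarith
  set κ : ℤ := (k : ℤ) / (q * r) with hκ
  have hqrpos : (0 : ℤ) < q * r := by positivity
  have hκ1 : κ * (q * r) ≤ k := Int.ediv_mul_le _ hqrpos.ne'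
  have hκ2 : (k : ℤ) < (κ + 1) * (q * r) := Int.lt_ediv_add_one_mul_self _ hqrpos
  have lower : ∀ z : ℤ, (k : ℤ) < z * (q * r) → κ + 1 ≤ z := by
    intro z hz
    by_contra h
    have : z * (q * r) ≤ κ * (q * r) := by gcongr; omega
    linarith
  have upper : ∀ z : ℤ, z * (q * r) ≤ k → z ≤ κ := by
    intro z hz
    by_contra h
    have : (κ + 1) * (q * r) ≤ z * (q * r) := by gcongr; omega
    linarith
  -- special predicate counts
  set S4 : ℤ → Prop := fun m => x + y ≤ D.A m ∧ D.p1 ≤ D.B m ∧ D.p2 ≤ D.C m ∧ D.F m = 2 with hS4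
  set S2 : ℤ → Prop := fun m => (x ≤ D.A m ∧ D.A m < y) ∧ D.p1 ≤ D.B m ∧ D.C m < D.p2 ∧ D.F m = 1 with hS2
  set S1 : ℤ → Prop := fun m => D.A m < x + y - p ∧ D.B m < D.p1 ∧ D.C m < D.p2 ∧ D.F m = 0 with hS1
  have hp1 := D.hp1
  have hp2 := D.hp2
  have pr0 : (0 : ℤ) ≤ p * r := by positivity
  have pq0 : (0 : ℤ) ≤ p * q := by positivity
  have e1 : (p : ℤ) ≤ p * r := by nlinarith
  have e2 : (p : ℤ) ≤ p * q := by nlinarith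
  have e3 : (2 : ℤ) * q ≤ p * q := by nlinarith
  have e4 : (2 : ℤ) * r ≤ p * r := by nlinarith
  classical
  have c4 : ∑ i ∈ Finset.range p, (if S4 (k - i) then (1 : ℤ) else 0) ≤ (κ + x + y + 1) - (κ + 1) := by
    apply D.card_window _ _ _ _ (by linarith)
    rintro i hi ⟨h1, h2, h3, h4⟩
    have e := D.hF (k - i)
    rw [h4] at e
    have b1 : D.p1 * (p * r) ≤ D.B (k - i) * (p * r) := by gcongr
    have b2 : D.p2 * (p * q) ≤ D.C (k - i) * (p * q) := by gcongr
    have b3 : D.B (k - i) * (p * r) ≤ (q - 1) * (p * r) := by gcongr; have := D.B1 (k - i); omega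
    have b4 : D.C (k - i) * (p * q) ≤ (r - 1) * (p * q) := by gcongr; have := D.C1 (k - i); omega
    have hi' : (i : ℤ) < p := by exact_mod_cast hi
    have hi0 : (0 : ℤ) ≤ i := by positivity
    have f1 : D.p1 * (p * r) = r * (p * q + 1 - q * x) := by linear_combination r * hp1
    have f2 : D.p2 * (p * q) = q * (p * r + 1 - r * y) := by linear_combination q * hp2
    constructor
    · apply lower; linarith
    · have := upper (D.A (k - i) - x - y) (by linarith)
      linarith
  have c4' : ∑ i ∈ Finset.range p, (if S4 (k - i) then (1 : ℤ) else 0) ≤ max 0 (p - (x + y)) := by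
    refine (D.card_window _ _ (x + y) (max (x + y) p) (by simp) ?_).trans (by omega)
    rintro i hi ⟨h1, h2, h3, h4⟩
    exact ⟨h1, lt_max_of_lt_right (D.A1 _)⟩
  have c2 : ∑ i ∈ Finset.range p, (if S2 (k - i) then (1 : ℤ) else 0) ≤ (κ + x + 1) - (κ + 1 - p + y) := by
    apply D.card_window _ _ _ _ (by linarith)
    rintro i hi ⟨h1, h2, h3, h4⟩
    have e := D.hF (k - i)
    rw [h4] at e
    have b1 : D.p1 * (p * r) ≤ D.B (k - i) * (p * r) := by gcongr
    have b2 : D.C (k - i) * (p * q) ≤ (D.p2 - 1) * (p * q) := by gcongr; omega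
    have b3 : D.B (k - i) * (p * r) ≤ (q - 1) * (p * r) := by gcongr; have := D.B1 (k - i); omega
    have b4 : 0 ≤ D.C (k - i) * (p * q) := mul_nonneg (D.C0 _) pq0
    have hi' : (i : ℤ) < p := by exact_mod_cast hi
    have hi0 : (0 : ℤ) ≤ i := by positivity
    have f1 : D.p1 * (p * r) = r * (p * q + 1 - q * x) := by linear_combination r * hp1
    have f2 : D.p2 * (p * q) = q * (p * r + 1 - r * y) := by linear_combination q * hp2
    constructor
    · have := lower (D.A (k - i) + p - y) (by linarith)
      linarith
    · have := upper (D.A (k - i) - x) (by linarith)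
      linarith
  have c2' : ∑ i ∈ Finset.range p, (if S2 (k - i) then (1 : ℤ) else 0) ≤ y - x := by
    refine D.card_window _ _ _ _ (by linarith) ?_
    rintro i hi ⟨h1, h2, h3, h4⟩
    exact h1
  have c1 : ∑ i ∈ Finset.range p, (if S1 (k - i) then (1 : ℤ) else 0) ≤ (κ + 1) - (κ + 1 - 2 * p + x + y) := by
    apply D.card_window _ _ _ _ (by linarith)
    rintro i hi ⟨h1, h2, h3, h4⟩
    have e := D.hF (k - i)
    rw [h4] at e
    have b1 : D.B (k - i) * (p * r) ≤ (D.p1 - 1) * (p * r) := by gcongr; omega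
    have b2 : D.C (k - i) * (p * q) ≤ (D.p2 - 1) * (p * q) := by gcongr; omega
    have b3 : 0 ≤ D.B (k - i) * (p * r) := mul_nonneg (D.B0 _) pr0
    have b4 : 0 ≤ D.C (k - i) * (p * q) := mul_nonneg (D.C0 _) pq0
    have hi' : (i : ℤ) < p := by exact_mod_cast hi
    have hi0 : (0 : ℤ) ≤ i := by positivity
    have f1 : D.p1 * (p * r) = r * (p * q + 1 - q * x) := by linear_combination r * hp1
    have f2 : D.p2 * (p * q) = q * (p * r + 1 - r * y) := by linear_combination q * hp2
    constructor
    · have := lower (D.A (k - i) + 2 * p - x - y) (by linarith)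
      linarith
    · have := upper (D.A (k - i)) (by linarith)
      linarith
  have c1' : ∑ i ∈ Finset.range p, (if S1 (k - i) then (1 : ℤ) else 0) ≤ max 0 (x + y - p) := by
    refine (D.card_window _ _ 0 (max 0 (x + y - p)) (by simp) ?_).trans (by omega)
    rintro i hi ⟨h1, h2, h3, h4⟩
    exact ⟨D.A0 _, lt_max_of_lt_right h1⟩
  have cI : ∀ lo hi : ℤ, lo ≤ hi → ∑ i ∈ Finset.range p, (if lo ≤ D.A (k - i) ∧ D.A (k - i) < hi then (1 : ℤ) else 0) ≤ hi - lo := by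
    intro lo hi h
    exact D.card_window _ (fun m => lo ≤ D.A m ∧ D.A m < hi) _ _ h (fun i _ h => h)
  constructor
  · intro hs
    have up : K ≤ ∑ i ∈ Finset.range p, ((if 0 ≤ D.A (k - i) ∧ D.A (k - i) < x then (1 : ℤ) else 0)
        + (if S4 (k - i) then (1 : ℤ) else 0)) := by
      rw [hK]
      apply Finset.sum_le_sum
      intro i hi
      rw [Finset.mem_range] at hi
      have ff := facts i hi _ rfl
      generalize (k : ℤ) - i = m at ff ⊢
      have g1 := D.F_q h1p h1q h1r m
      have g2 := D.F_r h1p h1q h1r m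
      have g3 := D.F_r h1p h1q h1r (m - q)
      rw [D.Bq] at g3
      have PT := ((pt_all hxy hy1 (D.A0 m) (D.A1 m) (D.Aq m) g1 g2 g3 ff _ rfl).1 hs).1
      exact PT
    have dn : -K ≤ ∑ i ∈ Finset.range p, ((if y ≤ D.A (k - i) ∧ D.A (k - i) < x + y then (1 : ℤ) else 0)
        + (if S2 (k - i) then (1 : ℤ) else 0)) := by
      rw [hK, ← Finset.sum_neg_distrib]
      apply Finset.sum_le_sum
      intro i hi
      rw [Finset.mem_range] at hi
      have ff := facts i hi _ rfl
      generalize (k : ℤ) - i = m at ff ⊢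
      have g1 := D.F_q h1p h1q h1r m
      have g2 := D.F_r h1p h1q h1r m
      have g3 := D.F_r h1p h1q h1r (m - q)
      rw [D.Bq] at g3
      have PT := ((pt_all hxy hy1 (D.A0 m) (D.A1 m) (D.Aq m) g1 g2 g3 ff _ rfl).1 hs).2
      exact PT
    rw [Finset.sum_add_distrib] at up dn
    have i1 := cI 0 x hx0.le
    have i2 := cI y (x + y) (by linarith)
    omega
  · intro hs
    have up : K ≤ ∑ i ∈ Finset.range p, ((if x + y - p ≤ D.A (k - i) ∧ D.A (k - i) < x then (1 : ℤ) else 0)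
        + (if S1 (k - i) then (1 : ℤ) else 0)) := by
      rw [hK]
      apply Finset.sum_le_sum
      intro i hi
      rw [Finset.mem_range] at hi
      have ff := facts i hi _ rfl
      generalize (k : ℤ) - i = m at ff ⊢
      have g1 := D.F_q h1p h1q h1r m
      have g2 := D.F_r h1p h1q h1r m
      have g3 := D.F_r h1p h1q h1r (m - q)
      rw [D.Bq] at g3
      have PT := ((pt_all hxy hy1 (D.A0 m) (D.A1 m) (D.Aq m) g1 g2 g3 ff _ rfl).2 hs).1
      exact PT
    have dn : -K ≤ ∑ i ∈ Finset.range p, ((if y ≤ D.A (k - i) ∧ D.A (k - i) < p then (1 : ℤ) else 0)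
        + (if S2 (k - i) then (1 : ℤ) else 0)) := by
      rw [hK, ← Finset.sum_neg_distrib]
      apply Finset.sum_le_sum
      intro i hi
      rw [Finset.mem_range] at hi
      have ff := facts i hi _ rfl
      generalize (k : ℤ) - i = m at ff ⊢
      have g1 := D.F_q h1p h1q h1r m
      have g2 := D.F_r h1p h1q h1r m
      have g3 := D.F_r h1p h1q h1r (m - q)
      rw [D.Bq] at g3
      have PT := ((pt_all hxy hy1 (D.A0 m) (D.A1 m) (D.Aq m) g1 g2 g3 ff _ rfl).2 hs).2
      exact PT
    rw [Finset.sum_add_distrib] at up dn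
    have i1 := cI (x + y - p) x (by linarith)
    have i2 := cI y p (by linarith)
    omega

/-- The pair of inverses `x, y` modulo `p` is bad. -/
def BadPair (p x y : ℕ) : Prop :=
  2 * p < 3 * (2 * min (min x (p - x)) (min y (p - y)) + max (min x (p - x)) (min y (p - y))) ∧
  3 * max (min x (p - x)) (min y (p - y)) < p

theorem coeff_le_of_not_bad {p q r : ℕ} (hp : p.Prime) (hq : q.Prime) (hr : r.Prime)
    (hpq : p ≠ q) (hpr : p ≠ r) (hqr : q ≠ r) (x y : ℕ) (hx0 : 0 < x) (hx1 : x < p) (hy0 : 0 < y) (hy1 : y < p)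
    (hx : (p : ℤ) ∣ q * x - 1) (hy : (p : ℤ) ∣ r * y - 1) (hb : ¬ BadPair p x y) (k : ℕ) :
    3 * ((cyclotomic (p * q * r) ℤ).coeff k).natAbs ≤ 2 * p := by
  wlog hxy : x ≤ y generalizing q r x y
  · have := this (q := r) (r := q) hr hq hpr hpq hqr.symm y x hy0 hy1 hx0 hx1 hy hx
      (by unfold BadPair at *; rwa [min_comm (min y (p - y)), max_comm (min y (p - y))]) (by omega)
    rwa [show p * q * r = p * r * q by ring]
  by_cases hk : k < p * q * r
  · obtain ⟨D⟩ := exists_data hp.one_lt hq.one_lt hr.one_lt ((Nat.coprime_primes hp hq).2 hpq)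
      ((Nat.coprime_primes hp hr).2 hpr) ((Nat.coprime_primes hq hr).2 hqr) x y
      (by exact_mod_cast hx0) (by exact_mod_cast hx1) (by exact_mod_cast hy0) (by exact_mod_cast hy1) hx hy
    have := D.coeff_bounds hp hq hr hpq hpr hqr (by exact_mod_cast hx0) (by exact_mod_cast hy1)
      (by exact_mod_cast hxy) k hk _ rfl
    unfold BadPair at hb
    generalize (cyclotomic (p * q * r) ℤ).coeff k = K at *
    omega
  · rw [coeff_eq_zero_of_natDegree_lt]
    · simp
    · rw [natDegree_cyclotomic]
      refine lt_of_lt_of_le (Nat.totient_lt _ ?_) (not_lt.1 hk)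
      have := hp.two_le
      have := hq.two_le
      have := hr.two_le
      have : 2 * 2 * 2 ≤ p * q * r := by gcongr
      omega

end NCB

namespace NCB

theorem sum_trunc (c V : ℕ) :
    ∑ v ∈ Finset.range V, 18 * (9 * v - c) ≤ (9 * V - c) ^ 2 := by
  induction V with
  | zero => simp
  | succ V ih =>
    rw [Finset.sum_range_succ]
    refine (Nat.add_le_add_right ih _).trans ?_
    by_cases h : 9 * V ≤ c
    · have : 9 * V - c = 0 := by omega
      rw [this]; simp
    · obtain ⟨s, hs⟩ := Nat.exists_eq_add_of_lt (not_le.1 h)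
      have h1 : 9 * V - c = s + 1 := by omega
      have h2 : 9 * (V + 1) - c = s + 10 := by omega
      rw [h1, h2]; nlinarith

def triT (p : ℕ) : Finset (ℕ × ℕ) :=
  (Finset.range ((p + 2) / 3) ×ˢ Finset.range p).filter
    fun w => w.2 ≤ w.1 ∧ 2 * p < 3 * (2 * w.2 + w.1)

theorem card_triT (p : ℕ) : 108 * (triT p).card ≤ (p + 9) ^ 2 + 108 * p := by
  have h1 : (triT p).card ≤ ∑ v ∈ Finset.range ((p + 2) / 3),
      ((Finset.range p).filter fun u => u ≤ v ∧ 2 * p < 3 * (2 * u + v)).card := by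
    rw [triT, Finset.card_filter, Finset.sum_product]
    apply Finset.sum_le_sum
    intro v _
    rw [Finset.card_filter]
  have h2 : ∀ v ∈ Finset.range ((p + 2) / 3),
      6 * ((Finset.range p).filter fun u => u ≤ v ∧ 2 * p < 3 * (2 * u + v)).card
        ≤ (9 * v - 2 * p) + 6 := by
    intro v hv
    rw [Finset.mem_range] at hv
    have : ((Finset.range p).filter fun u => u ≤ v ∧ 2 * p < 3 * (2 * u + v)) ⊆
        Finset.Icc ((2 * p - 3 * v) / 6 + 1) v := by
      intro u hu
      simp only [Finset.mem_filter, Finset.mem_range, Finset.mem_Icc] at *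
      omega
    have := Finset.card_le_card this
    rw [Nat.card_Icc] at this
    omega
  have h3 := Finset.sum_le_sum h2
  rw [← Finset.mul_sum, Finset.sum_add_distrib] at h3
  have h4 := sum_trunc (2 * p) ((p + 2) / 3)
  rw [← Finset.mul_sum] at h4
  have h5 : (9 * ((p + 2) / 3) - 2 * p) ^ 2 ≤ (p + 9) ^ 2 := by
    apply Nat.pow_le_pow_left; omega
  simp only [Finset.sum_const, Finset.card_range, smul_eq_mul] at h3
  have h6 : (p + 2) / 3 ≤ p := by omega
  omega

open Classical in
theorem card_bad (p : ℕ) :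
    (((Finset.range p ×ˢ Finset.range p).filter fun w => BadPair p w.1 w.2).card : ℝ)
      ≤ 2 / 27 * p ^ 2 + 16 * p := by
  have h : ((Finset.range p ×ˢ Finset.range p).filter fun w => BadPair p w.1 w.2) ⊆
      ((Finset.univ : Finset (Bool × Bool × Bool)) ×ˢ triT p).image
        (fun z => let a := if z.1.1 then z.2.1 else p - z.2.1
                  let b := if z.1.2.1 then z.2.2 else p - z.2.2
                  if z.1.2.2 then (a, b) else (b, a)) := by
    rintro ⟨x, y⟩ hw
    rw [Finset.mem_filter, Finset.mem_product, Finset.mem_range, Finset.mem_range] at hw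
    unfold BadPair at hw
    simp only at hw
    rw [Finset.mem_image]
    have hu := min_cases x (p - x)
    have hv := min_cases y (p - y)
    have hm := min_cases (min x (p - x)) (min y (p - y))
    have hM := max_cases (min x (p - x)) (min y (p - y))
    generalize max (min x (p - x)) (min y (p - y)) = M at *
    generalize min (min x (p - x)) (min y (p - y)) = m at *
    generalize hu' : min x (p - x) = u at *
    generalize hv' : min y (p - y) = v at *
    obtain ⟨⟨hxp, hyp⟩, hb1, hb2⟩ := hw
    have hpu : (x ≤ p - x ∧ u = x) ∨ (¬ x ≤ p - x ∧ p - u = x) := by omega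
    have hpv : (y ≤ p - y ∧ v = y) ∨ (¬ y ≤ p - y ∧ p - v = y) := by omega
    by_cases c : u ≤ v
    · refine ⟨((decide (y ≤ p - y), decide (x ≤ p - x), false), (v, u)), ?_, ?_⟩
      · simp only [triT, Finset.mem_product, Finset.mem_univ, Finset.mem_filter, Finset.mem_range, true_and]
        omega
      · simp only [decide_eq_true_eq, Prod.mk.injEq, Bool.false_eq_true, if_false]
        clear hu hv hu' hv' hm hM hb1 hb2; constructor <;> split_ifs <;> omega
    · refine ⟨((decide (x ≤ p - x), decide (y ≤ p - y), true), (u, v)), ?_, ?_⟩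
      · simp only [triT, Finset.mem_product, Finset.mem_univ, Finset.mem_filter, Finset.mem_range, true_and]
        omega
      · simp only [decide_eq_true_eq, if_true, Prod.mk.injEq]
        clear hu hv hu' hv' hm hM hb1 hb2; constructor <;> split_ifs <;> omega
  have h1 := (Finset.card_le_card h).trans Finset.card_image_le
  rw [Finset.card_product] at h1
  have h2 := card_triT p
  have h3 : (Finset.univ : Finset (Bool × Bool × Bool)).card = 8 := by decide
  rw [h3] at h1
  rcases Nat.eq_zero_or_pos p with rfl | hp
  · simp
  have h4 : 108 * ((Finset.range p ×ˢ Finset.range p).filter fun w => BadPair p w.1 w.2).card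
      ≤ 8 * ((p + 9) ^ 2 + 108 * p) := by omega
  have h5 : (108 : ℝ) * ((Finset.range p ×ˢ Finset.range p).filter fun w => BadPair p w.1 w.2).card
      ≤ 8 * ((p + 9) ^ 2 + 108 * p) := by exact_mod_cast h4
  have hp' : (1 : ℝ) ≤ p := by exact_mod_cast hp
  nlinarith

open Classical in
/-- indicator of the bad residue classes mod p -/
noncomputable def bet (p : ℕ) (a b : ZMod p) : ℝ := if BadPair p (a⁻¹).val (b⁻¹).val then 1 else 0

theorem bet_nonneg (p : ℕ) (a b : ZMod p) : 0 ≤ bet p a b := by unfold bet; split_ifs <;> norm_num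
theorem bet_le_one (p : ℕ) (a b : ZMod p) : bet p a b ≤ 1 := by unfold bet; split_ifs <;> norm_num

theorem sum_bet (p : ℕ) [Fact p.Prime] :
    ∑ a : ZMod p, ∑ b : ZMod p, bet p a b ≤ 2 / 27 * p ^ 2 + 16 * p := by
  classical
  refine le_trans (le_of_eq ?_) (card_bad p)
  have e1 : ∀ f : ZMod p → ℝ, ∑ a, f a⁻¹ = ∑ a, f a := fun f =>
    Equiv.sum_comp (Function.Involutive.toPerm (fun a : ZMod p => a⁻¹) inv_inv) f
  have e2 : ∀ f : ℕ → ℝ, ∑ a : ZMod p, f a.val = ∑ n ∈ Finset.range p, f n := by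
    intro f
    refine Finset.sum_nbij (fun a => a.val) ?_ ?_ ?_ ?_
    · intro a _; simpa using ZMod.val_lt a
    · intro a _ b _ h; exact ZMod.val_injective p h
    · intro n hn
      refine ⟨(n : ZMod p), by simp, ?_⟩
      exact ZMod.val_natCast_of_lt (by simpa using hn)
    · simp
  rw [Finset.card_filter, Finset.sum_product]
  push_cast
  rw [← e2 (fun x => ∑ y ∈ Finset.range p, (if BadPair p x y then (1 : ℝ) else 0))]
  rw [← e1]
  unfold bet
  simp only [inv_inv]
  refine Finset.sum_congr rfl fun a _ => ?_
  rw [← e2, ← e1]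
  simp only [inv_inv]

theorem coeff_le_of_bet {p q r : ℕ} (hp : p.Prime) (hq : q.Prime) (hr : r.Prime)
    (hpq : p ≠ q) (hpr : p ≠ r) (hqr : q ≠ r) (hb : bet p q r = 0) (k : ℕ) :
    3 * ((cyclotomic (p * q * r) ℤ).coeff k).natAbs ≤ 2 * p := by
  haveI := Fact.mk hp
  have nz : ∀ s : ℕ, s.Prime → p ≠ s → (s : ZMod p) ≠ 0 := by
    intro s hs h h0
    rw [ZMod.natCast_eq_zero_iff] at h0
    exact h ((Nat.prime_dvd_prime_iff_eq hp hs).1 h0)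
  have dv : ∀ s : ℕ, s.Prime → p ≠ s → (p : ℤ) ∣ s * (((s : ZMod p)⁻¹).val : ℕ) - 1 := by
    intro s hs h
    rw [← ZMod.intCast_zmod_eq_zero_iff_dvd]
    push_cast
    rw [ZMod.natCast_zmod_val, mul_inv_cancel₀ (nz s hs h), sub_self]
  have ps : ∀ s : ℕ, s.Prime → p ≠ s → 0 < ((s : ZMod p)⁻¹).val := by
    intro s hs h
    rw [ZMod.val_pos]; exact inv_ne_zero (nz s hs h)
  refine coeff_le_of_not_bad hp hq hr hpq hpr hqr _ _ (ps q hq hpq) (ZMod.val_lt _) (ps r hr hpr) (ZMod.val_lt _)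
    (dv q hq hpq) (dv r hr hpr) ?_ k
  intro h
  simp [bet, h] at hb

end NCB

namespace NCB

theorem count_class (m a N : ℕ) (hm : 0 < m) (v : ℕ) :
    |((((Finset.Ico a (a + N)).filter fun n => n ≡ v [MOD m]).card : ℝ)) - (N : ℝ) / m| ≤ 1 := by
  have h := Nat.Ico_filter_modEq_card a (a + N) hm v
  have hm' : (0 : ℚ) < m := by exact_mod_cast hm
  have e : (((a + N : ℕ) : ℚ) - v) / m = ((a : ℚ) - v) / m + (N : ℚ) / m := by push_cast; ring
  rw [e] at h
  generalize ((a : ℚ) - v) / m = s at h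
  have hN : (0 : ℚ) ≤ (N : ℚ) / m := by positivity
  have hmono : ⌈s⌉ ≤ ⌈s + (N : ℚ) / m⌉ := Int.ceil_mono (by linarith)
  rw [max_eq_left (by linarith)] at h
  have h1 := Int.le_ceil s
  have h2 := Int.ceil_lt_add_one s
  have h3 := Int.le_ceil (s + (N : ℚ) / m)
  have h4 := Int.ceil_lt_add_one (s + (N : ℚ) / m)
  have h5 : ((((Finset.Ico a (a + N)).filter fun n => n ≡ v [MOD m]).card : ℚ)) =
     (⌈s + (N : ℚ) / m⌉ : ℚ) - ⌈s⌉ := by exact_mod_cast h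
  have h6 : |((((Finset.Ico a (a + N)).filter fun n => n ≡ v [MOD m]).card : ℚ)) - (N : ℚ) / m| ≤ 1 := by
    rw [h5, abs_le]; constructor <;> linarith
  have h7 := (Rat.cast_le (K := ℝ)).2 h6
  push_cast at h7
  exact h7

theorem oneD_mod (m : ℕ) [NeZero m] (G : ZMod m → ℝ) (C : ℝ) (hG : ∀ z, |G z| ≤ C) (a N : ℕ) :
    |∑ n ∈ Finset.Ico a (a + N), G n - (N : ℝ) / m * ∑ z, G z| ≤ m * C := by
  have e : ∑ n ∈ Finset.Ico a (a + N), G n =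
      ∑ z : ZMod m, (((Finset.Ico a (a + N)).filter fun n => n ≡ z.val [MOD m]).card : ℝ) * G z := by
    rw [← Finset.sum_fiberwise (Finset.Ico a (a + N)) (fun n : ℕ => (n : ZMod m))]
    refine Finset.sum_congr rfl fun z _ => ?_
    have : ((Finset.Ico a (a + N)).filter fun n => n ≡ z.val [MOD m]) =
      ((Finset.Ico a (a + N)).filter fun n : ℕ => (n : ZMod m) = z) := by
      refine Finset.filter_congr fun n _ => ?_
      rw [← ZMod.natCast_eq_natCast_iff, ZMod.natCast_zmod_val]
    rw [this, ← nsmul_eq_mul, ← Finset.sum_const]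
    refine Finset.sum_congr rfl fun n hn => ?_
    rw [(Finset.mem_filter.1 hn).2]
  rw [e, Finset.mul_sum, ← Finset.sum_sub_distrib]
  refine (Finset.abs_sum_le_sum_abs _ _).trans ?_
  have : ∀ z ∈ (Finset.univ : Finset (ZMod m)),
      |(((Finset.Ico a (a + N)).filter fun n => n ≡ z.val [MOD m]).card : ℝ) * G z - (N : ℝ) / m * G z| ≤ C := by
    intro z _
    rw [← sub_mul, abs_mul]
    have := count_class m a N (NeZero.pos m) z.val
    nlinarith [hG z, abs_nonneg (G z)]
  refine (Finset.sum_le_sum this).trans ?_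
  simp [ZMod.card]

theorem oneD {p p' : ℕ} [NeZero p] [NeZero p'] (h : p.Coprime p') (g : ZMod p → ZMod p' → ℝ) (C : ℝ)
    (hg : ∀ c c', |g c c'| ≤ C) (a N : ℕ) :
    |∑ n ∈ Finset.Ico a (a + N), g n n - (N : ℝ) / (p * p') * ∑ c, ∑ c', g c c'| ≤ p * p' * C := by
  have := oneD_mod (p * p') (fun z => g (ZMod.chineseRemainder h z).1 (ZMod.chineseRemainder h z).2) C
    (fun z => hg _ _) a N
  have e : ∑ z : ZMod (p * p'), g (ZMod.chineseRemainder h z).1 (ZMod.chineseRemainder h z).2 =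
      ∑ c, ∑ c', g c c' := by
    rw [← Fintype.sum_prod_type']
    exact Equiv.sum_comp (ZMod.chineseRemainder h).toEquiv (fun w : ZMod p × ZMod p' => g w.1 w.2)
  rw [e] at this
  push_cast at this
  simpa using this

theorem twoD {p p' : ℕ} [NeZero p] [NeZero p'] (h : p.Coprime p') (f : ZMod p → ZMod p → ℝ)
    (f' : ZMod p' → ZMod p' → ℝ) (hf : ∀ a b, |f a b| ≤ 1) (hf' : ∀ a b, |f' a b| ≤ 1)
    (h0 : ∑ a, ∑ b, f a b = 0) (a N b K : ℕ) :
    |∑ q ∈ Finset.Ico a (a + N), ∑ r ∈ Finset.Ico b (b + K), f q r * f' q r| ≤ p * p' * (N + K) := by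
  have pp : (0 : ℝ) < p := by exact_mod_cast NeZero.pos p
  have pp' : (0 : ℝ) < p' := by exact_mod_cast NeZero.pos p'
  have s1 : ∀ q : ℕ, |∑ r ∈ Finset.Ico b (b + K), f q r * f' q r -
      (K : ℝ) / (p * p') * ((∑ c, f q c) * ∑ c', f' q c')| ≤ p * p' := by
    intro q
    have := oneD h (fun c c' => f q c * f' q c') 1 (fun c c' => by
      rw [abs_mul]; exact mul_le_one₀ (hf _ _) (abs_nonneg _) (hf' _ _)) b K
    rw [Finset.sum_mul_sum]
    simpa using this
  have b1 : ∀ q, |∑ c, f q c| ≤ p := fun q => by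
    refine (Finset.abs_sum_le_sum_abs _ _).trans ((Finset.sum_le_sum fun c _ => hf q c).trans ?_)
    simp [ZMod.card]
  have b2 : ∀ q, |∑ c, f' q c| ≤ p' := fun q => by
    refine (Finset.abs_sum_le_sum_abs _ _).trans ((Finset.sum_le_sum fun c _ => hf' q c).trans ?_)
    simp [ZMod.card]
  have s2 := oneD h (fun c c' => (∑ d, f c d) * ∑ d', f' c' d') (p * p') (fun c c' => by
      rw [abs_mul]; exact mul_le_mul (b1 _) (b2 _) (abs_nonneg _) pp.le) a N
  rw [← Finset.sum_mul_sum, h0, zero_mul, mul_zero, sub_zero] at s2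
  have s3 : |∑ q ∈ Finset.Ico a (a + N), ∑ r ∈ Finset.Ico b (b + K), f q r * f' q r -
      (K : ℝ) / (p * p') * ∑ q ∈ Finset.Ico a (a + N), ((∑ c, f q c) * ∑ c', f' q c')| ≤ N * (p * p') := by
    rw [Finset.mul_sum, ← Finset.sum_sub_distrib]
    refine (Finset.abs_sum_le_sum_abs _ _).trans ((Finset.sum_le_sum fun q _ => s1 q).trans ?_)
    simp
  have s4 : |(K : ℝ) / (p * p') * ∑ q ∈ Finset.Ico a (a + N), ((∑ c, f q c) * ∑ c', f' q c')| ≤ K * (p * p') := by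
    rw [abs_mul, abs_of_nonneg (by positivity)]
    calc _ ≤ (K : ℝ) / (p * p') * (p * p' * (p * p')) := by gcongr
      _ = _ := by field_simp
  have := abs_sub_abs_le_abs_sub (∑ q ∈ Finset.Ico a (a + N), ∑ r ∈ Finset.Ico b (b + K), f q r * f' q r)
    ((K : ℝ) / (p * p') * ∑ q ∈ Finset.Ico a (a + N), ((∑ c, f q c) * ∑ c', f' q c'))
  nlinarith

theorem duality {ι κ : Type*} (P : Finset ι) (L A : Finset κ) (hA : A ⊆ L) (φ : ι → κ → ℝ)
    (h1 : ∀ p ∈ P, ∀ w, |φ p w| ≤ 1) (E : ℝ) (hE : 0 ≤ E)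
    (h2 : ∀ p ∈ P, ∀ p' ∈ P, p ≠ p' → |∑ w ∈ L, φ p w * φ p' w| ≤ E) :
    ∑ p ∈ P, (∑ w ∈ A, φ p w) ^ 2 ≤ L.card * (L.card + P.card * E) := by
  classical
  set D : ι → ℝ := fun p => ∑ w ∈ A, φ p w with hD
  set S := ∑ p ∈ P, (D p) ^ 2 with hS
  have hS0 : 0 ≤ S := Finset.sum_nonneg fun p _ => sq_nonneg _
  have e1 : S = ∑ w ∈ A, ∑ p ∈ P, D p * φ p w := by
    rw [Finset.sum_comm, hS]
    refine Finset.sum_congr rfl fun p _ => ?_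
    rw [← Finset.mul_sum, sq]
  have e2 : S ^ 2 ≤ A.card * ∑ w ∈ A, (∑ p ∈ P, D p * φ p w) ^ 2 := by
    rw [e1]; exact sq_sum_le_card_mul_sum_sq
  have e3 : ∑ w ∈ A, (∑ p ∈ P, D p * φ p w) ^ 2 ≤ ∑ w ∈ L, (∑ p ∈ P, D p * φ p w) ^ 2 :=
    Finset.sum_le_sum_of_subset_of_nonneg hA fun _ _ _ => sq_nonneg _
  have e4 : ∑ w ∈ L, (∑ p ∈ P, D p * φ p w) ^ 2 =
      ∑ p ∈ P, ∑ p' ∈ P, D p * D p' * ∑ w ∈ L, φ p w * φ p' w := by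
    simp_rw [sq, Finset.sum_mul_sum]
    rw [Finset.sum_comm]
    refine Finset.sum_congr rfl fun p _ => ?_
    rw [Finset.sum_comm]
    refine Finset.sum_congr rfl fun p' _ => ?_
    rw [Finset.mul_sum]
    refine Finset.sum_congr rfl fun w _ => ?_
    ring
  have e5 : ∀ p ∈ P, ∀ p' ∈ P, D p * D p' * ∑ w ∈ L, φ p w * φ p' w ≤
      (if p = p' then (D p) ^ 2 * L.card else 0) + ((D p) ^ 2 + (D p') ^ 2) / 2 * E := by
    intro p hp p' hp'
    split_ifs with hpp
    · subst hpp
      have : ∑ w ∈ L, φ p w * φ p w ≤ L.card := by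
        rw [← nsmul_one, ← Finset.sum_const]
        refine Finset.sum_le_sum fun w _ => ?_
        have := abs_le.1 (h1 p hp w)
        nlinarith
      have h3 := mul_le_mul_of_nonneg_left this (sq_nonneg (D p))
      have h4 : 0 ≤ ((D p) ^ 2 + (D p) ^ 2) / 2 * E := by positivity
      linarith [sq (D p)]
    · have h3 := h2 p hp p' hp' hpp
      rw [zero_add]
      calc _ ≤ |D p * D p' * ∑ w ∈ L, φ p w * φ p' w| := le_abs_self _
        _ = |D p * D p'| * |∑ w ∈ L, φ p w * φ p' w| := abs_mul _ _
        _ ≤ ((D p) ^ 2 + (D p') ^ 2) / 2 * E := by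
          gcongr
          rw [abs_le]; constructor <;> nlinarith [sq_nonneg (D p - D p'), sq_nonneg (D p + D p')]
  have e6 : ∑ p ∈ P, ∑ p' ∈ P, D p * D p' * ∑ w ∈ L, φ p w * φ p' w ≤ S * (L.card + P.card * E) := by
    refine (Finset.sum_le_sum fun p hp => Finset.sum_le_sum fun p' hp' => e5 p hp p' hp').trans (le_of_eq ?_)
    simp_rw [Finset.sum_add_distrib]
    have f1 : ∑ p ∈ P, ∑ p' ∈ P, (if p = p' then (D p) ^ 2 * (L.card : ℝ) else 0) = S * L.card := by
      rw [hS, Finset.sum_mul]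
      refine Finset.sum_congr rfl fun p hp => ?_
      simp [hp]
    have f2 : ∑ p ∈ P, ∑ p' ∈ P, ((D p) ^ 2 + (D p') ^ 2) / 2 * E = S * (P.card * E) := by
      simp_rw [← Finset.sum_mul, ← Finset.sum_div, Finset.sum_add_distrib]
      simp only [Finset.sum_const, nsmul_eq_mul, ← Finset.mul_sum]
      rw [← hS]; ring
    rw [f1, f2]; ring
  have hAL : (A.card : ℝ) ≤ L.card := by exact_mod_cast Finset.card_le_card hA
  have hE' : 0 ≤ (L.card : ℝ) + P.card * E := by positivity
  have e7 : S ^ 2 ≤ L.card * (S * (L.card + P.card * E)) := by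
    refine e2.trans (mul_le_mul hAL ((e3.trans e4.le).trans e6) (Finset.sum_nonneg fun _ _ => sq_nonneg _)
      (Nat.cast_nonneg _))
  rcases hS0.eq_or_lt with h | h
  · rw [← h]; positivity
  · have : S * S ≤ S * (L.card * (L.card + P.card * E)) := by nlinarith
    exact le_of_mul_le_mul_left this h

/-- density of bad pairs mod p -/
noncomputable def kap (p : ℕ) : ℝ :=
  (∑ x ∈ Finset.range p, ∑ y ∈ Finset.range p, bet p x y) / (p : ℝ) ^ 2

theorem sum_range_zmod (p : ℕ) [NeZero p] (f : ZMod p → ℝ) :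
    ∑ n ∈ Finset.range p, f n = ∑ a, f a := by
  symm
  refine Finset.sum_nbij (fun a => a.val) ?_ ?_ ?_ ?_
  · intro a _; simpa using ZMod.val_lt a
  · intro a _ b _ h; exact ZMod.val_injective p h
  · intro n hn
    refine ⟨(n : ZMod p), by simp, ?_⟩
    exact ZMod.val_natCast_of_lt (by simpa using hn)
  · simp

theorem kap_eq (p : ℕ) [NeZero p] : kap p = (∑ a, ∑ b, bet p a b) / (p : ℝ) ^ 2 := by
  rw [kap, ← sum_range_zmod p (fun a => ∑ b, bet p a b)]
  simp_rw [← sum_range_zmod p]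

theorem kap_nonneg (p : ℕ) : 0 ≤ kap p := by
  unfold kap
  exact div_nonneg (Finset.sum_nonneg fun x _ => Finset.sum_nonneg fun y _ => bet_nonneg p x y) (sq_nonneg _)

theorem kap_le_one (p : ℕ) (hp : 0 < p) : kap p ≤ 1 := by
  unfold kap
  have hp' : (0 : ℝ) < p := by exact_mod_cast hp
  rw [div_le_one (by positivity)]
  calc _ ≤ ∑ x ∈ Finset.range p, ∑ y ∈ Finset.range p, (1 : ℝ) :=
        Finset.sum_le_sum fun x _ => Finset.sum_le_sum fun y _ => bet_le_one p x y
    _ ≤ _ := by simp [sq]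

theorem kap_le (p : ℕ) (hp : p.Prime) : kap p ≤ 2 / 27 + 16 / p := by
  have := Fact.mk hp
  have hp' : (0 : ℝ) < p := by exact_mod_cast hp.pos
  rw [kap_eq, div_le_iff₀ (by positivity)]
  refine (sum_bet p).trans (le_of_eq ?_)
  field_simp

theorem dispersion (P : Finset ℕ) (hP : ∀ p ∈ P, p.Prime) (M : ℝ) (hM : ∀ p ∈ P, (p : ℝ) ≤ M) (hM0 : 0 ≤ M)
    (a N b K : ℕ) (A : Finset (ℕ × ℕ)) (hA : A ⊆ Finset.Ico a (a + N) ×ˢ Finset.Ico b (b + K)) :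
    (∑ p ∈ P, |∑ w ∈ A, (bet p w.1 w.2 - kap p)|) ^ 2 ≤
      P.card * ((N * K : ℝ) * (N * K + P.card * (M ^ 2 * (N + K)))) := by
  have key := duality P (Finset.Ico a (a + N) ×ˢ Finset.Ico b (b + K)) A hA
    (fun p w => bet p w.1 w.2 - kap p) (by
      intro p hp w
      have h1 := bet_nonneg p w.1 w.2
      have h2 := bet_le_one p w.1 w.2
      have h3 := kap_nonneg p
      have h4 := kap_le_one p (hP p hp).pos
      rw [abs_le]; constructor <;> linarith) (M ^ 2 * (N + K)) (by positivity) (by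
      intro p hp p' hp' hne
      have := Fact.mk (hP p hp)
      have := Fact.mk (hP p' hp')
      have hb : ∀ s : ℕ, s.Prime → ∀ a b : ZMod s, |bet s a b - kap s| ≤ 1 := by
        intro s hs a b
        have h1 := bet_nonneg s a b
        have h2 := bet_le_one s a b
        have h3 := kap_nonneg s
        have h4 := kap_le_one s hs.pos
        rw [abs_le]; constructor <;> linarith
      have hp0 : (0 : ℝ) < p := by exact_mod_cast (hP p hp).pos
      have := twoD ((Nat.coprime_primes (hP p hp) (hP p' hp')).2 hne) (fun a b => bet p a b - kap p)
        (fun a b => bet p' a b - kap p') (hb p (hP p hp)) (hb p' (hP p' hp')) (by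
          simp_rw [Finset.sum_sub_distrib]
          rw [kap_eq]
          simp [ZMod.card]
          field_simp
          simp) a N b K
      rw [Finset.sum_product]
      refine this.trans ?_
      have := hM p hp
      have := hM p' hp'
      rw [sq]
      gcongr)
  rw [Finset.card_product, Nat.card_Ico, Nat.card_Ico] at key
  simp only [add_tsub_cancel_left] at key
  push_cast at key
  calc (∑ p ∈ P, |∑ w ∈ A, (bet p w.1 w.2 - kap p)|) ^ 2
      ≤ P.card * ∑ p ∈ P, |∑ w ∈ A, (bet p w.1 w.2 - kap p)| ^ 2 := sq_sum_le_card_mul_sum_sq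
    _ ≤ _ := by
      simp_rw [sq_abs]
      exact mul_le_mul_of_nonneg_left key (Nat.cast_nonneg _)

end NCB

namespace NCB

theorem pi_upper (y : ℕ) : (Nat.primeCounting y : ℝ) ≤ 8 * y / Nat.log 2 y := by
  rcases lt_or_ge y 2 with h | h
  · have : Nat.primeCounting y = 0 := Nat.primeCounting_eq_zero_iff.2 (by omega)
    rw [this]; push_cast; positivity
  have hy : (2 : ℝ) ≤ y := by exact_mod_cast h
  have hy0 : (0 : ℝ) < y := by linarith
  have key := Chebyshev.pi_le_log4_mul_div (x := y) (by linarith)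
  rw [Nat.floor_natCast] at key
  have hl : 0 < Nat.log 2 y := Nat.log_pos (by norm_num) h
  have hl' : (0 : ℝ) < Nat.log 2 y := by exact_mod_cast hl
  have h2 : (0.69 : ℝ) < log 2 := by linarith [Real.log_two_gt_d9]
  have hlog : Nat.log 2 y * log 2 ≤ log y := by
    rw [← Real.log_pow]
    apply Real.log_le_log (by positivity)
    exact_mod_cast Nat.pow_log_le_self 2 (by omega)
  have hly : 0 < log y := by nlinarith
  have h4 : log 4 = 2 * log 2 := by
    rw [show (4 : ℝ) = 2 ^ 2 by norm_num, Real.log_pow]; norm_num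
  rw [Real.log_sqrt hy0.le, h4] at key
  have hs : √y * √y = y := Real.mul_self_sqrt hy0.le
  have hs0 : 0 < √y := Real.sqrt_pos.2 hy0
  have hs1 : log y ≤ 2 * √y := by
    have : log √y ≤ √y - 1 := Real.log_le_sub_one_of_pos hs0
    rw [Real.log_sqrt hy0.le] at this
    linarith
  have h5 : √y ≤ 2 * y / log y := by
    rw [le_div_iff₀ hly]; nlinarith
  have h6 : 2 * log 2 * y / (log y / 2) = 4 * log 2 * y / log y := by field_simp; ring
  rw [h6] at key
  have h7 : (Nat.primeCounting y : ℝ) ≤ (4 * log 2 + 2) * y / log y := by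
    calc _ ≤ _ := key
      _ ≤ 4 * log 2 * y / log y + 2 * y / log y := by linarith
      _ = _ := by ring
  refine h7.trans ?_
  rw [div_le_div_iff₀ hly hl']
  have : (4 * log 2 + 2) ≤ 8 * log 2 := by linarith
  calc (4 * log 2 + 2) * y * (Nat.log 2 y) ≤ 8 * log 2 * y * (Nat.log 2 y) := by gcongr
    _ = 8 * y * (Nat.log 2 y * log 2) := by ring
    _ ≤ _ := by gcongr

theorem theta_low (n : ℕ) (hn : 10 ^ 6 ≤ n) : (log 2 - 3 / 8) * n ≤ Chebyshev.theta n := by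
  have key := Chebyshev.theta_ge n
  have hn' : (10 ^ 6 : ℝ) ≤ n := by exact_mod_cast hn
  set y : ℝ := √√n with hy
  have hn0 : (0 : ℝ) < n := by linarith
  have hs : √n = y ^ 2 := by rw [hy, Real.sq_sqrt (Real.sqrt_nonneg _)]
  have hx : (n : ℝ) = y ^ 4 := by
    rw [show y ^ 4 = (y ^ 2) ^ 2 by ring, ← hs, Real.sq_sqrt hn0.le]
  have hy0 : 0 < y := Real.sqrt_pos.2 (Real.sqrt_pos.2 hn0)
  have hy30 : 30 ≤ y := by
    by_contra h
    push Not at h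
    have : y ^ 4 < 30 ^ 4 := by gcongr
    rw [← hx] at this; norm_num at this; linarith
  have l1 : log n ≤ 4 * y := by
    rw [hx, Real.log_pow]
    have := Real.log_le_sub_one_of_pos hy0
    push_cast; linarith
  have l2 : log (n + 1) ≤ 4 * y + 1 := by
    have : log ((n : ℝ) + 1) ≤ log (2 * n) := Real.log_le_log (by linarith) (by linarith)
    rw [Real.log_mul (by norm_num) hn0.ne'] at this
    linarith [Real.log_two_lt_d9]
  rw [hs] at key
  have l3 : 2 * y ^ 2 * log n ≤ 8 * y ^ 3 := by nlinarith [sq_nonneg y]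
  have l4 : 8 * y ^ 3 + 4 * y + 1 ≤ 3 / 8 * y ^ 4 := by
    have a1 : 30 * y ^ 3 ≤ y ^ 4 := by
      have : 0 < y ^ 3 := by positivity
      nlinarith
    have a2 : 900 * y ≤ y ^ 3 := by nlinarith [mul_pos hy0 hy0]
    nlinarith
  rw [← hx] at l4
  nlinarith

theorem pi_lower (n : ℕ) (hn : 10 ^ 6 ≤ n) : 3 / 10 * n / log n ≤ (Nat.primeCounting n : ℝ) := by
  have h1 := theta_low n hn
  have h2 := Chebyshev.theta_le_pi_mul_log n
  have hn' : (10 ^ 6 : ℝ) ≤ n := by exact_mod_cast hn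
  have : 0 < log n := Real.log_pos (by linarith)
  rw [div_le_iff₀ this]
  have := Real.log_two_gt_d9
  nlinarith

/-- sum of reciprocals of primes in [a,b) -/
noncomputable def rp (a b : ℕ) : ℝ := ∑ p ∈ (Finset.Ico a b).filter Nat.Prime, (1 : ℝ) / p

theorem rp_nonneg (a b : ℕ) : 0 ≤ rp a b := Finset.sum_nonneg fun _ _ => by positivity

theorem rp_mono {a a' b b' : ℕ} (h : a' ≤ a) (h' : b ≤ b') : rp a b ≤ rp a' b' := by
  unfold rp
  refine Finset.sum_le_sum_of_subset_of_nonneg ?_ fun _ _ _ => by positivity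
  apply Finset.filter_subset_filter
  exact Finset.Ico_subset_Ico h h'

theorem rp_split {a b c : ℕ} (h : a ≤ b) (h' : b ≤ c) : rp a c = rp a b + rp b c := by
  unfold rp
  simp_rw [Finset.sum_filter]
  rw [Finset.sum_Ico_consecutive _ h h']

theorem rp_block (i : ℕ) : rp (2 ^ i) (2 ^ (i + 1)) ≤ 16 / (i + 1) := by
  have h := pi_upper (2 ^ (i + 1))
  rw [Nat.log_pow (by norm_num)] at h
  have hc : ((Finset.Ico (2 ^ i) (2 ^ (i + 1))).filter Nat.Prime).card ≤ Nat.primeCounting (2 ^ (i + 1)) := by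
    rw [← Nat.primesLE_card_eq_primeCounting]
    apply Finset.card_le_card
    intro p hp
    simp only [Finset.mem_filter, Finset.mem_Ico] at hp
    rw [Nat.mem_primesLE]
    exact ⟨hp.1.2.le, hp.2⟩
  have h1 : rp (2 ^ i) (2 ^ (i + 1)) ≤
      ((Finset.Ico (2 ^ i) (2 ^ (i + 1))).filter Nat.Prime).card * (1 / 2 ^ i : ℝ) := by
    unfold rp
    rw [← nsmul_eq_mul, ← Finset.sum_const]
    refine Finset.sum_le_sum fun p hp => ?_
    simp only [Finset.mem_filter, Finset.mem_Ico] at hp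
    have : (2 : ℝ) ^ i ≤ p := by exact_mod_cast hp.1.1
    gcongr
  have hc' : (((Finset.Ico (2 ^ i) (2 ^ (i + 1))).filter Nat.Prime).card : ℝ) ≤
    Nat.primeCounting (2 ^ (i + 1)) := by exact_mod_cast hc
  calc _ ≤ _ := h1
    _ ≤ (8 * ((2 ^ (i + 1) : ℕ) : ℝ) / ((i + 1 : ℕ) : ℝ)) * (1 / 2 ^ i : ℝ) := by
      gcongr; exact hc'.trans h
    _ = _ := by push_cast; field_simp; ring

theorem rp_dyadic (a b : ℕ) (h : a ≤ b) : rp (2 ^ a) (2 ^ b) ≤ ∑ i ∈ Finset.Ico a b, 16 / ((i : ℝ) + 1) := by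
  induction b, h using Nat.le_induction with
  | base => simp [rp]
  | succ b hb ih =>
    rw [Finset.sum_Ico_succ_top hb,
      rp_split (Nat.pow_le_pow_right (by norm_num) hb) (Nat.pow_le_pow_right (by norm_num) (Nat.le_succ b))]
    exact add_le_add ih (rp_block b)

theorem rp_window (a b : ℕ) (ha : 1 ≤ a) (h : a ≤ b) : rp (2 ^ a) (2 ^ b) ≤ 16 * (log b - log a) := by
  refine (rp_dyadic a b h).trans ?_
  induction b, h using Nat.le_induction with
  | base => simp
  | succ b hb ih =>
    rw [Finset.sum_Ico_succ_top hb]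
    have hb' : (0 : ℝ) < b := by exact_mod_cast (show 0 < b by omega)
    have h1 := Real.one_sub_inv_le_log_of_pos (x := ((b : ℝ) + 1) / b) (by positivity)
    rw [Real.log_div (by positivity) (by positivity)] at h1
    have h2 : 1 - (((b : ℝ) + 1) / b)⁻¹ = 1 / (b + 1) := by field_simp; ring
    rw [h2] at h1
    push_cast
    have h3 : (16 : ℝ) / (b + 1) = 16 * (1 / (b + 1)) := by ring
    linarith

theorem rp_upper (b : ℕ) (hb : 1 ≤ b) : rp 0 (2 ^ b) ≤ 16 * log b := by
  have h := rp_window 1 b le_rfl hb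
  have h0 : rp 0 (2 ^ 1) = 0 := by
    unfold rp
    rw [Finset.sum_eq_zero]
    intro p hp
    simp only [Finset.mem_filter, Finset.mem_Ico] at hp
    have := hp.2.two_le
    omega
  rw [rp_split (a := 0) (b := 2 ^ 1) (by norm_num) (Nat.pow_le_pow_right (by norm_num) hb), h0]
  simpa using h

theorem rp_block8 (i : ℕ) (hi : 7 ≤ i) : 1 / (24 * ((i : ℝ) + 1)) ≤ rp (8 ^ i + 1) (8 ^ (i + 1) + 1) := by
  have hbig : 10 ^ 6 ≤ 8 ^ (i + 1) := le_trans (by norm_num) (Nat.pow_le_pow_right (by norm_num) (show 8 ≤ i + 1 by omega))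
  have h1 := theta_low _ hbig
  have h2 := Chebyshev.theta_le_log4_mul_x (x := ((8 ^ i : ℕ) : ℝ)) (by positivity)
  have h4 : log 4 = 2 * log 2 := by
    rw [show (4 : ℝ) = 2 ^ 2 by norm_num, Real.log_pow]; norm_num
  have h8 : log 8 = 3 * log 2 := by
    rw [show (8 : ℝ) = 2 ^ 3 by norm_num, Real.log_pow]; norm_num
  have hl1 := Real.log_two_gt_d9
  have hl2 := Real.log_two_lt_d9
  rw [h4] at h2
  have hd : Chebyshev.theta ((8 ^ (i + 1) : ℕ) : ℝ) - Chebyshev.theta ((8 ^ i : ℕ) : ℝ) =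
      ∑ p ∈ (Finset.Ico (8 ^ i + 1) (8 ^ (i + 1) + 1)).filter Nat.Prime, log p := by
    unfold Chebyshev.theta
    rw [Nat.floor_natCast, Nat.floor_natCast]
    have e : ∀ m : ℕ, Finset.Ioc 0 m = Finset.Ico 1 (m + 1) := fun m => by ext; simp; omega
    rw [e, e]
    simp_rw [Finset.sum_filter]
    rw [← Finset.sum_Ico_consecutive _ (show 1 ≤ 8 ^ i + 1 by omega)
      (show 8 ^ i + 1 ≤ 8 ^ (i + 1) + 1 by have := Nat.pow_le_pow_right (show 0 < 8 by norm_num) (Nat.le_succ i); omega)]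
    ring
  have hlow : (8 : ℝ) ^ i ≤ ∑ p ∈ (Finset.Ico (8 ^ i + 1) (8 ^ (i + 1) + 1)).filter Nat.Prime, log p := by
    rw [← hd]
    push_cast at h1 h2 ⊢
    have : (0 : ℝ) < 8 ^ i := by positivity
    rw [pow_succ] at h1 ⊢
    nlinarith
  have hup : ∑ p ∈ (Finset.Ico (8 ^ i + 1) (8 ^ (i + 1) + 1)).filter Nat.Prime, log p ≤
      (8 ^ (i + 1) * ((i + 1) * log 8)) * rp (8 ^ i + 1) (8 ^ (i + 1) + 1) := by
    unfold rp
    rw [Finset.mul_sum]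
    refine Finset.sum_le_sum fun p hp => ?_
    simp only [Finset.mem_filter, Finset.mem_Ico] at hp
    have hp0 : (0 : ℝ) < p := by exact_mod_cast hp.2.pos
    have hple : (p : ℝ) ≤ 8 ^ (i + 1) := by exact_mod_cast (show p ≤ 8 ^ (i + 1) by omega)
    have hlp : log p ≤ (i + 1) * log 8 := by
      have := Real.log_le_log hp0 hple
      rw [Real.log_pow] at this
      exact_mod_cast this
    rw [mul_one_div, le_div_iff₀ hp0, mul_comm]
    exact mul_le_mul hple hlp (Real.log_nonneg (by exact_mod_cast hp.2.one_le)) (by positivity)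
  have hfin := hlow.trans hup
  have hr := rp_nonneg (8 ^ i + 1) (8 ^ (i + 1) + 1)
  rw [div_le_iff₀ (by positivity)]
  have hl8 : log 8 ≤ 3 := by rw [h8]; linarith
  have h9 : (8 : ℝ) ^ i ≤ 8 ^ i * (rp (8 ^ i + 1) (8 ^ (i + 1) + 1) * (24 * ((i : ℝ) + 1))) := by
    refine hfin.trans ?_
    calc _ ≤ (8 ^ (i + 1) * (((i : ℝ) + 1) * 3)) * rp (8 ^ i + 1) (8 ^ (i + 1) + 1) := by gcongr
      _ = _ := by rw [pow_succ]; ring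
  have : (0 : ℝ) < 8 ^ i := by positivity
  nlinarith

theorem rp_lower (k : ℕ) (hk : 7 ≤ k) : (log (k + 1) - log 8) / 24 ≤ rp 3 (8 ^ k + 1) := by
  have : rp (8 ^ 7 + 1) (8 ^ k + 1) ≤ rp 3 (8 ^ k + 1) := rp_mono (by norm_num) le_rfl
  refine le_trans ?_ this
  clear this
  induction k, hk using Nat.le_induction with
  | base => norm_num [rp]
  | succ k hk ih =>
    rw [rp_split (b := 8 ^ k + 1) (by have := Nat.pow_le_pow_right (show 0 < 8 by norm_num) hk; omega)
      (by have := Nat.pow_le_pow_right (show 0 < 8 by norm_num) (Nat.le_succ k); omega)]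
    have h1 := rp_block8 k hk
    have h2 := Real.log_le_sub_one_of_pos (x := ((k : ℝ) + 1 + 1) / (k + 1)) (by positivity)
    rw [Real.log_div (by positivity) (by positivity)] at h2
    have h3 : ((k : ℝ) + 1 + 1) / (k + 1) - 1 = 24 * (1 / (24 * ((k : ℝ) + 1))) := by field_simp; ring
    rw [h3] at h2
    push_cast
    linarith

end NCB

namespace NCB

/-- ternary triples up to n -/
def Tr (n : ℕ) : Finset (ℕ × ℕ × ℕ) :=
  (Finset.range (n + 1) ×ˢ Finset.range (n + 1) ×ˢ Finset.range (n + 1)).filter fun t =>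
    t.1.Prime ∧ t.2.1.Prime ∧ t.2.2.Prime ∧ 3 ≤ t.1 ∧ t.1 < t.2.1 ∧ t.2.1 < t.2.2 ∧ t.1 * t.2.1 * t.2.2 ≤ n

theorem mem_Tr {n p q r : ℕ} : (p, q, r) ∈ Tr n ↔
    p.Prime ∧ q.Prime ∧ r.Prime ∧ 3 ≤ p ∧ p < q ∧ q < r ∧ p * q * r ≤ n := by
  unfold Tr
  simp only [Finset.mem_filter, Finset.mem_product, Finset.mem_range]
  constructor
  · rintro ⟨_, h⟩; exact h
  · rintro ⟨h1, h2, h3, h4, h5, h6, h7⟩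
    refine ⟨?_, h1, h2, h3, h4, h5, h6, h7⟩
    have hr : r ≤ p * q * r := Nat.le_mul_of_pos_left r (Nat.mul_pos h1.pos h2.pos)
    omega

theorem fiber_upper (n : ℕ) (hl : 12 ≤ Nat.log 2 n) (w : ℕ × ℕ) :
    (((Tr n).filter fun t => (t.1, t.2.1) = w).card : ℝ) ≤ 32 * n / Nat.log 2 n * (1 / w.1 * (1 / w.2)) := by
  obtain ⟨p, q⟩ := w
  rcases Finset.eq_empty_or_nonempty ((Tr n).filter fun t => (t.1, t.2.1) = (p, q)) with h | ⟨⟨p', q', r⟩, h⟩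
  · rw [h]; simp only [Finset.card_empty, Nat.cast_zero]; positivity
  simp only [Finset.mem_filter, Prod.mk.injEq] at h
  obtain ⟨h, rfl, rfl⟩ := h
  rw [mem_Tr] at h
  obtain ⟨hp, hq, hr, h3, hpq, hqr, hn⟩ := h
  have hpq0 : 0 < p' * q' := Nat.mul_pos hp.pos hq.pos
  set y := n / (p' * q') with hy
  have hc : ((Tr n).filter fun t => (t.1, t.2.1) = (p', q')).card ≤ Nat.primeCounting y := by
    rw [← Nat.primesLE_card_eq_primeCounting]
    refine Finset.card_le_card_of_injOn (fun t => t.2.2) ?_ ?_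
    · rintro ⟨a, b, c⟩ ht
      simp only [Finset.coe_filter, Set.mem_ofPred_eq, Prod.mk.injEq] at ht
      obtain ⟨ht, rfl, rfl⟩ := ht
      rw [mem_Tr] at ht
      simp only [Finset.mem_coe, Nat.mem_primesLE]
      refine ⟨?_, ht.2.2.1⟩
      rw [hy, Nat.le_div_iff_mul_le hpq0]
      linarith [ht.2.2.2.2.2.2, mul_comm c (a * b)]
    · rintro ⟨a, b, c⟩ ht ⟨a', b', c'⟩ ht' hcc
      simp only [Finset.coe_filter, Set.mem_ofPred_eq, Prod.mk.injEq] at ht ht' hcc ⊢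
      obtain ⟨_, rfl, rfl⟩ := ht
      obtain ⟨_, rfl, rfl⟩ := ht'
      exact ⟨rfl, rfl, hcc⟩
  have h1 := pi_upper y
  -- lower bound for log y
  have hy1 : n < p' * q' * (y + 1) := by
    rw [hy]; have := Nat.lt_mul_div_succ n hpq0; linarith
  have hn0 : 0 < n := by
    rcases Nat.eq_zero_or_pos n with h | h
    · subst h; simp at hl
    · exact h
  have hcube : n < (y + 1) ^ 3 := by
    by_contra hcon
    push Not at hcon
    have a1 : p' * q' * q' < n := lt_of_lt_of_le (Nat.mul_lt_mul_of_pos_left hqr hpq0) hn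
    have a2 : (p' * q') ^ 3 ≤ (p' * q' * q') ^ 2 := by
      calc (p' * q') ^ 3 = p' * (p' * p' * q' * q' * q') := by ring
        _ ≤ q' * (p' * p' * q' * q' * q') := Nat.mul_le_mul_right _ hpq.le
        _ = _ := by ring
    have a3 : (p' * q' * q') ^ 2 < n ^ 2 := Nat.pow_lt_pow_left a1 (by norm_num)
    have a4 : n ^ 3 < (p' * q' * (y + 1)) ^ 3 := Nat.pow_lt_pow_left hy1 (by norm_num)
    have a5 : (p' * q' * (y + 1)) ^ 3 ≤ n ^ 2 * n := by
      rw [mul_pow]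
      exact Nat.mul_le_mul (a2.trans a3.le) hcon
    have : n ^ 2 * n = n ^ 3 := by ring
    omega
  have hlog : Nat.log 2 n < 3 * (Nat.log 2 y + 1) := by
    apply Nat.log_lt_of_lt_pow hn0.ne'
    calc n < (y + 1) ^ 3 := hcube
      _ ≤ (2 ^ (Nat.log 2 y + 1)) ^ 3 := Nat.pow_le_pow_left (Nat.lt_pow_succ_log_self (by norm_num) y) 3
      _ = 2 ^ (3 * (Nat.log 2 y + 1)) := by rw [← pow_mul, mul_comm]
  have hlog4 : Nat.log 2 n ≤ 4 * Nat.log 2 y := by omega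
  have hlog4' : (Nat.log 2 n : ℝ) ≤ 4 * Nat.log 2 y := by exact_mod_cast hlog4
  have hl0 : (0 : ℝ) < Nat.log 2 n := by exact_mod_cast (show 0 < Nat.log 2 n by omega)
  have hly0 : (0 : ℝ) < Nat.log 2 y := by linarith
  have hyle : (y : ℝ) ≤ n * (1 / p' * (1 / q')) := by
    have hp0 : (0 : ℝ) < p' := by exact_mod_cast hp.pos
    have hq0 : (0 : ℝ) < q' := by exact_mod_cast hq.pos
    have := Nat.cast_div_le (α := ℝ) (m := n) (n := p' * q')
    rw [← hy] at this
    refine this.trans (le_of_eq ?_)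
    push_cast; field_simp
  calc (((Tr n).filter fun t => (t.1, t.2.1) = (p', q')).card : ℝ) ≤ Nat.primeCounting y := by exact_mod_cast hc
    _ ≤ 8 * y / Nat.log 2 y := h1
    _ ≤ 8 * y * 4 / Nat.log 2 n := by
      rw [div_le_div_iff₀ hly0 hl0]
      have : (0 : ℝ) ≤ y := Nat.cast_nonneg y
      nlinarith
    _ ≤ 8 * (n * (1 / p' * (1 / q'))) * 4 / Nat.log 2 n := by gcongr
    _ = _ := by ring

theorem triples_upper (n : ℕ) (hl : 12 ≤ Nat.log 2 n) (S : Finset (ℕ × ℕ)) :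
    (((Tr n).filter fun t => (t.1, t.2.1) ∈ S).card : ℝ) ≤
      32 * n / Nat.log 2 n * ∑ w ∈ S, (1 / (w.1 : ℝ) * (1 / w.2)) := by
  rw [← Finset.sum_card_fiberwise_eq_card_filter, Finset.mul_sum]
  push_cast
  exact Finset.sum_le_sum fun w _ => fiber_upper n hl w

theorem fiber_lower (n k : ℕ) (hk : k = Nat.log 2 n / 30) (hk1 : 7 ≤ k) (p q : ℕ) (hp : p.Prime) (hq : q.Prime)
    (h3 : 3 ≤ p) (hpq : p < q) (hqz : q ≤ 8 ^ k) :
    1 / 10 * (n : ℝ) / Nat.log 2 n * (1 / p * (1 / q)) ≤ (((Tr n).filter fun t => (t.1, t.2.1) = (p, q)).card : ℝ) := by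
  set z := 8 ^ k with hz
  set l := Nat.log 2 n with hl
  have hlk : l < 30 * (k + 1) := by omega
  have hn0 : n ≠ 0 := by
    rintro rfl
    simp at hl
    omega
  have hz10 : z ^ 10 ≤ n := by
    calc z ^ 10 = 2 ^ (30 * k) := by
          rw [hz, show 8 = 2 ^ 3 by norm_num, ← pow_mul, ← pow_mul]; congr 1; ring
      _ ≤ 2 ^ l := Nat.pow_le_pow_right (by norm_num) (by omega)
      _ ≤ n := Nat.pow_log_le_self 2 hn0
  have hzk : k + 1 ≤ z := Nat.lt_pow_self (by norm_num)
  have hzb : 8 ^ 7 ≤ z := Nat.pow_le_pow_right (by norm_num) hk1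
  have hpq0 : 0 < p * q := Nat.mul_pos hp.pos hq.pos
  set y := n / (p * q) with hy
  have hc : Nat.primeCounting y ≤ ((Tr n).filter fun t => (t.1, t.2.1) = (p, q)).card + q := by
    rw [← Nat.primesLE_card_eq_primeCounting]
    have hsub : Nat.primesLE y ⊆ ((Tr n).filter fun t => (t.1, t.2.1) = (p, q)).image (fun t => t.2.2) ∪
        Finset.Icc 1 q := by
      intro r hr
      rw [Nat.mem_primesLE] at hr
      rw [Finset.mem_union]
      rcases le_or_gt r q with h | h
      · right; rw [Finset.mem_Icc]; exact ⟨hr.2.one_le, h⟩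
      · left
        rw [Finset.mem_image]
        refine ⟨(p, q, r), ?_, rfl⟩
        rw [Finset.mem_filter, mem_Tr]
        refine ⟨⟨hp, hq, hr.2, h3, hpq, h, ?_⟩, rfl⟩
        have := (Nat.le_div_iff_mul_le hpq0).1 hr.1
        linarith [mul_comm r (p * q)]
    refine (Finset.card_le_card hsub).trans ((Finset.card_union_le _ _).trans ?_)
    have := Finset.card_image_le (s := (Tr n).filter fun t => (t.1, t.2.1) = (p, q)) (f := fun t => t.2.2)
    simp only [Nat.card_Icc, add_tsub_cancel_right]
    omega
  have hpqz : p * q ≤ z ^ 2 := by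
    rw [sq]; exact Nat.mul_le_mul (by omega) hqz
  have hyz : z ^ 8 ≤ y := by
    rw [hy, Nat.le_div_iff_mul_le hpq0]
    calc z ^ 8 * (p * q) ≤ z ^ 8 * z ^ 2 := Nat.mul_le_mul_left _ hpqz
      _ = z ^ 10 := by ring
      _ ≤ n := hz10
  have hy6 : 10 ^ 6 ≤ y := by
    have : z ≤ z ^ 8 := Nat.le_self_pow (by norm_num) z
    norm_num at hzb ⊢
    omega
  have hpi := pi_lower y hy6
  have hyn : y ≤ n := Nat.div_le_self _ _
  have hnR : (0 : ℝ) < n := by exact_mod_cast Nat.pos_of_ne_zero hn0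
  have hy6' : (10 ^ 6 : ℝ) ≤ y := by exact_mod_cast hy6
  have hl3 : 3 ≤ l := by omega
  have hlog : log y ≤ l := by
    have h1 : log y ≤ log n := Real.log_le_log (by linarith) (by exact_mod_cast hyn)
    have h2 : (n : ℝ) ≤ 2 ^ (l + 1) := by exact_mod_cast (Nat.lt_pow_succ_log_self (by norm_num) n).le
    have h3 := Real.log_le_log hnR h2
    rw [Real.log_pow] at h3
    push_cast at h3
    have : (3 : ℝ) ≤ l := by exact_mod_cast hl3
    nlinarith [Real.log_two_lt_d9]
  have hlogpos : 0 < log y := Real.log_pos (by linarith)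
  have hp0 : (0 : ℝ) < p := by exact_mod_cast hp.pos
  have hq0 : (0 : ℝ) < q := by exact_mod_cast hq.pos
  have hl0 : (0 : ℝ) < l := by exact_mod_cast (show 0 < l by omega)
  set V : ℝ := n * (1 / p * (1 / q)) with hV
  have hyV : V ≤ 2 * y := by
    have h1 : n < p * q * (y + 1) := by
      rw [hy]; have := Nat.lt_mul_div_succ n hpq0; linarith
    have h2 : (n : ℝ) ≤ p * q * (y + 1) := by exact_mod_cast h1.le
    have : V ≤ y + 1 := by
      rw [hV]
      calc (n : ℝ) * (1 / p * (1 / q)) ≤ (p * q * (y + 1)) * (1 / p * (1 / q)) := by gcongr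
        _ = y + 1 := by field_simp
    linarith
  have hqV : (q : ℝ) * l ≤ V / 20 := by
    have h1 : 600 * (k + 1) ≤ z ^ 7 := by
      calc 600 * (k + 1) ≤ z * z := Nat.mul_le_mul (by norm_num at hzb; omega) hzk
        _ ≤ z ^ 7 := by
          rw [← sq]; exact Nat.pow_le_pow_right (by omega) (by norm_num)
    have h2 : q * l * 20 * (p * q) ≤ n := by
      calc q * l * 20 * (p * q) ≤ z * (30 * (k + 1)) * 20 * z ^ 2 := by gcongr
        _ = z ^ 3 * (600 * (k + 1)) := by ring
        _ ≤ z ^ 3 * z ^ 7 := Nat.mul_le_mul_left _ h1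
        _ = z ^ 10 := by ring
        _ ≤ n := hz10
    have h3 : (q : ℝ) * l * 20 * (p * q) ≤ n := by exact_mod_cast h2
    rw [le_div_iff₀ (by norm_num), hV]
    calc (q : ℝ) * l * 20 = (q * l * 20 * (p * q)) * (1 / p * (1 / q)) := by field_simp
      _ ≤ n * (1 / p * (1 / q)) := by gcongr
  have hc' : (Nat.primeCounting y : ℝ) ≤ ((Tr n).filter fun t => (t.1, t.2.1) = (p, q)).card + q := by
    exact_mod_cast hc
  have h5 : 3 / 10 * (y : ℝ) / l ≤ 3 / 10 * y / log y := by gcongr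
  have h6 : 3 / 20 * V / l ≤ 3 / 10 * (y : ℝ) / l := by gcongr ?_ / _; linarith
  have h7 : (q : ℝ) ≤ V / 20 / l := by rw [le_div_iff₀ hl0]; exact hqV
  have h8 : 1 / 10 * (n : ℝ) / l * (1 / p * (1 / q)) = 3 / 20 * V / l - V / 20 / l := by rw [hV]; ring
  rw [h8]
  linarith

theorem pair_sum (s : Finset ℕ) (hs : ∀ p ∈ s, 1 ≤ p) :
    ((∑ p ∈ s, (1 : ℝ) / p) ^ 2 - ∑ p ∈ s, (1 : ℝ) / p) / 2 ≤
      ∑ w ∈ (s ×ˢ s).filter (fun w => w.1 < w.2), (1 / (w.1 : ℝ) * (1 / w.2)) := by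
  rw [Finset.sum_filter, Finset.sum_product]
  set g : ℕ → ℕ → ℝ := fun a b => 1 / (a : ℝ) * (1 / b) with hg
  have e1 : (∑ p ∈ s, (1 : ℝ) / p) ^ 2 = ∑ a ∈ s, ∑ b ∈ s, g a b := by
    rw [sq, Finset.sum_mul_sum]
  have e2 : ∑ a ∈ s, ∑ b ∈ s, g a b = ∑ a ∈ s, ∑ b ∈ s, (if a < b then g a b else 0) +
      ∑ a ∈ s, ∑ b ∈ s, (if b < a then g a b else 0) + ∑ a ∈ s, ∑ b ∈ s, (if a = b then g a b else 0) := by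
    simp_rw [← Finset.sum_add_distrib]
    refine Finset.sum_congr rfl fun a _ => Finset.sum_congr rfl fun b _ => ?_
    rcases lt_trichotomy a b with h | h | h
    · simp [h, h.ne, h.not_gt]
    · simp [h]
    · simp [h, h.ne', h.not_gt]
  have e3 : ∑ a ∈ s, ∑ b ∈ s, (if b < a then g a b else 0) = ∑ a ∈ s, ∑ b ∈ s, (if a < b then g a b else 0) := by
    rw [Finset.sum_comm]
    refine Finset.sum_congr rfl fun a _ => Finset.sum_congr rfl fun b _ => ?_
    simp only [hg, mul_comm]
  have e4 : ∑ a ∈ s, ∑ b ∈ s, (if a = b then g a b else 0) ≤ ∑ p ∈ s, (1 : ℝ) / p := by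
    refine Finset.sum_le_sum fun a ha => ?_
    rw [Finset.sum_ite_eq, if_pos ha]
    have h1 : (1 : ℝ) ≤ a := by exact_mod_cast hs a ha
    have h2 : 1 / (a : ℝ) ≤ 1 := by rw [div_le_one (by linarith)]; exact h1
    have h3 : 0 ≤ 1 / (a : ℝ) := by positivity
    simp only [hg]
    nlinarith
  linarith

theorem NT_lower (n : ℕ) (hmu : 200 ≤ Nat.log 2 (Nat.log 2 n)) :
    (1 / 10 ^ 6 : ℝ) * ((Nat.log 2 (Nat.log 2 n) : ℝ) ^ 2 * (n / Nat.log 2 n)) ≤ (Tr n).card := by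
  set l := Nat.log 2 n with hl
  set μ := Nat.log 2 l with hmu'
  set k := l / 30 with hk
  have hl0 : l ≠ 0 := by
    intro h
    rw [h] at hmu'
    simp at hmu'
    omega
  have hlμ : 2 ^ μ ≤ l := Nat.pow_log_le_self 2 hl0
  have hk7 : 7 ≤ k := by
    have : 2 ^ 8 ≤ 2 ^ μ := Nat.pow_le_pow_right (by norm_num) (by omega)
    omega
  set s := (Finset.Ico 3 (8 ^ k + 1)).filter Nat.Prime with hs
  set S := (s ×ˢ s).filter (fun w => w.1 < w.2) with hS
  have hR : rp 3 (8 ^ k + 1) = ∑ p ∈ s, (1 : ℝ) / p := rfl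
  have h1 : (∑ w ∈ S, 1 / 10 * (n : ℝ) / l * (1 / w.1 * (1 / w.2))) ≤ (Tr n).card := by
    have : ((Tr n).filter fun t => (t.1, t.2.1) ∈ S).card ≤ (Tr n).card := Finset.card_filter_le _ _
    rw [← Finset.sum_card_fiberwise_eq_card_filter] at this
    have h2 : (∑ w ∈ S, (((Tr n).filter fun t => (t.1, t.2.1) = w).card : ℝ)) ≤ (Tr n).card := by
      exact_mod_cast this
    refine le_trans (Finset.sum_le_sum ?_) h2
    rintro ⟨p, q⟩ hw
    simp only [hS, hs, Finset.mem_filter, Finset.mem_product, Finset.mem_Ico] at hw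
    exact fiber_lower n k hk hk7 p q hw.1.1.2 hw.1.2.2 hw.1.1.1.1 hw.2 (by omega)
  rw [← Finset.mul_sum] at h1
  have h2 := pair_sum s (fun p hp => by
    simp only [hs, Finset.mem_filter, Finset.mem_Ico] at hp; omega)
  rw [← hR] at h2
  have h3 := rp_lower k hk7
  have h4 : (μ : ℝ) * log 2 - log 30 ≤ log ((k : ℝ) + 1) := by
    have a1 : 2 ^ μ ≤ 30 * (k + 1) := by omega
    have a2 : (2 : ℝ) ^ μ ≤ 30 * (k + 1) := by exact_mod_cast a1
    have := Real.log_le_log (by positivity) a2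
    rw [Real.log_pow, Real.log_mul (by norm_num) (by positivity)] at this
    linarith
  have h30 : log 30 ≤ 5 * log 2 := by
    rw [show (5 : ℝ) * log 2 = ((5 : ℕ) : ℝ) * log 2 by norm_num, ← Real.log_pow]
    exact Real.log_le_log (by norm_num) (by norm_num)
  have h8 : log 8 = 3 * log 2 := by
    rw [show (8 : ℝ) = 2 ^ 3 by norm_num, Real.log_pow]; norm_num
  have hμ : (200 : ℝ) ≤ μ := by exact_mod_cast hmu
  have hRμ : (μ : ℝ) / 100 ≤ rp 3 (8 ^ k + 1) := by
    nlinarith [Real.log_two_gt_d9, Real.log_two_lt_d9]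
  have h5 : (μ : ℝ) ^ 2 / 40000 ≤ ∑ w ∈ S, 1 / (w.1 : ℝ) * (1 / w.2) := by
    refine le_trans ?_ h2
    nlinarith
  refine le_trans ?_ h1
  have h6 : (0 : ℝ) ≤ 1 / 10 * (n : ℝ) / l := by positivity
  have h7 := mul_le_mul_of_nonneg_left h5 h6
  refine le_trans ?_ h7
  have h9 : (0 : ℝ) ≤ (μ : ℝ) ^ 2 * (n / l) := by positivity
  have h10 : 1 / 10 * (n : ℝ) / l * ((μ : ℝ) ^ 2 / 40000) = 1 / 400000 * ((μ : ℝ) ^ 2 * (n / l)) := by ring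
  rw [h10]
  nlinarith

theorem excl_upper (n i0 : ℕ) (hi0 : 1 ≤ i0) (hl : 12 ≤ Nat.log 2 n) :
    (((Tr n).filter fun t => t.1 < 2 ^ i0 ∨ t.2.1 < t.1 ^ 20).card : ℝ) ≤
      32 * n / Nat.log 2 n * ((16 * log i0 + 64) * (16 * log (Nat.log 2 n + 1))) := by
  set l := Nat.log 2 n with hlv
  have hn2 : n < 2 ^ (l + 1) := Nat.lt_pow_succ_log_self (by norm_num) n
  set P := (Finset.Ico 0 (2 ^ (l + 1))).filter Nat.Prime with hP
  have hrpP : rp 0 (2 ^ (l + 1)) = ∑ p ∈ P, (1 : ℝ) / p := rfl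
  set S1 := ((Finset.Ico 0 (2 ^ i0)).filter Nat.Prime) ×ˢ P with hS1
  set S2 := P.sigma (fun p => (Finset.Ico p (p ^ 20)).filter Nat.Prime) with hS2
  set S2' := S2.image (fun w => (w.1, w.2)) with hS2'
  have hrl := rp_upper (l + 1) (by omega)
  have b1 : ∑ w ∈ S1, (1 / (w.1 : ℝ) * (1 / w.2)) ≤ 16 * log i0 * (16 * log (l + 1)) := by
    rw [hS1, Finset.sum_product]
    dsimp only
    rw [← Finset.sum_mul_sum]
    have := rp_upper i0 hi0
    rw [hrpP] at hrl
    push_cast at hrl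
    exact mul_le_mul this hrl (Finset.sum_nonneg fun _ _ => by positivity) ((rp_nonneg _ _).trans this)
  have b2 : ∑ w ∈ S2', (1 / (w.1 : ℝ) * (1 / w.2)) ≤ 64 * (16 * log (l + 1)) := by
    rw [hS2', Finset.sum_image (by
      rintro ⟨a, b⟩ _ ⟨c, d⟩ _ h
      simp only [Prod.mk.injEq] at h
      obtain ⟨rfl, rfl⟩ := h; rfl), hS2, Finset.sum_sigma]
    calc _ ≤ ∑ p ∈ P, 64 * (1 / (p : ℝ)) := by
          refine Finset.sum_le_sum fun p hp => ?_
          dsimp only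
          rw [← Finset.mul_sum, mul_comm]
          have hpp : p.Prime := (Finset.mem_filter.1 hp).2
          have : rp p (p ^ 20) ≤ 64 := by
            set i := Nat.log 2 p with hi
            have hi1 : 1 ≤ i := Nat.log_pos (by norm_num) hpp.two_le
            have a1 : 2 ^ i ≤ p := Nat.pow_log_le_self 2 hpp.ne_zero
            have a2 : p ^ 20 ≤ 2 ^ ((i + 1) * 20) := by
              rw [pow_mul]
              exact Nat.pow_le_pow_left (Nat.lt_pow_succ_log_self (by norm_num) p).le 20
            have a3 := rp_window i ((i + 1) * 20) hi1 (by omega)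
            refine (rp_mono a1 a2).trans (a3.trans ?_)
            have hi0' : (1 : ℝ) ≤ i := by exact_mod_cast hi1
            have a4 : log (((i + 1) * 20 : ℕ) : ℝ) ≤ log (40 * i) := by
              apply Real.log_le_log (by push_cast; positivity)
              push_cast; linarith
            rw [Real.log_mul (by norm_num) (by positivity)] at a4
            have a5 : log 40 ≤ 4 := by
              have e : log 40 = 3 * log 2 + log 5 := by
                rw [show (40 : ℝ) = 2 ^ 3 * 5 by norm_num, Real.log_mul (by norm_num) (by norm_num), Real.log_pow]
                norm_num
              have e5 : log 5 ≤ log 4 + (5 / 4 - 1) := by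
                have := Real.log_le_sub_one_of_pos (x := 5 / 4) (by norm_num)
                rw [Real.log_div (by norm_num) (by norm_num)] at this
                linarith
              have h4 : log 4 = 2 * log 2 := by
                rw [show (4 : ℝ) = 2 ^ 2 by norm_num, Real.log_pow]; norm_num
              linarith [Real.log_two_lt_d9]
            linarith
          exact mul_le_mul_of_nonneg_right this (by positivity)
      _ = 64 * rp 0 (2 ^ (l + 1)) := by rw [← Finset.mul_sum, hrpP]
      _ ≤ _ := by push_cast at hrl; linarith
  have c1 := triples_upper n hl S1
  have c2 := triples_upper n hl S2'
  have hcard : ((Tr n).filter fun t => t.1 < 2 ^ i0 ∨ t.2.1 < t.1 ^ 20).card ≤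
      ((Tr n).filter fun t => (t.1, t.2.1) ∈ S1).card + ((Tr n).filter fun t => (t.1, t.2.1) ∈ S2').card := by
    refine le_trans (Finset.card_le_card ?_) (Finset.card_union_le _ _)
    rintro ⟨p, q, r⟩ ht
    rw [Finset.mem_filter] at ht
    obtain ⟨ht, hc⟩ := ht
    have ht' := mem_Tr.1 ht
    obtain ⟨hp, hq, hr, h3, hpq, hqr, hn⟩ := ht'
    have hple : p ≤ n := le_trans (Nat.le_mul_of_pos_right p (Nat.mul_pos hq.pos hr.pos)) (by rw [← mul_assoc]; exact hn)
    have hqle : q ≤ n := le_trans (by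
      calc q ≤ p * r * q := Nat.le_mul_of_pos_left q (Nat.mul_pos hp.pos hr.pos)
        _ = p * q * r := by ring) hn
    rw [Finset.mem_union]
    rcases hc with hc | hc
    · left
      rw [Finset.mem_filter]
      refine ⟨ht, ?_⟩
      simp only [hS1, hP, Finset.mem_product, Finset.mem_filter, Finset.mem_Ico]
      exact ⟨⟨⟨Nat.zero_le _, hc⟩, hp⟩, ⟨Nat.zero_le _, by omega⟩, hq⟩
    · right
      rw [Finset.mem_filter]
      refine ⟨ht, ?_⟩
      rw [hS2', Finset.mem_image]
      refine ⟨⟨p, q⟩, ?_, rfl⟩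
      simp only [hS2, hP, Finset.mem_sigma, Finset.mem_filter, Finset.mem_Ico]
      exact ⟨⟨⟨Nat.zero_le _, by omega⟩, hp⟩, ⟨hpq.le, hc⟩, hq⟩
  have hcard' : (((Tr n).filter fun t => t.1 < 2 ^ i0 ∨ t.2.1 < t.1 ^ 20).card : ℝ) ≤
      ((Tr n).filter fun t => (t.1, t.2.1) ∈ S1).card + ((Tr n).filter fun t => (t.1, t.2.1) ∈ S2').card := by
    exact_mod_cast hcard
  have hpos : (0 : ℝ) ≤ 32 * n / l := by positivity
  have d1 := c1.trans (mul_le_mul_of_nonneg_left b1 hpos)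
  have d2 := c2.trans (mul_le_mul_of_nonneg_left b2 hpos)
  refine hcard'.trans ((add_le_add d1 d2).trans (le_of_eq ?_))
  ring

end NCB

namespace NCB

theorem abel_bound (k g : ℕ → ℝ) (a N : ℕ) (B : ℝ) (hk0 : ∀ n, 0 ≤ k n)
    (hk : ∀ n, a ≤ n → k (n + 1) ≤ k n) (hB : ∀ n, |∑ i ∈ Finset.Ico a (a + n), g i| ≤ B) :
    |∑ i ∈ Finset.Ico a (a + N), k i * g i| ≤ k a * B := by
  have e : ∀ M, ∑ i ∈ Finset.Ico a (a + M), k i * g i = k (a + M) * ∑ i ∈ Finset.Ico a (a + M), g i +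
      ∑ j ∈ Finset.range M, (k (a + j) - k (a + j + 1)) * ∑ i ∈ Finset.Ico a (a + (j + 1)), g i := by
    intro M
    induction M with
    | zero => simp
    | succ M ih =>
      rw [Finset.sum_range_succ, ← add_assoc a M 1, Finset.sum_Ico_succ_top (by omega), ih,
        Finset.sum_Ico_succ_top (by omega)]
      ring
  have hb : ∀ M, k (a + M) * B + ∑ j ∈ Finset.range M, (k (a + j) - k (a + j + 1)) * B = k a * B := by
    intro M
    induction M with
    | zero => simp
    | succ M ih =>
      rw [Finset.sum_range_succ, ← ih, ← add_assoc]; ring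
  rw [e, ← hb N]
  refine (abs_add_le _ _).trans (add_le_add ?_ ?_)
  · rw [abs_mul, abs_of_nonneg (hk0 _)]
    exact mul_le_mul_of_nonneg_left (hB N) (hk0 _)
  · refine (Finset.abs_sum_le_sum_abs _ _).trans (Finset.sum_le_sum fun j _ => ?_)
    have : 0 ≤ k (a + j) - k (a + j + 1) := sub_nonneg.2 (hk _ (by omega))
    rw [abs_mul, abs_of_nonneg this]
    exact mul_le_mul_of_nonneg_left (hB _) this

theorem twoD_var {p p' : ℕ} [NeZero p] [NeZero p'] (h : p.Coprime p') (f : ZMod p → ZMod p → ℝ)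
    (f' : ZMod p' → ZMod p' → ℝ) (hf : ∀ a b, |f a b| ≤ 1) (hf' : ∀ a b, |f' a b| ≤ 1)
    (h0 : ∑ a, ∑ b, f a b = 0) (a N : ℕ) (b len : ℕ → ℕ) (hlen : ∀ q, a ≤ q → len (q + 1) ≤ len q) :
    |∑ q ∈ Finset.Ico a (a + N), ∑ r ∈ Finset.Ico (b q) (b q + len q), f q r * f' q r| ≤
      p * p' * (N + len a) := by
  have pp : (0 : ℝ) < p := by exact_mod_cast NeZero.pos p
  have pp' : (0 : ℝ) < p' := by exact_mod_cast NeZero.pos p'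
  have s1 : ∀ q : ℕ, |∑ r ∈ Finset.Ico (b q) (b q + len q), f q r * f' q r -
      (len q : ℝ) * (1 / (p * p') * ((∑ c, f q c) * ∑ c', f' q c'))| ≤ p * p' := by
    intro q
    have := oneD h (fun c c' => f q c * f' q c') 1 (fun c c' => by
      rw [abs_mul]; exact mul_le_one₀ (hf _ _) (abs_nonneg _) (hf' _ _)) (b q) (len q)
    rw [Finset.sum_mul_sum]
    rw [← mul_assoc, mul_one_div]
    simpa using this
  have b1 : ∀ q, |∑ c, f q c| ≤ p := fun q => by
    refine (Finset.abs_sum_le_sum_abs _ _).trans ((Finset.sum_le_sum fun c _ => hf q c).trans ?_)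
    simp [ZMod.card]
  have b2 : ∀ q, |∑ c, f' q c| ≤ p' := fun q => by
    refine (Finset.abs_sum_le_sum_abs _ _).trans ((Finset.sum_le_sum fun c _ => hf' q c).trans ?_)
    simp [ZMod.card]
  have s2 : ∀ M, |∑ q ∈ Finset.Ico a (a + M), 1 / ((p : ℝ) * p') * ((∑ c, f q c) * ∑ c', f' q c')| ≤ p * p' := by
    intro M
    have s2 := oneD h (fun c c' => (∑ d, f c d) * ∑ d', f' c' d') (p * p') (fun c c' => by
      rw [abs_mul]; exact mul_le_mul (b1 _) (b2 _) (abs_nonneg _) pp.le) a M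
    rw [← Finset.sum_mul_sum, h0, zero_mul, mul_zero, sub_zero] at s2
    rw [← Finset.mul_sum, abs_mul, abs_of_nonneg (by positivity)]
    calc _ ≤ 1 / ((p : ℝ) * p') * (p * p' * (p * p')) := by gcongr
      _ = _ := by field_simp
  have s4 := abel_bound (fun q => (len q : ℝ))
    (fun q : ℕ => 1 / ((p : ℝ) * p') * ((∑ c, f q c) * ∑ c', f' q c')) a N (p * p')
    (fun _ => Nat.cast_nonneg _) (fun q hq => by exact_mod_cast hlen q hq) s2
  have s3 : |∑ q ∈ Finset.Ico a (a + N), ∑ r ∈ Finset.Ico (b q) (b q + len q), f q r * f' q r -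
      ∑ q ∈ Finset.Ico a (a + N), (len q : ℝ) * (1 / (p * p') * ((∑ c, f q c) * ∑ c', f' q c'))| ≤ N * (p * p') := by
    rw [← Finset.sum_sub_distrib]
    refine (Finset.abs_sum_le_sum_abs _ _).trans ((Finset.sum_le_sum fun q _ => s1 q).trans ?_)
    simp
  have := abs_sub_abs_le_abs_sub (∑ q ∈ Finset.Ico a (a + N), ∑ r ∈ Finset.Ico (b q) (b q + len q), f q r * f' q r)
    (∑ q ∈ Finset.Ico a (a + N), (len q : ℝ) * (1 / (p * p') * ((∑ c, f q c) * ∑ c', f' q c')))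
  nlinarith

/-- truncated centred indicator -/
noncomputable def phi (n p : ℕ) (w : ℕ × ℕ) : ℝ :=
  if w.1 < w.2 ∧ p * w.1 * w.2 ≤ n then bet p w.1 w.2 - kap p else 0

theorem abs_bet_sub (p : ℕ) (hp : 0 < p) (a b : ZMod p) : |bet p a b - kap p| ≤ 1 := by
  have h1 := bet_nonneg p a b
  have h2 := bet_le_one p a b
  have h3 := kap_nonneg p
  have h4 := kap_le_one p hp
  rw [abs_le]; constructor <;> linarith

theorem abs_phi (n p : ℕ) (hp : 0 < p) (w : ℕ × ℕ) : |phi n p w| ≤ 1 := by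
  unfold phi
  split_ifs
  · exact abs_bet_sub p hp _ _
  · simp

/-- ambient lattice region -/
def Lreg (n Z a N : ℕ) : Finset (ℕ × ℕ) :=
  (Finset.Ico a (a + N) ×ˢ Finset.range (n + 1)).filter fun w => w.1 < w.2 ∧ Z * w.1 * w.2 ≤ n

theorem row_eq (n M q : ℕ) (hM : 0 < M) (hq : 0 < q) :
    (Finset.range (n + 1)).filter (fun r => q < r ∧ M * q * r ≤ n) =
      Finset.Ico (q + 1) (q + 1 + (n / (M * q) - q)) := by
  ext r
  have hMq : 0 < M * q := Nat.mul_pos hM hq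
  have h1 : M * q * r ≤ n ↔ r ≤ n / (M * q) := by
    rw [Nat.le_div_iff_mul_le hMq, mul_comm]
  have h2 : n / (M * q) ≤ n := Nat.div_le_self _ _
  simp only [Finset.mem_filter, Finset.mem_range, Finset.mem_Ico, h1]
  omega

theorem cross (n Z a N p p' : ℕ) (hp : p.Prime) (hp' : p'.Prime) (hne : p ≠ p') (hZp : Z ≤ p) (hZp' : Z ≤ p')
    (hZ : 0 < Z) (ha : 0 < a) :
    |∑ w ∈ Lreg n Z a N, phi n p w * phi n p' w| ≤ (p * p' : ℝ) * (N + (n : ℝ) / (Z * a)) := by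
  have := Fact.mk hp
  have := Fact.mk hp'
  set M := max p p' with hM
  have hM0 : 0 < M := lt_of_lt_of_le hp.pos (le_max_left _ _)
  have e : ∑ w ∈ Lreg n Z a N, phi n p w * phi n p' w =
      ∑ q ∈ Finset.Ico a (a + N), ∑ r ∈ Finset.Ico (q + 1) (q + 1 + (n / (M * q) - q)),
        (bet p q r - kap p) * (bet p' q r - kap p') := by
    unfold Lreg
    rw [Finset.sum_filter, Finset.sum_product]
    refine Finset.sum_congr rfl fun q hq => ?_
    rw [Finset.mem_Ico] at hq
    rw [← row_eq n M q hM0 (by omega), Finset.sum_filter]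
    refine Finset.sum_congr rfl fun r _ => ?_
    unfold phi
    simp only
    have i1 : p * q * r ≤ M * q * r := by gcongr; exact le_max_left _ _
    have i2 : p' * q * r ≤ M * q * r := by gcongr; exact le_max_right _ _
    have i3 : Z * q * r ≤ p * q * r := by gcongr
    by_cases c : q < r ∧ M * q * r ≤ n
    · rw [if_pos ⟨c.1, by omega⟩, if_pos ⟨c.1, by omega⟩, if_pos ⟨c.1, by omega⟩, if_pos c]
    · rw [if_neg c]
      by_cases c1 : q < r
      · have c2 : ¬ M * q * r ≤ n := fun h => c ⟨c1, h⟩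
        rcases max_choice p p' with h | h
        · rw [← hM] at h
          rw [h] at c2
          rw [if_neg (c := q < r ∧ p * q * r ≤ n) (fun h => c2 h.2)]
          simp
        · rw [← hM] at h
          rw [h] at c2
          rw [if_neg (c := q < r ∧ p' * q * r ≤ n) (fun h => c2 h.2)]
          simp
      · simp [c1]
  have hp0 : (0 : ℝ) < p := by exact_mod_cast hp.pos
  have key := twoD_var ((Nat.coprime_primes hp hp').2 hne) (fun a b => bet p a b - kap p)
        (fun a b => bet p' a b - kap p') (abs_bet_sub p hp.pos) (abs_bet_sub p' hp'.pos) (by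
          simp_rw [Finset.sum_sub_distrib]
          rw [kap_eq]
          simp [ZMod.card]
          field_simp
          simp) a N (fun q => q + 1) (fun q => n / (M * q) - q) (by
          intro q hq
          have h1 : n / (M * (q + 1)) ≤ n / (M * q) :=
            Nat.div_le_div_left (Nat.mul_le_mul_left _ (by omega)) (Nat.mul_pos hM0 (by omega))
          exact Nat.sub_le_sub_left (by omega) _ |>.trans (Nat.sub_le_sub_right h1 _))
  rw [e]
  refine key.trans ?_
  have hlen : ((n / (M * a) - a : ℕ) : ℝ) ≤ (n : ℝ) / (Z * a) := by
    have h1 : n / (M * a) - a ≤ n / (Z * a) := by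
      have : n / (M * a) ≤ n / (Z * a) :=
        Nat.div_le_div_left (Nat.mul_le_mul_right _ (hZp.trans (le_max_left _ _))) (Nat.mul_pos hZ ha)
      exact (Nat.sub_le _ _).trans this
    calc ((n / (M * a) - a : ℕ) : ℝ) ≤ ((n / (Z * a) : ℕ) : ℝ) := by exact_mod_cast h1
      _ ≤ (n : ℝ) / ((Z * a : ℕ) : ℝ) := Nat.cast_div_le
      _ = _ := by push_cast; rfl
  gcongr

theorem card_Lreg (n Z a N : ℕ) (hZ : 0 < Z) (ha : 2 ≤ a) :
    ((Lreg n Z a N).card : ℝ) ≤ n / Z * log (a + N) := by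
  have h1 : ((Lreg n Z a N).card : ℝ) ≤ ∑ q ∈ Finset.Ico a (a + N), (n : ℝ) / Z * (1 / q) := by
    unfold Lreg
    rw [Finset.card_filter, Finset.sum_product]
    push_cast
    refine Finset.sum_le_sum fun q hq => ?_
    rw [Finset.mem_Ico] at hq
    have e := row_eq n Z q hZ (by omega)
    have e2 : (∑ r ∈ Finset.range (n + 1), (if q < r ∧ Z * q * r ≤ n then (1 : ℝ) else 0)) =
        (((Finset.range (n + 1)).filter (fun r => q < r ∧ Z * q * r ≤ n)).card : ℝ) := by
      rw [Finset.card_filter]; push_cast; rfl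
    rw [e2, e, Nat.card_Ico]
    calc _ ≤ ((n / (Z * q) : ℕ) : ℝ) := by
          refine Nat.cast_le.2 ?_
          rw [Nat.add_sub_cancel_left]; exact Nat.sub_le _ _
      _ ≤ (n : ℝ) / ((Z * q : ℕ) : ℝ) := Nat.cast_div_le
      _ = _ := by push_cast; field_simp
  refine h1.trans ?_
  rw [← Finset.mul_sum]
  refine mul_le_mul_of_nonneg_left ?_ (by positivity)
  have h2 : ∀ M : ℕ, ∑ q ∈ Finset.Ico a (a + M), (1 : ℝ) / q ≤ log ((a : ℝ) + M - 1) := by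
    intro M
    have ha' : (2 : ℝ) ≤ a := by exact_mod_cast ha
    induction M with
    | zero => simp; exact Real.log_nonneg (by linarith)
    | succ M ih =>
      rw [← add_assoc, Finset.sum_Ico_succ_top (by omega)]
      have hM : (0 : ℝ) ≤ M := Nat.cast_nonneg M
      set v : ℝ := (a : ℝ) + M with hv
      have h1 := Real.one_sub_inv_le_log_of_pos (x := v / (v - 1)) (div_pos (by linarith) (by linarith))
      rw [Real.log_div (by linarith) (by linarith)] at h1
      have h2 : 1 - (v / (v - 1))⁻¹ = 1 / v := by
        have : v ≠ 0 := by linarith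
        rw [inv_div]; field_simp; ring
      rw [h2] at h1
      push_cast
      rw [← hv, show (a : ℝ) + (M + 1) - 1 = v by rw [hv]; ring]
      linarith
  refine (h2 N).trans (Real.log_le_log ?_ (by linarith))
  have ha' : (2 : ℝ) ≤ a := by exact_mod_cast ha
  have hM : (0 : ℝ) ≤ N := Nat.cast_nonneg N
  linarith

end NCB

namespace NCB

theorem log_le_nlog (n : ℕ) (hl : 12 ≤ Nat.log 2 n) : log n ≤ Nat.log 2 n := by
  have hn : n ≠ 0 := by rintro rfl; simp at hl
  have h1 : n < 2 ^ (Nat.log 2 n + 1) := Nat.lt_pow_succ_log_self (by norm_num) n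
  have h2 : log n ≤ log ((2 : ℝ) ^ (Nat.log 2 n + 1)) :=
    Real.log_le_log (by exact_mod_cast Nat.pos_of_ne_zero hn) (by exact_mod_cast h1.le)
  rw [Real.log_pow] at h2
  have h3 : (12 : ℝ) ≤ Nat.log 2 n := by exact_mod_cast hl
  have h4 := Real.log_two_lt_d9
  push_cast at h2
  nlinarith

theorem block_phi (n i : ℕ) (hi : 1 ≤ i) (hl : 12 ≤ Nat.log 2 n) (hZn : (2 ^ i) ^ 41 ≤ n)
    (hZl : Nat.log 2 n ^ 8 ≤ 2 ^ i) (P : Finset ℕ) (A : Finset (ℕ × ℕ))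
    (hP : ∀ p ∈ P, p.Prime ∧ 2 ^ i ≤ p ∧ p < 2 * 2 ^ i)
    (hA : A ⊆ Lreg n (2 ^ i) ((2 ^ i) ^ 20) (Nat.sqrt n)) :
    ∑ p ∈ P, ∑ w ∈ A, phi n p w ≤ 2 * n / (Nat.log 2 n : ℝ) ^ 3 := by
  have hZ2 : 2 ≤ 2 ^ i := by
    calc 2 = 2 ^ 1 := rfl
      _ ≤ 2 ^ i := Nat.pow_le_pow_right (by norm_num) hi
  have hlogn := log_le_nlog n hl
  generalize Nat.log 2 n = l at *
  generalize 2 ^ i = Z at *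
  set N := Nat.sqrt n with hN
  have hNN : N * N ≤ n := Nat.sqrt_le n
  have z1 : Z ^ 20 ≤ N := by
    rw [hN, Nat.le_sqrt, ← pow_add]
    exact (Nat.pow_le_pow_right (by omega) (by norm_num)).trans hZn
  have z2 : Z ^ 4 ≤ N := (Nat.pow_le_pow_right (by omega) (by norm_num)).trans z1
  have z3 : 2 ≤ Z ^ 20 := hZ2.trans (Nat.le_self_pow (by norm_num) Z)
  have z4 : Z ^ 20 + N ≤ n := by nlinarith
  have hZR : (2 : ℝ) ≤ Z := by exact_mod_cast hZ2
  have hlR : (12 : ℝ) ≤ l := by exact_mod_cast hl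
  have hnR : (0 : ℝ) < n := by exact_mod_cast (show 0 < n by omega)
  have Zpos : (0 : ℝ) < Z := by linarith
  set E : ℝ := (2 * Z) * (2 * Z) * (N + (n : ℝ) / (Z * (Z ^ 20 : ℕ))) with hE
  have hE0 : 0 ≤ E := by positivity
  have dual := duality P (Lreg n Z (Z ^ 20) N) A hA (fun p w => phi n p w)
    (fun p hp w => abs_phi n p (hP p hp).1.pos w) E hE0 (by
      intro p hp p' hp' hne
      refine (cross n Z (Z ^ 20) N p p' (hP p hp).1 (hP p' hp').1 hne (hP p hp).2.1 (hP p' hp').2.1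
        (by omega) (by omega)).trans ?_
      have b1 : (p : ℝ) ≤ 2 * Z := by exact_mod_cast (hP p hp).2.2.le
      have b2 : (p' : ℝ) ≤ 2 * Z := by exact_mod_cast (hP p' hp').2.2.le
      rw [hE]
      gcongr)
  set W : ℝ := n / Z * l with hW
  have hW0 : 0 ≤ W := by positivity
  have hL : ((Lreg n Z (Z ^ 20) N).card : ℝ) ≤ W := by
    refine (card_Lreg n Z (Z ^ 20) N (by omega) z3).trans ?_
    rw [hW]
    have : log (((Z ^ 20 : ℕ) : ℝ) + N) ≤ l :=
      (Real.log_le_log (by positivity) (by exact_mod_cast z4)).trans hlogn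
    gcongr
  have hPc : (P.card : ℝ) ≤ Z := by
    have : P ⊆ Finset.Ico Z (2 * Z) := fun p hp => Finset.mem_Ico.2 (hP p hp).2
    have h := Finset.card_le_card this
    rw [Nat.card_Ico] at h
    exact_mod_cast (show P.card ≤ Z by omega)
  have hPE : (P.card : ℝ) * E ≤ W := by
    have t1 : (Z : ℝ) * E ≤ 8 * (n / Z) := by
      have u1 : (Z : ℝ) ^ 4 * N ≤ n := by
        exact_mod_cast (Nat.mul_le_mul_right N z2).trans hNN
      have u2 : (Z : ℝ) ^ 3 * N ≤ n / Z := by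
        rw [le_div_iff₀ Zpos]; linarith
      have u3 : (Z : ℝ) ^ 3 * ((n : ℝ) / (Z * (Z ^ 20 : ℕ))) ≤ n / Z := by
        push_cast
        have : (Z : ℝ) ^ 3 * ((n : ℝ) / (Z * Z ^ 20)) = n / Z * (1 / Z ^ 17) := by field_simp
        rw [this]
        refine mul_le_of_le_one_right (by positivity) ?_
        rw [div_le_one (by positivity)]
        exact one_le_pow₀ (by linarith)
      rw [hE]; nlinarith
    calc (P.card : ℝ) * E ≤ Z * E := by gcongr
      _ ≤ 8 * (n / Z) := t1
      _ ≤ W := by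
        rw [hW, mul_comm]
        refine mul_le_mul_of_nonneg_left (by linarith) (by positivity)
  have s2 : ∑ p ∈ P, (∑ w ∈ A, phi n p w) ^ 2 ≤ 2 * W ^ 2 := by
    refine dual.trans ?_
    calc _ ≤ W * (W + W) := by gcongr
      _ = _ := by ring
  have s3 : (∑ p ∈ P, ∑ w ∈ A, phi n p w) ^ 2 ≤ (2 * n / (l : ℝ) ^ 3) ^ 2 := by
    calc _ ≤ (P.card : ℝ) * ∑ p ∈ P, (∑ w ∈ A, phi n p w) ^ 2 := sq_sum_le_card_mul_sum_sq
      _ ≤ Z * (2 * W ^ 2) := by gcongr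
      _ = 2 * n ^ 2 * l ^ 2 / Z := by rw [hW]; field_simp
      _ ≤ 2 * n ^ 2 * l ^ 2 / (l : ℝ) ^ 8 := by
        have : (l : ℝ) ^ 8 ≤ Z := by exact_mod_cast hZl
        gcongr
      _ = 2 * n ^ 2 / (l : ℝ) ^ 6 := by field_simp
      _ ≤ 4 * n ^ 2 / (l : ℝ) ^ 6 := by gcongr; norm_num
      _ = _ := by rw [div_pow]; ring
  exact le_of_abs_le (abs_le_of_sq_le_sq s3 (by positivity))

/-- block of triples -/
def Gb (n i : ℕ) : Finset (ℕ × ℕ × ℕ) :=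
  (Tr n).filter fun t => Nat.log 2 t.1 = i ∧ (2 ^ i) ^ 20 ≤ t.2.1

theorem block (n i : ℕ) (hi : 2 ≤ i) (hl : 12 ≤ Nat.log 2 n) (hZl : Nat.log 2 n ^ 8 ≤ 2 ^ i) :
    ∑ t ∈ Gb n i, bet t.1 t.2.1 t.2.2 ≤
      (2 / 27 + 16 / 2 ^ i) * (Gb n i).card + 2 * n / (Nat.log 2 n : ℝ) ^ 3 := by
  rcases Finset.eq_empty_or_nonempty (Gb n i) with h | ⟨⟨p, q, r⟩, h⟩
  · rw [h]; simp only [Finset.sum_empty, Finset.card_empty]; positivity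
  have hlogp : ∀ p, 0 < p → (Nat.log 2 p = i ↔ 2 ^ i ≤ p ∧ p < 2 * 2 ^ i) := by
    intro p hp
    rw [Nat.log_eq_iff (Or.inl (by omega)), pow_succ, mul_comm 2]
  have hZn : (2 ^ i) ^ 41 ≤ n := by
    simp only [Gb, Finset.mem_filter, mem_Tr] at h
    obtain ⟨⟨hp, hq, hr, h3, hpq, hqr, hn⟩, hi, hq'⟩ := h
    rw [hlogp p hp.pos] at hi
    calc (2 ^ i) ^ 41 = (2 ^ i) * (2 ^ i) ^ 20 * (2 ^ i) ^ 20 := by ring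
      _ ≤ p * q * r := Nat.mul_le_mul (Nat.mul_le_mul hi.1 hq') (hq'.trans hqr.le)
      _ ≤ n := hn
  set P := (Finset.Ico (2 ^ i) (2 * 2 ^ i)).filter Nat.Prime with hP
  set A := (Lreg n (2 ^ i) ((2 ^ i) ^ 20) (Nat.sqrt n)).filter (fun w => w.1.Prime ∧ w.2.Prime) with hA
  have main := block_phi n i (by omega) hl hZn hZl P A (fun p hp => by
    rw [hP, Finset.mem_filter, Finset.mem_Ico] at hp
    exact ⟨hp.2, hp.1⟩) (Finset.filter_subset _ _)
  have hG : Gb n i = (P ×ˢ A).filter fun t => t.2.1 < t.2.2 ∧ t.1 * t.2.1 * t.2.2 ≤ n := by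
    ext ⟨p, q, r⟩
    simp only [Gb, Finset.mem_filter, mem_Tr, Finset.mem_product, hP, hA, Lreg, Finset.mem_Ico,
      Finset.mem_range]
    constructor
    · rintro ⟨⟨hp, hq, hr, h3, hpq, hqr, hn⟩, hi, hq'⟩
      rw [hlogp p hp.pos] at hi
      have e1 : 2 ^ i * q * r ≤ p * q * r := by gcongr; exact hi.1
      have e2 : r ≤ p * q * r := Nat.le_mul_of_pos_left r (Nat.mul_pos hp.pos hq.pos)
      have e3 : q ≤ Nat.sqrt n := by
        rw [Nat.le_sqrt]
        calc q * q ≤ q * r := Nat.mul_le_mul_left _ hqr.le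
          _ ≤ p * (q * r) := Nat.le_mul_of_pos_left _ hp.pos
          _ ≤ n := by rw [← mul_assoc]; exact hn
      have e4 : 0 < (2 ^ i) ^ 20 := by positivity
      exact ⟨⟨⟨hi, hp⟩, ⟨⟨⟨⟨hq', by omega⟩, by omega⟩, hqr, e1.trans hn⟩, hq, hr⟩⟩, hqr, hn⟩
    · rintro ⟨⟨⟨hi', hp⟩, ⟨⟨⟨⟨hq', _⟩, _⟩, _⟩, hq, hr⟩⟩, hqr, hn⟩
      have f1 : 2 ^ 2 ≤ 2 ^ i := Nat.pow_le_pow_right (by norm_num) hi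
      have f2 : (2 ^ i) ^ 2 ≤ (2 ^ i) ^ 20 := Nat.pow_le_pow_right (by omega) (by norm_num)
      refine ⟨⟨hp, hq, hr, by omega, ?_, hqr, hn⟩, (hlogp p hp.pos).2 hi', hq'⟩
      nlinarith
  have hsum : ∑ t ∈ Gb n i, (bet t.1 t.2.1 t.2.2 - kap t.1) = ∑ p ∈ P, ∑ w ∈ A, phi n p w := by
    rw [hG, Finset.sum_filter, Finset.sum_product]
    rfl
  rw [Finset.sum_sub_distrib] at hsum
  have hk : ∑ t ∈ Gb n i, kap t.1 ≤ (2 / 27 + 16 / 2 ^ i) * (Gb n i).card := by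
    rw [mul_comm, ← nsmul_eq_mul]
    refine Finset.sum_le_card_nsmul _ _ _ ?_
    rintro ⟨p, q, r⟩ ht
    simp only [Gb, Finset.mem_filter, mem_Tr] at ht
    have hp := ht.1.1
    have := ((hlogp p hp.pos).1 ht.2.1).1
    have : (2 : ℝ) ^ i ≤ p := by exact_mod_cast this
    refine (kap_le p hp).trans ?_
    gcongr
  linarith

theorem bad_bound (n i0 : ℕ) (hi0 : 2 ≤ i0) (hl : 12 ≤ Nat.log 2 n) (hZl : Nat.log 2 n ^ 8 ≤ 2 ^ i0) :
    ∑ t ∈ Tr n, bet t.1 t.2.1 t.2.2 ≤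
      32*n/Nat.log 2 n * ((16*log i0 + 64) * (16*log (Nat.log 2 n + 1))) +
      (2 / 27 + 16 / 2 ^ i0) * (Tr n).card + (Nat.log 2 n + 1) * (2 * n / (Nat.log 2 n : ℝ) ^ 3) := by
  set X := (Tr n).filter fun t => t.1 < 2^i0 ∨ t.2.1 < t.1^20 with hX
  set I := Finset.Icc i0 (Nat.log 2 n) with hI
  have hdisj : ∀ i ∈ I, ∀ j ∈ I, i ≠ j → Disjoint (Gb n i) (Gb n j) := by
    intro i _ j _ hij
    rw [Finset.disjoint_left]
    intro t h1 h2
    simp only [Gb, Finset.mem_filter] at h1 h2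
    exact hij (h1.2.1.symm.trans h2.2.1)
  have hsub : Tr n ⊆ X ∪ I.biUnion (Gb n) := by
    rintro ⟨p, q, r⟩ h
    rw [Finset.mem_union, hX, Finset.mem_filter, Finset.mem_biUnion]
    by_cases c : p < 2^i0 ∨ q < p^20
    · exact Or.inl ⟨h, c⟩
    · right
      push Not at c
      have h' := h
      rw [mem_Tr] at h'
      have hp := h'.1
      have hpn : p ≤ n := by
        have : p ≤ p * (q * r) := Nat.le_mul_of_pos_right p (Nat.mul_pos h'.2.1.pos h'.2.2.1.pos)
        rw [← mul_assoc] at this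
        exact this.trans h'.2.2.2.2.2.2
      refine ⟨Nat.log 2 p, ?_, ?_⟩
      · rw [hI, Finset.mem_Icc]
        exact ⟨Nat.le_log_of_pow_le (by norm_num) c.1, Nat.log_mono_right hpn⟩
      · simp only [Gb, Finset.mem_filter]
        refine ⟨h, trivial, ?_⟩
        exact (Nat.pow_le_pow_left (Nat.pow_log_le_self 2 hp.ne_zero) 20).trans c.2
  have hcard : ∑ i ∈ I, ((Gb n i).card : ℝ) ≤ (Tr n).card := by
    rw [← Nat.cast_sum, ← Finset.card_biUnion hdisj]
    refine Nat.cast_le.2 (Finset.card_le_card ?_)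
    intro t ht
    rw [Finset.mem_biUnion] at ht
    obtain ⟨i, _, h⟩ := ht
    exact Finset.mem_of_mem_filter _ h
  have hXs : ∑ t ∈ X, bet t.1 t.2.1 t.2.2 ≤ X.card := by
    have := Finset.sum_le_card_nsmul X (fun t => bet t.1 t.2.1 t.2.2) 1 (fun t _ => bet_le_one _ _ _)
    simpa using this
  have hXc := excl_upper n i0 (by omega) hl
  rw [← hX] at hXc
  have hb : ∑ t ∈ I.biUnion (Gb n), bet t.1 t.2.1 t.2.2 ≤ (2 / 27 + 16 / 2 ^ i0) * (Tr n).card +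
      (Nat.log 2 n + 1) * (2 * n / (Nat.log 2 n : ℝ) ^ 3) := by
    rw [Finset.sum_biUnion hdisj]
    calc _ ≤ ∑ i ∈ I, ((2 / 27 + 16 / 2 ^ i0) * ((Gb n i).card : ℝ) + 2 * n / (Nat.log 2 n : ℝ) ^ 3) := by
          refine Finset.sum_le_sum fun i hi => ?_
          rw [hI, Finset.mem_Icc] at hi
          have hz : 2 ^ i0 ≤ 2 ^ i := Nat.pow_le_pow_right (by norm_num) hi.1
          have hz' : (2 : ℝ) ^ i0 ≤ 2 ^ i := by exact_mod_cast hz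
          refine (block n i (by omega) hl (hZl.trans hz)).trans ?_
          gcongr
      _ = (2 / 27 + 16 / 2 ^ i0) * ∑ i ∈ I, ((Gb n i).card : ℝ) + I.card * (2 * n / (Nat.log 2 n : ℝ) ^ 3) := by
          rw [Finset.sum_add_distrib, ← Finset.mul_sum, Finset.sum_const, nsmul_eq_mul]
      _ ≤ _ := by
          have : (I.card : ℝ) ≤ Nat.log 2 n + 1 := by
            rw [hI, Nat.card_Icc]; exact_mod_cast (by omega)
          gcongr
  calc ∑ t ∈ Tr n, bet t.1 t.2.1 t.2.2 ≤ ∑ t ∈ X ∪ I.biUnion (Gb n), bet t.1 t.2.1 t.2.2 :=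
        Finset.sum_le_sum_of_subset_of_nonneg hsub fun t _ _ => bet_nonneg _ _ _
    _ ≤ ∑ t ∈ X, bet t.1 t.2.1 t.2.2 + ∑ t ∈ I.biUnion (Gb n), bet t.1 t.2.1 t.2.2 := by
        rw [← Finset.sum_union_inter]
        exact le_add_of_nonneg_right (Finset.sum_nonneg fun t _ => bet_nonneg _ _ _)
    _ ≤ _ := (add_le_add (hXs.trans hXc) hb).trans_eq (add_assoc _ _ _).symm

end NCB

namespace NCB

theorem g_small (δ : ℝ) (hδ : 0 < δ) : ∀ᶠ m : ℕ in atTop,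
    512 * (16 * log ((8 * (m + 1) : ℕ) : ℝ) + 64) * (m + 1) + 4 ≤ δ * (m : ℝ) ^ 2 := by
  set η : ℝ := δ / 10 ^ 6 with hη
  have hη0 : 0 < η := by positivity
  have h1 := (Real.isLittleO_log_id_atTop.bound hη0)
  have h2 : Tendsto (fun m : ℕ => ((8 * (m + 1) : ℕ) : ℝ)) atTop atTop := by
    refine tendsto_natCast_atTop_atTop.comp ?_
    refine tendsto_atTop_mono (fun m => ?_) tendsto_id
    simp only [id]; omega
  have h3 := h2.eventually h1
  have h4 : ∀ᶠ m : ℕ in atTop, 64 / η ≤ (m : ℝ) := tendsto_natCast_atTop_atTop.eventually_ge_atTop _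
  filter_upwards [h3, h4, eventually_ge_atTop 1] with m a1 a2 a3
  rw [div_le_iff₀ hη0] at a2
  have a4 : (1 : ℝ) ≤ m := by exact_mod_cast a3
  have a5 : log ((8 * (m + 1) : ℕ) : ℝ) ≤ η * (8 * (m + 1)) := by
    refine (le_abs_self _).trans ?_
    have e : ‖(id ((8 * (m + 1) : ℕ) : ℝ) : ℝ)‖ = 8 * ((m : ℝ) + 1) := by
      rw [id, Real.norm_of_nonneg (by positivity)]; push_cast; ring
    rw [e] at a1
    exact a1
  have hδη : δ = 10 ^ 6 * η := by rw [hη]; ring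
  have a6 : 16 * log ((8 * (m + 1) : ℕ) : ℝ) + 64 ≤ η * (129 * (m + 1)) := by nlinarith
  have a7 : η * (129 * ((m : ℝ) + 1)) * (m + 1) ≤ 516 * (η * m ^ 2) := by
    have : ((m : ℝ) + 1) * (m + 1) ≤ 4 * m ^ 2 := by nlinarith
    nlinarith
  have a8 : (16 * log ((8 * (m + 1) : ℕ) : ℝ) + 64) * (m + 1) ≤ η * (129 * (m + 1)) * ((m : ℝ) + 1) :=
    mul_le_mul_of_nonneg_right a6 (by positivity)
  have a9 : 64 ≤ η * (m : ℝ) ^ 2 := by nlinarith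
  rw [hδη]
  nlinarith

theorem bad_ev (ε : ℝ) (hε : 0 < ε) : ∀ᶠ n : ℕ in atTop,
    0 < (Tr n).card ∧ ∑ t ∈ Tr n, bet t.1 t.2.1 t.2.2 ≤ (2 / 27 + ε) * (Tr n).card := by
  have hμ : Tendsto (fun n : ℕ => Nat.log 2 (Nat.log 2 n)) atTop atTop := by
    rw [tendsto_atTop]
    intro M
    filter_upwards [eventually_ge_atTop (2 ^ (2 ^ M))] with n hn
    exact Nat.le_log_of_pow_le (by norm_num) (Nat.le_log_of_pow_le (by norm_num) hn)
  have h1 := hμ.eventually (g_small (ε / 2 * (1 / 10 ^ 6)) (by positivity))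
  have h2 := hμ.eventually (eventually_ge_atTop 200)
  have h3 : ∀ᶠ m : ℕ in atTop, 32 / ε ≤ (m : ℝ) := tendsto_natCast_atTop_atTop.eventually_ge_atTop _
  have h3 := hμ.eventually h3
  filter_upwards [h1, h2, h3] with n a1 a2 a3
  have hT := NT_lower n a2
  set l := Nat.log 2 n with hl
  set m := Nat.log 2 l with hm
  have hl0 : l ≠ 0 := by rintro h; rw [hm, h] at a2; simp at a2
  have l1 : l < 2 ^ (m + 1) := Nat.lt_pow_succ_log_self (by norm_num) l
  have l2 : 2 ^ m ≤ l := Nat.pow_log_le_self 2 hl0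
  have l3 : m < 2 ^ m := Nat.lt_two_pow_self
  have l4 : 12 ≤ l := by omega
  have hn0 : n ≠ 0 := by rintro rfl; simp at hl; omega
  have hnR : (0 : ℝ) < n := by exact_mod_cast Nat.pos_of_ne_zero hn0
  have hlR : (12 : ℝ) ≤ l := by exact_mod_cast l4
  have hmR : (200 : ℝ) ≤ m := by exact_mod_cast a2
  have hb := bad_bound n (8 * (m + 1)) (by omega) l4 (by
    rw [mul_comm 8, pow_mul]
    exact Nat.pow_le_pow_left l1.le 8)
  rw [← hl] at hb
  have hTpos : (0 : ℝ) < (Tr n).card := lt_of_lt_of_le (by positivity) hT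
  refine ⟨by exact_mod_cast hTpos, hb.trans ?_⟩
  have e1 : log ((l : ℝ) + 1) ≤ m + 1 := by
    have : ((l : ℝ) + 1) ≤ (2 : ℝ) ^ (m + 1) := by exact_mod_cast l1
    have := Real.log_le_log (by positivity) this
    rw [Real.log_pow] at this
    have h4 := Real.log_two_lt_d9
    push_cast at this
    nlinarith
  have e2 : (16 : ℝ) / 2 ^ (8 * (m + 1)) ≤ ε / 2 := by
    have : (m : ℝ) ≤ 2 ^ (8 * (m + 1)) := by
      have := (Nat.lt_two_pow_self (n := 8 * (m + 1))).le
      exact_mod_cast (show m ≤ 8 * (m + 1) by omega).trans this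
    rw [div_le_iff₀ (by positivity)]
    rw [div_le_iff₀ hε] at a3
    nlinarith
  have hlogpos : 0 ≤ log ((8 * (m + 1) : ℕ) : ℝ) := Real.log_natCast_nonneg _
  have e3 : 32 * (n : ℝ) / l * ((16 * log ((8 * (m + 1) : ℕ) : ℝ) + 64) * (16 * log ((l : ℝ) + 1))) ≤
      n / l * (512 * (16 * log ((8 * (m + 1) : ℕ) : ℝ) + 64) * (m + 1)) := by
    calc _ ≤ 32 * (n : ℝ) / l * ((16 * log ((8 * (m + 1) : ℕ) : ℝ) + 64) * (16 * (m + 1))) := by gcongr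
      _ = _ := by ring
  have e4 : ((l : ℝ) + 1) * (2 * n / (l : ℝ) ^ 3) ≤ n / l * 4 := by
    have : ((l : ℝ) + 1) * (2 * n / (l : ℝ) ^ 3) = n / l * (2 * (l + 1) / l ^ 2) := by field_simp
    rw [this]
    refine mul_le_mul_of_nonneg_left ?_ (by positivity)
    rw [div_le_iff₀ (by positivity)]
    nlinarith
  have e5 : (n : ℝ) / l * (512 * (16 * log ((8 * (m + 1) : ℕ) : ℝ) + 64) * (m + 1) + 4) ≤
      n / l * (ε / 2 * (1 / 10 ^ 6) * m ^ 2) := mul_le_mul_of_nonneg_left a1 (by positivity)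
  have e6 : (n : ℝ) / l * (ε / 2 * (1 / 10 ^ 6) * m ^ 2) ≤ ε / 2 * (Tr n).card := by
    calc _ = ε / 2 * ((1/10^6:ℝ) * ((m:ℝ)^2 * (n / l))) := by ring
      _ ≤ _ := by gcongr
  have e7 := mul_le_mul_of_nonneg_right e2 hTpos.le
  rw [mul_add] at e5
  linarith

theorem prod_inj {n : ℕ} : Set.InjOn (fun t : ℕ × ℕ × ℕ => t.1 * t.2.1 * t.2.2) (Tr n : Set (ℕ × ℕ × ℕ)) := by
  have key : ∀ p q r p' q' r' : ℕ, p.Prime → q.Prime → r.Prime → p < q → q < r → p'.Prime → q'.Prime →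
      r'.Prime → p' < q' → q' < r' → p * q * r = p' * q' * r' → p' ≤ p := by
    intro p q r p' q' r' hp hq hr h1 h2 hp' hq' hr' h1' h2' e
    have d : p ∣ p' * q' * r' := by rw [← e, mul_assoc]; exact dvd_mul_right _ _
    rcases hp.dvd_mul.1 d with d | d
    · rcases hp.dvd_mul.1 d with d | d
      · exact ((Nat.prime_dvd_prime_iff_eq hp hp').1 d).ge
      · have := (Nat.prime_dvd_prime_iff_eq hp hq').1 d; omega
    · have := (Nat.prime_dvd_prime_iff_eq hp hr').1 d; omega
  have key2 : ∀ q r q' r' : ℕ, q.Prime → r.Prime → q < r → q'.Prime →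
      r'.Prime → q' < r' → q * r = q' * r' → q' ≤ q := by
    intro q r q' r' hq hr h2 hq' hr' h2' e
    have d : q ∣ q' * r' := by rw [← e]; exact dvd_mul_right _ _
    rcases hq.dvd_mul.1 d with d | d
    · exact ((Nat.prime_dvd_prime_iff_eq hq hq').1 d).ge
    · have := (Nat.prime_dvd_prime_iff_eq hq hr').1 d; omega
  rintro ⟨p, q, r⟩ h ⟨p', q', r'⟩ h' e
  rw [Finset.mem_coe, mem_Tr] at h h'
  simp only at e
  obtain ⟨hp, hq, hr, _, h1, h2, _⟩ := h
  obtain ⟨hp', hq', hr', _, h1', h2', _⟩ := h'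
  have e1 : p = p' := le_antisymm (key _ _ _ _ _ _ hp' hq' hr' h1' h2' hp hq hr h1 h2 e.symm)
    (key _ _ _ _ _ _ hp hq hr h1 h2 hp' hq' hr' h1' h2' e)
  subst e1
  rw [mul_assoc, mul_assoc] at e
  have e := Nat.eq_of_mul_eq_mul_left hp.pos e
  have e2 : q = q' := le_antisymm (key2 _ _ _ _ hq' hr' h2' hq hr h2 e.symm) (key2 _ _ _ _ hq hr h2 hq' hr' h2' e)
  subst e2
  have e := Nat.eq_of_mul_eq_mul_left hq.pos e
  subst e
  rfl

theorem NT_set (x : ℝ) (hx : 0 ≤ x) : {n : ℕ | ∃ p q r : ℕ, p.Prime ∧ q.Prime ∧ r.Prime ∧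
    3 ≤ p ∧ p < q ∧ q < r ∧ n = p * q * r ∧ (n : ℝ) ≤ x} =
    (((Tr ⌊x⌋₊).image fun t : ℕ × ℕ × ℕ => t.1 * t.2.1 * t.2.2 : Finset ℕ) : Set ℕ) := by
  ext m
  simp only [Set.mem_ofPred_eq, Finset.coe_image, Set.mem_image, Finset.mem_coe, Prod.exists, mem_Tr]
  constructor
  · rintro ⟨p, q, r, hp, hq, hr, h3, h1, h2, rfl, hm⟩
    exact ⟨p, q, r, ⟨hp, hq, hr, h3, h1, h2, Nat.le_floor hm⟩, rfl⟩
  · rintro ⟨p, q, r, ⟨hp, hq, hr, h3, h1, h2, hm⟩, rfl⟩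
    exact ⟨p, q, r, hp, hq, hr, h3, h1, h2, rfl, (Nat.le_floor_iff hx).1 hm⟩

theorem NT_eq (x : ℝ) (hx : 0 ≤ x) : NTcount x = (Tr ⌊x⌋₊).card := by
  unfold NTcount
  rw [NT_set x hx, Set.ncard_coe_finset, Finset.card_image_of_injOn prod_inj]

theorem NCB_le (x : ℝ) (hx : 0 ≤ x) : NCBcount x ≤ NTcount x := by
  unfold NCBcount NTcount
  refine Set.ncard_le_ncard ?_ (by rw [NT_set x hx]; exact Finset.finite_toSet _)
  rintro m ⟨p, q, r, hp, hq, hr, h3, h1, h2, e, hm, _⟩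
  exact ⟨p, q, r, hp, hq, hr, h3, h1, h2, e, hm⟩

theorem NCB_ge (x : ℝ) (hx : 0 ≤ x) :
    ((Tr ⌊x⌋₊).filter fun t => bet t.1 t.2.1 t.2.2 = 0).card ≤ NCBcount x := by
  rw [← Finset.card_image_of_injOn (f := fun t : ℕ × ℕ × ℕ => t.1 * t.2.1 * t.2.2)
    (prod_inj.mono (Finset.coe_subset.2 (Finset.filter_subset _ _))), ← Set.ncard_coe_finset]
  unfold NCBcount
  refine Set.ncard_le_ncard ?_ ?_
  · intro m hm
    simp only [Finset.coe_image, Set.mem_image, Finset.mem_coe, Prod.exists, Finset.mem_filter, mem_Tr] at hm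
    obtain ⟨p, q, r, ⟨⟨hp, hq, hr, h3, h1, h2, hm⟩, hb⟩, rfl⟩ := hm
    refine ⟨p, q, r, hp, hq, hr, h3, h1, h2, rfl, (Nat.le_floor_iff hx).1 hm, ?_⟩
    have : polyHeight (cyclotomic (p * q * r) ℤ) ≤ 2 * p / 3 := by
      refine Finset.sup_le fun k _ => ?_
      rw [Nat.le_div_iff_mul_le (by norm_num), mul_comm]
      exact coeff_le_of_bet hp hq hr (by omega) (by omega) (by omega) hb k
    rw [Nat.le_div_iff_mul_le (by norm_num)] at this
    rw [le_div_iff₀ (by norm_num)]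
    exact_mod_cast this
  · refine Set.Finite.subset (s := {n : ℕ | ∃ p q r : ℕ, p.Prime ∧ q.Prime ∧ r.Prime ∧
      3 ≤ p ∧ p < q ∧ q < r ∧ n = p * q * r ∧ (n : ℝ) ≤ x}) (by rw [NT_set x hx]; exact Finset.finite_toSet _) ?_
    rintro m ⟨p, q, r, hp, hq, hr, h3, h1, h2, e, hm, _⟩
    exact ⟨p, q, r, hp, hq, hr, h3, h1, h2, e, hm⟩

theorem card_le_good (n : ℕ) : ((Tr n).card : ℝ) ≤
    ((Tr n).filter fun t => bet t.1 t.2.1 t.2.2 = 0).card + ∑ t ∈ Tr n, bet t.1 t.2.1 t.2.2 := by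
  rw [Finset.card_filter, Finset.card_eq_sum_ones]
  push_cast
  rw [← Finset.sum_add_distrib]
  refine Finset.sum_le_sum fun t _ => ?_
  split_ifs with h
  · rw [h]; simp
  · unfold bet at h ⊢
    split_ifs at h ⊢ <;> simp_all

theorem ratio_ev (ε : ℝ) (hε : 0 < ε) :
    ∀ᶠ x : ℝ in atTop, 25 / 27 - ε ≤ (NCBcount x : ℝ) / (NTcount x : ℝ) := by
  have h1 := (tendsto_nat_floor_atTop (α := ℝ)).eventually (bad_ev ε hε)
  filter_upwards [h1, eventually_ge_atTop 0] with x h hx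
  obtain ⟨hT, hb⟩ := h
  have hTR : (0 : ℝ) < (Tr ⌊x⌋₊).card := by exact_mod_cast hT
  rw [NT_eq x hx, le_div_iff₀ hTR]
  have h2 := card_le_good ⌊x⌋₊
  have h3 : (((Tr ⌊x⌋₊).filter fun t => bet t.1 t.2.1 t.2.2 = 0).card : ℝ) ≤ NCBcount x := by
    exact_mod_cast NCB_ge x hx
  linarith

theorem liminf_ge : (25 / 27 : ℝ) ≤ Filter.liminf (fun x : ℝ => (NCBcount x : ℝ) / (NTcount x : ℝ)) atTop := by
  refine le_of_forall_pos_sub_le fun ε hε => ?_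
  refine le_liminf_of_le ?_ (ratio_ev ε hε)
  refine IsBoundedUnder.isCoboundedUnder_ge ⟨1, ?_⟩
  rw [eventually_map]
  filter_upwards [eventually_ge_atTop 0] with x hx
  exact div_le_one_of_le₀ (by exact_mod_cast NCB_le x hx) (Nat.cast_nonneg _)

end NCB

theorem NCB_relative_density :
    (25 / 27 : ℝ) ≤ Filter.liminf (fun x : ℝ => (NCBcount x : ℝ) / (NTcount x : ℝ)) atTop ∧
    (0.925 : ℝ) ≤ Filter.liminf (fun x : ℝ => (NCBcount x : ℝ) / (NTcount x : ℝ)) atTop := by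
  exact ⟨NCB.liminf_ge, le_trans (by norm_num) NCB.liminf_ge⟩
end

section
/- Let p > 3 be prime. For integers 1 ≤ j, k ≤ p-1 set α = min(j, k, p-j, p-k), δ = min(max(j,k), max(p-j,p-k)), δ₁ = min(δ, p-δ), and GB(j,k) = min((p-1)/2 + α, p - δ₁). Let N_GB(p) be the number of pairs (j,k) with 1 ≤ j, k ≤ p-1 and GB(j,k) ≤ 2p/3. Then N_GB(p) = (8/9)p² - (16/9)p + 8/9 if p ≡ 1 (mod 3), and N_GB(p) = (8/9)p² - (8/9)p - 16/9 if p ≡ 2 (mod 3). -/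
/-- `GB(j,k) = min((p-1)/2 + α, p - δ₁)` with `α = min(j,k,p-j,p-k)`,
`δ = min(max(j,k), max(p-j,p-k))` and `δ₁ = min(δ, p-δ)`, as a rational number. -/
def GBval (p j k : ℕ) : ℚ :=
  let α : ℚ := min (min (j : ℚ) (k : ℚ)) (min ((p : ℚ) - (j : ℚ)) ((p : ℚ) - (k : ℚ)))
  let δ : ℚ := min (max (j : ℚ) (k : ℚ)) (max ((p : ℚ) - (j : ℚ)) ((p : ℚ) - (k : ℚ)))
  let δ₁ : ℚ := min δ ((p : ℚ) - δ)
  min (((p : ℚ) - 1) / 2 + α) ((p : ℚ) - δ₁)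

/-- `N_GB(p)`: the number of pairs `(j,k)` with `1 ≤ j,k ≤ p-1` and `GB(j,k) ≤ 2p/3`. -/
def NGB (p : ℕ) : ℕ :=
  ((Finset.Icc 1 (p - 1) ×ˢ Finset.Icc 1 (p - 1)).filter
    (fun jk : ℕ × ℕ => GBval p jk.1 jk.2 ≤ 2 * (p : ℚ) / 3)).card

theorem GBval_le_iff (p m j k : ℕ) (hm : p = 2 * m + 1) :
    GBval p j k ≤ 2 * (p : ℚ) / 3 ↔
      3 * min ((m : ℤ) + min (min (j : ℤ) k) (min ((p : ℤ) - j) ((p : ℤ) - k)))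
        ((p : ℤ) - min (min (max (j : ℤ) k) (max ((p : ℤ) - j) ((p : ℤ) - k)))
          ((p : ℤ) - min (max (j : ℤ) k) (max ((p : ℤ) - j) ((p : ℤ) - k)))) ≤ 2 * (p : ℤ) := by
  have h : GBval p j k = ((min ((m : ℤ) + min (min (j : ℤ) k) (min ((p : ℤ) - j) ((p : ℤ) - k)))
        ((p : ℤ) - min (min (max (j : ℤ) k) (max ((p : ℤ) - j) ((p : ℤ) - k)))
          ((p : ℤ) - min (max (j : ℤ) k) (max ((p : ℤ) - j) ((p : ℤ) - k)))) : ℤ) : ℚ) := by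
    have h2 : ((p : ℚ) - 1) / 2 = m := by subst hm; push_cast; ring
    unfold GBval
    simp only [h2]
    push_cast
    rfl
  rw [h, le_div_iff₀ (by norm_num), mul_comm]
  exact_mod_cast Iff.rfl

set_option maxHeartbeats 4000000 in
/-- Counting: the complement of the counted set is a product of two copies of
`[A, L] ∪ [p - L, p - A]`. -/
theorem NGB_count (p m t A L : ℕ) (hm : p = 2 * m + 1)
    (h : (p = 6 * t + 1 ∧ A = t + 1 ∧ L = 2 * t) ∨
      (p = 6 * t + 5 ∧ A = t + 2 ∧ L = 2 * t + 1)) :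
    NGB p + (2 * t) * (2 * t) = (p - 1) * (p - 1) := by
  have hc : (Finset.Icc A L ∪ Finset.Icc (p - L) (p - A)).card = 2 * t := by
    rw [Finset.card_union_of_disjoint, Nat.card_Icc, Nat.card_Icc]
    · omega
    · rw [Finset.disjoint_left]
      intro x hx hy
      rw [Finset.mem_Icc] at hx hy
      omega
  have hs : (Finset.Icc 1 (p - 1) ×ˢ Finset.Icc 1 (p - 1)).filter
      (fun jk : ℕ × ℕ => ¬ GBval p jk.1 jk.2 ≤ 2 * (p : ℚ) / 3) =
      (Finset.Icc A L ∪ Finset.Icc (p - L) (p - A)) ×ˢ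
        (Finset.Icc A L ∪ Finset.Icc (p - L) (p - A)) := by
    ext ⟨j, k⟩
    simp only [Finset.mem_filter, Finset.mem_product, Finset.mem_union, Finset.mem_Icc]
    rw [GBval_le_iff p m j k hm]
    constructor
    · rintro ⟨⟨h1, h2⟩, h3⟩
      rcases h with h | h <;> omega
    · rintro ⟨h1, h2⟩
      rcases h with h | h <;> rcases h1 with h1 | h1 <;> rcases h2 with h2 | h2 <;> omega
  have ht := Finset.card_filter_add_card_filter_not
    (s := Finset.Icc 1 (p - 1) ×ˢ Finset.Icc 1 (p - 1))
    (fun jk : ℕ × ℕ => GBval p jk.1 jk.2 ≤ 2 * (p : ℚ) / 3)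
  rw [hs, Finset.card_product, Finset.card_product, hc, Nat.card_Icc] at ht
  simpa [NGB] using ht

theorem NGB_formula (p : ℕ) (hp : p.Prime) (hp3 : 3 < p) :
    (p % 3 = 1 →
      (NGB p : ℚ) = 8 / 9 * (p : ℚ) ^ 2 - 16 / 9 * (p : ℚ) + 8 / 9) ∧
    (p % 3 = 2 →
      (NGB p : ℚ) = 8 / 9 * (p : ℚ) ^ 2 - 8 / 9 * (p : ℚ) - 16 / 9) := by
  have hodd : p % 2 = 1 := (hp.eq_two_or_odd).resolve_left (by omega)
  constructor
  · intro h
    obtain ⟨t, rfl⟩ : ∃ t, p = 6 * t + 1 := ⟨p / 6, by omega⟩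
    have := NGB_count (6 * t + 1) (3 * t) t _ _ (by omega) (Or.inl ⟨rfl, rfl, rfl⟩)
    have h2 : ((NGB (6 * t + 1) + (2 * t) * (2 * t) : ℕ) : ℚ) = ((6 * t) * (6 * t) : ℕ) := by
      exact_mod_cast this
    push_cast at h2 ⊢
    linarith
  · intro h
    obtain ⟨t, rfl⟩ : ∃ t, p = 6 * t + 5 := ⟨p / 6, by omega⟩
    have := NGB_count (6 * t + 5) (3 * t + 2) t _ _ (by omega) (Or.inr ⟨rfl, rfl, rfl⟩)
    have h2 : ((NGB (6 * t + 5) + (2 * t) * (2 * t) : ℕ) : ℚ)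
        = ((6 * t + 4) * (6 * t + 4) : ℕ) := by
      exact_mod_cast this
    push_cast at h2 ⊢
    linarith
end

section
/- Let p > 3 be prime. For integers 1 ≤ j, k ≤ p-1 set α = min(j, k, p-j, p-k), δ = min(max(j,k), max(p-j,p-k)), δ₁ = min(δ, p-δ), and BB(j,k) = min(2α + δ₁, p - δ₁). Let N_BB(p) be the number of pairs (j,k) with 1 ≤ j, k ≤ p-1 and BB(j,k) ≤ 2p/3. Then N_BB(p) = (25/27)p² - ((8/27)·χ(p) + 2)·p + 73/27 if p ≡ ±2 (mod 9), and N_BB(p) = (25/27)p² - ((8/27)·χ(p) + 2)·p + 37/27 otherwise, where χ(p) = 1 if p ≡ 1 (mod 3) and χ(p) = -1 if p ≡ 2 (mod 3) (the Legendre symbol (p/3)). -/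
/-- `BB(j,k) = min(2α + δ₁, p - δ₁)` with `α = min(j,k,p-j,p-k)`,
`δ = min(max(j,k), max(p-j,p-k))` and `δ₁ = min(δ, p-δ)`, as a rational number. -/
def BBval (p j k : ℕ) : ℚ :=
  let α : ℚ := min (min (j : ℚ) (k : ℚ)) (min ((p : ℚ) - (j : ℚ)) ((p : ℚ) - (k : ℚ)))
  let δ : ℚ := min (max (j : ℚ) (k : ℚ)) (max ((p : ℚ) - (j : ℚ)) ((p : ℚ) - (k : ℚ)))
  let δ₁ : ℚ := min δ ((p : ℚ) - δ)
  min (2 * α + δ₁) ((p : ℚ) - δ₁)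

/-- `N_BB(p)`: the number of pairs `(j,k)` with `1 ≤ j,k ≤ p-1` and `BB(j,k) ≤ 2p/3`. -/
def NBB (p : ℕ) : ℕ :=
  ((Finset.Icc 1 (p - 1) ×ˢ Finset.Icc 1 (p - 1)).filter
    (fun jk : ℕ × ℕ => BBval p jk.1 jk.2 ≤ 2 * (p : ℚ) / 3)).card

/-- `χ(p)`: the Legendre symbol `(p/3)`, i.e. `1` if `p ≡ 1 (mod 3)` and `-1` if
`p ≡ 2 (mod 3)`. -/
def chi3 (p : ℕ) : ℚ := if p % 3 = 1 then 1 else -1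

open Finset in
lemma edge_sum (a c K : ℕ) (h : a ≤ K) (P : ℕ → Prop) [DecidablePred P]
    (hP : ∀ y, P y ↔ y < a) : ∑ y ∈ range K, (if P y then c else 0) = a * c := by
  have h1 : ∑ y ∈ range K, (if P y then c else 0) = ∑ y ∈ range a, c := by
    rw [← sum_filter]
    congr 1
    ext y
    simp only [mem_filter, mem_range, hP]
    omega
  rw [h1]; simp

/-- number of pairs below `K` with `2 max + min < 2 m` -/
def triCount (m K : ℕ) : ℕ :=
  ∑ x ∈ Finset.range K, ∑ y ∈ Finset.range K, if 2 * max x y + min x y < 2 * m then 1 else 0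

open Finset in
lemma triCount_step (m K : ℕ) (h : m + 1 ≤ K) :
    triCount (m + 3) (K + 2) = triCount m K + (4 * m + 8) := by
  have key : ∀ x, ∑ y ∈ range (K + 2),
      (if 2 * max (x + 2) y + min (x + 2) y < 2 * (m + 3) then 1 else 0) =
      ∑ y ∈ range K, (if 2 * max x y + min x y < 2 * m then 1 else 0)
        + (if x < m + 1 then 1 else 0) + (if x < m + 1 then 1 else 0) := by
    intro x
    rw [sum_range_succ', sum_range_succ']
    congr 1
    · congr 1
      · apply sum_congr rfl
        intro y _
        congr 1
        apply propext
        omega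
      · congr 1
        apply propext
        omega
    · congr 1
      apply propext
      omega
  unfold triCount
  rw [sum_range_succ', sum_range_succ']
  have k2 : ∑ x ∈ range K, ∑ y ∈ range (K + 2),
      (if 2 * max (x + 1 + 1) y + min (x + 1 + 1) y < 2 * (m + 3) then 1 else 0) = 
      ∑ x ∈ range K, (∑ y ∈ range K, (if 2 * max x y + min x y < 2 * m then 1 else 0)
        + (if x < m + 1 then 1 else 0) + (if x < m + 1 then 1 else 0)) :=
    sum_congr rfl (fun x _ => key x)
  have r0 : ∑ y ∈ range (K + 2),
      (if 2 * max 0 y + min 0 y < 2 * (m + 3) then 1 else 0) = (m + 3) * 1 :=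
    edge_sum (m + 3) 1 (K + 2) (by omega) _ (fun y => by omega)
  have r1 : ∑ y ∈ range (K + 2),
      (if 2 * max (0 + 1) y + min (0 + 1) y < 2 * (m + 3) then 1 else 0) = (m + 3) * 1 := by
    rw [sum_range_succ', edge_sum (m + 2) 1 (K + 1) (by omega)
      (fun y => 2 * max (0 + 1) (y + 1) + min (0 + 1) (y + 1) < 2 * (m + 3))
      (fun y => by omega), if_pos (by omega)]
    omega
  have r2 : ∑ x ∈ range K, (if x < m + 1 then 1 else 0) = (m + 1) * 1 :=
    edge_sum (m + 1) 1 K (by omega) _ (fun y => Iff.rfl)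
  rw [k2, sum_add_distrib, sum_add_distrib, r0, r1, r2]
  omega

open Finset in
lemma triCount_shrink (m K : ℕ) (h : m ≤ K) : triCount m (K + 1) = triCount m K := by
  unfold triCount
  rw [sum_range_succ]
  have h0 : ∑ y ∈ range (K + 1), (if 2 * max K y + min K y < 2 * m then 1 else 0) = 0 := by
    apply sum_eq_zero
    intro y _
    rw [if_neg]; omega
  rw [h0, add_zero]
  apply sum_congr rfl
  intro x _
  rw [sum_range_succ, if_neg (by omega), add_zero]

lemma triCount_eq (m K : ℕ) (h : m ≤ K) : triCount m K = triCount m m := by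
  induction K, h using Nat.le_induction with
  | base => rfl
  | succ K hK ih => rw [triCount_shrink m K hK, ih]

lemma triCount_formula (m : ℕ) :
    3 * triCount m m + (if m % 3 = 1 then 1 else 0) = 2 * m ^ 2 + 2 * m := by
  induction m using Nat.strong_induction_on with
  | _ m ih =>
    match m, ih with
    | 0, _ => decide
    | 1, _ => decide
    | 2, _ => decide
    | m + 3, ih =>
      have h1 := ih m (by omega)
      have h2 := triCount_step m (m + 1) le_rfl
      rw [triCount_shrink m m le_rfl] at h2
      rw [show m + 1 + 2 = m + 3 by omega] at h2
      rw [h2, Nat.add_mod_right]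
      linarith

open Finset in
lemma fold_sum (h : ℕ) (f : ℕ → ℕ) :
    ∑ j ∈ Icc 1 (2 * h), f (min j (2 * h + 1 - j)) = 2 * ∑ i ∈ range h, f (i + 1) := by
  have e : ∑ j ∈ Icc 1 (2 * h), f (min j (2 * h + 1 - j))
      = ∑ i ∈ range (h + h), f (min (i + 1) (2 * h + 1 - (i + 1))) := by
    rw [Finset.sum_bij (fun j _ => j - 1)]
    · intro a ha; simp only [mem_Icc, mem_range] at *; omega
    · intro a ha b hb hab; simp only [mem_Icc] at *; omega
    · intro b hb; simp only [mem_range] at hb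
      exact ⟨b + 1, by simp only [mem_Icc]; omega, by omega⟩
    · intro a ha; simp only [mem_Icc] at ha; rw [show a - 1 + 1 = a by omega]
  rw [e, sum_range_add, two_mul (∑ i ∈ range h, f (i + 1))]
  congr 1
  · apply sum_congr rfl
    intro i hi
    simp only [mem_range] at hi
    congr 1; omega
  · rw [← sum_range_reflect (fun i => f (i + 1)) h]
    apply sum_congr rfl
    intro i hi
    simp only [mem_range] at hi
    congr 1; omega

open Finset in
lemma refl_sum (n h : ℕ) (hn : n ≤ h) (f g : ℕ → ℕ) (hf : ∀ a, n < a → f a = 0)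
    (hg : ∀ x, x < n → f (n - x) = g x) :
    ∑ i ∈ range h, f (i + 1) = ∑ x ∈ range n, g x := by
  obtain ⟨d, rfl⟩ := Nat.exists_eq_add_of_le hn
  rw [sum_range_add, sum_eq_zero (s := range d) (fun x _ => hf _ (by omega)), add_zero,
    ← sum_range_reflect]
  apply sum_congr rfl
  intro x hx
  simp only [mem_range] at hx
  rw [← hg x hx]
  congr 1; omega

/-- the pair of folded coordinates violates the bound -/
def bad (p a b : ℕ) : ℕ :=
  if 3 * max a b < p ∧ 2 * p < 3 * (2 * min a b + max a b) then 1 else 0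

lemma BBval_nat (p j k : ℕ) (hj : j < p) (hk : k < p) :
    (BBval p j k ≤ 2 * (p : ℚ) / 3) ↔
      ¬ (3 * max (min j (p - j)) (min k (p - k)) < p ∧
        2 * p < 3 * (2 * min (min j (p - j)) (min k (p - k))
          + max (min j (p - j)) (min k (p - k)))) := by
  have e : BBval p j k = ((min (2 * min (min j k) (min (p - j) (p - k)) +
      min (min (max j k) (max (p - j) (p - k))) (p - min (max j k) (max (p - j) (p - k))))
      (p - min (min (max j k) (max (p - j) (p - k)))
        (p - min (max j k) (max (p - j) (p - k)))) : ℕ) : ℚ) := by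
    unfold BBval
    have h1 : min (max j k) (max (p - j) (p - k)) ≤ p := by omega
    have h2 : min (min (max j k) (max (p - j) (p - k)))
        (p - min (max j k) (max (p - j) (p - k))) ≤ p := by omega
    rw [Nat.cast_min, Nat.cast_add, Nat.cast_sub h2, Nat.cast_min (min (max j k) _),
      Nat.cast_sub h1]
    push_cast [Nat.cast_sub hj.le, Nat.cast_sub hk.le]
    rfl
  rw [e, le_div_iff₀ (by norm_num)]
  norm_cast
  omega

open Finset in
lemma NBB_bad (h : ℕ) :
    NBB (2 * h + 1) + 4 * ∑ i ∈ range h, ∑ l ∈ range h, bad (2 * h + 1) (i + 1) (l + 1)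
      = (2 * h) ^ 2 := by
  set p := 2 * h + 1 with hp
  have hb : ∑ j ∈ Icc 1 (2 * h), ∑ k ∈ Icc 1 (2 * h), bad p (min j (p - j)) (min k (p - k))
      = 4 * ∑ i ∈ range h, ∑ l ∈ range h, bad p (i + 1) (l + 1) := by
    rw [fold_sum h (fun a => ∑ k ∈ Icc 1 (2 * h), bad p a (min k (p - k)))]
    have : ∀ a, ∑ k ∈ Icc 1 (2 * h), bad p a (min k (p - k))
        = 2 * ∑ l ∈ range h, bad p a (l + 1) := fun a => fold_sum h (fun b => bad p a b)
    simp only [this]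
    rw [← mul_sum]; ring
  have hN : NBB p = ∑ j ∈ Icc 1 (2 * h), ∑ k ∈ Icc 1 (2 * h),
      (1 - bad p (min j (p - j)) (min k (p - k))) := by
    unfold NBB
    rw [card_filter, sum_product, show p - 1 = 2 * h by omega]
    apply sum_congr rfl; intro j hj
    apply sum_congr rfl; intro k hk
    simp only [mem_Icc] at hj hk
    have := BBval_nat p j k (by omega) (by omega)
    simp only [this, bad]
    split_ifs <;> simp_all
  rw [← hb, hN, ← sum_add_distrib]
  simp only [← sum_add_distrib]
  have h1 : ∀ a b, 1 - bad p a b + bad p a b = 1 := by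
    intro a b; unfold bad; split_ifs <;> rfl
  simp only [h1]
  simp; ring

open Finset in
lemma bad_count (p h n m : ℕ) (hn : n ≤ h)
    (hc : (p = 6 * m + 1 ∧ n = 2 * m) ∨ (p = 6 * m + 5 ∧ n = 2 * m + 1)) :
    ∑ i ∈ range h, ∑ l ∈ range h, bad p (i + 1) (l + 1) = triCount m m := by
  rw [← triCount_eq m n (by omega)]
  unfold triCount
  refine refl_sum n h hn (fun a => ∑ l ∈ range h, bad p a (l + 1)) _ ?_ ?_
  · intro a ha
    apply sum_eq_zero
    intro l _
    unfold bad
    rw [if_neg]; omega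
  · intro x hx
    refine refl_sum n h hn (fun b => bad p (n - x) b) _ ?_ ?_
    · intro b hb
      unfold bad
      rw [if_neg]; omega
    · intro y hy
      simp only [bad]
      congr 1
      apply propext
      omega

theorem NBB_formula (p : ℕ) (hp : p.Prime) (hp3 : 3 < p) :
    ((p % 9 = 2 ∨ p % 9 = 7) →
      (NBB p : ℚ) =
        25 / 27 * (p : ℚ) ^ 2 - (8 / 27 * chi3 p + 2) * (p : ℚ) + 73 / 27) ∧
    (¬ (p % 9 = 2 ∨ p % 9 = 7) →
      (NBB p : ℚ) =
        25 / 27 * (p : ℚ) ^ 2 - (8 / 27 * chi3 p + 2) * (p : ℚ) + 37 / 27) := by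
  have h2 : p % 2 = 1 := by
    rcases hp.eq_two_or_odd with h | h <;> omega
  have h3 : p % 3 ≠ 0 := by
    intro h
    have := (Nat.prime_dvd_prime_iff_eq Nat.prime_three hp).1 (Nat.dvd_of_mod_eq_zero h)
    omega
  obtain ⟨m, hm⟩ : ∃ m, p = 6 * m + 1 ∨ p = 6 * m + 5 := ⟨p / 6, by omega⟩
  have hT := triCount_formula m
  rcases hm with rfl | rfl
  · have hN := NBB_bad (3 * m)
    rw [show 2 * (3 * m) + 1 = 6 * m + 1 by ring,
      bad_count (6 * m + 1) (3 * m) (2 * m) m (by omega) (by omega)] at hN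
    have hchi : chi3 (6 * m + 1) = 1 := by
      unfold chi3; rw [if_pos (by omega)]
    rw [hchi]
    have hNq : (NBB (6 * m + 1) : ℚ) + 4 * triCount m m = (2 * (3 * m)) ^ 2 := by
      exact_mod_cast hN
    constructor
    · intro hc
      rw [if_pos (by omega)] at hT
      have hTq : 3 * (triCount m m : ℚ) + 1 = 2 * m ^ 2 + 2 * m := by exact_mod_cast hT
      push_cast
      linarith
    · intro hc
      rw [if_neg (by omega)] at hT
      have hTq : 3 * (triCount m m : ℚ) + 0 = 2 * m ^ 2 + 2 * m := by exact_mod_cast hT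
      push_cast
      linarith
  · have hN := NBB_bad (3 * m + 2)
    rw [show 2 * (3 * m + 2) + 1 = 6 * m + 5 by ring,
      bad_count (6 * m + 5) (3 * m + 2) (2 * m + 1) m (by omega) (by omega)] at hN
    have hchi : chi3 (6 * m + 5) = -1 := by
      unfold chi3; rw [if_neg (by omega)]
    rw [hchi]
    have hNq : (NBB (6 * m + 5) : ℚ) + 4 * triCount m m = (2 * (3 * m + 2)) ^ 2 := by
      exact_mod_cast hN
    constructor
    · intro hc
      rw [if_pos (by omega)] at hT
      have hTq : 3 * (triCount m m : ℚ) + 1 = 2 * m ^ 2 + 2 * m := by exact_mod_cast hT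
      push_cast
      linarith
    · intro hc
      rw [if_neg (by omega)] at hT
      have hTq : 3 * (triCount m m : ℚ) + 0 = 2 * m ^ 2 + 2 * m := by exact_mod_cast hT
      push_cast
      linarith
end

section
/- Let p be an odd prime and q, r integers coprime to p. Let q* and r* be the inverses of q and r modulo p with 1 ≤ q*, r* ≤ p-1, set a = min(q*, r*, p-q*, p-r*), and let d be the unique integer with 1 ≤ d ≤ p-1 and a·d·q·r ≡ 1 (mod p). Then d = min(max(q*, r*), max(p-q*, p-r*)). -/
theorem d_eq_min_max (p : ℕ) (hp : p.Prime) (hodd : Odd p)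
    (q r : ℤ) (hq : IsCoprime q (p : ℤ)) (hr : IsCoprime r (p : ℤ))
    (qs rs : ℕ)
    (hqs1 : 1 ≤ qs) (hqs2 : qs ≤ p - 1) (hqsinv : q * (qs : ℤ) ≡ 1 [ZMOD (p : ℤ)])
    (hrs1 : 1 ≤ rs) (hrs2 : rs ≤ p - 1) (hrsinv : r * (rs : ℤ) ≡ 1 [ZMOD (p : ℤ)])
    (a : ℕ) (ha : a = min (min qs rs) (min (p - qs) (p - rs)))
    (d : ℕ) (hd1 : 1 ≤ d) (hd2 : d ≤ p - 1)
    (hdinv : (a : ℤ) * (d : ℤ) * q * r ≡ 1 [ZMOD (p : ℤ)]) :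
    d = min (max qs rs) (max (p - qs) (p - rs)) := by
  have h1 : (a : ℤ) * d ≡ qs * rs [ZMOD (p : ℤ)] := by
    have e1 := (hdinv.mul_right ((qs : ℤ) * rs)).symm
    have e2 := (hqsinv.mul hrsinv).mul_left ((a : ℤ) * d)
    have e3 : (a : ℤ) * d * (q * qs * (r * rs)) = a * d * q * r * (qs * rs) := by ring
    rw [e3] at e2
    rw [one_mul] at e1
    rw [one_mul, mul_one] at e2
    exact (e1.trans e2).symm
  have key : ∀ e : ℕ, 1 ≤ e → e ≤ p - 1 → (a : ℤ) * e ≡ qs * rs [ZMOD (p : ℤ)] → d = e := by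
    intro e he1 he2 he
    have h2 : (p : ℤ) ∣ a * e - a * d := (h1.trans he.symm).dvd
    rw [← mul_sub] at h2
    rcases (Nat.prime_iff_prime_int.mp hp).dvd_or_dvd h2 with h3 | h3
    · have h4 : p ∣ a := by exact_mod_cast h3
      have := Nat.le_of_dvd (by omega) h4
      omega
    · have := Int.eq_zero_of_abs_lt_dvd h3 (by rw [abs_lt]; omega)
      omega
  have hc : a = qs ∨ a = rs ∨ a = p - qs ∨ a = p - rs := by omega
  have neg : ((p : ℤ) - qs) * (p - rs) ≡ qs * rs [ZMOD (p : ℤ)] := by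
    apply Int.ModEq.symm
    rw [Int.modEq_iff_dvd]
    exact ⟨p - qs - rs, by ring⟩
  have cq : ((p - qs : ℕ) : ℤ) = p - qs := by omega
  have cr : ((p - rs : ℕ) : ℤ) = p - rs := by omega
  rcases hc with h | h | h | h
  · have := key rs hrs1 hrs2 (by rw [h])
    omega
  · have := key qs hqs1 hqs2 (by rw [h, mul_comm])
    omega
  · have := key (p - rs) (by omega) (by omega) (by rw [h, cq, cr]; exact neg)
    omega
  · have := key (p - qs) (by omega) (by omega) (by rw [h, cq, cr, mul_comm]; exact neg)
    omega
end

section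
/- (Bachman's bound) Let 3 ≤ p < q < r be primes. Let q* and r* be the inverses of q and r modulo p with 1 ≤ q*, r* ≤ p-1, set a = min(q*, r*, p-q*, p-r*), and let d be the unique integer with 1 ≤ d ≤ p-1 and a·d·q·r ≡ 1 (mod p). Then every coefficient a_{pqr}(k) of the cyclotomic polynomial Φ_{pqr} satisfies -min((p-1)/2 + a, d) ≤ a_{pqr}(k) ≤ min((p-1)/2 + a, p - d). -/
open Polynomial

/-- truncated coefficient of the binary cyclotomic polynomial in coordinates -/
def bb (p q Q P N x y : ℕ) : ℤ :=
  (if x < Q ∧ y < P ∧ x * q + y * p ≤ N then 1 else 0) -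
    (if Q ≤ x ∧ P ≤ y ∧ x * q + y * p ≤ N + p * q then 1 else 0)

lemma count_upper {p : ℕ} (x : ℕ → ℕ) (hx : Set.InjOn x (Finset.range p : Finset ℕ)) (T : ℕ → ℤ)
    (U : Finset ℕ) (h1 : ∀ m < p, T m ≤ 1) (h2 : ∀ m < p, 0 < T m → x m ∈ U) :
    ∑ m ∈ Finset.range p, T m ≤ U.card := by
  classical
  have h3 : ∑ m ∈ Finset.range p, T m ≤ ∑ m ∈ Finset.range p, if x m ∈ U then (1 : ℤ) else 0 := by
    apply Finset.sum_le_sum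
    intro m hm
    have hm := Finset.mem_range.1 hm
    split_ifs with h
    · exact h1 m hm
    · by_contra hc
      exact h (h2 m hm (by omega))
  refine h3.trans ?_
  rw [Finset.sum_boole]
  have : (Finset.filter (fun m => x m ∈ U) (Finset.range p)).card ≤ U.card := by
    apply Finset.card_le_card_of_injOn x
    · intro m hm
      simp only [Finset.coe_filter, Set.mem_ofPred_eq] at hm
      exact hm.2
    · exact hx.mono (by intro m hm; simp at hm ⊢; exact hm.1)
  exact_mod_cast this

section key
variable (p q Q P R N x x' y : ℕ)

set_option maxHeartbeats 2000000 in
lemma bb_bound1 (hq : 0 < q) (hp : 0 < p) (hQP : Q * q + P * p = 1 + p * q) (hx : x < p) (hx' : x' < p) (hy : y < q)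
    (hR : R < p) (hxx : x' + R = x ∨ x' + R = x + p) (hQR : Q ≤ R) (hs : Q + R ≤ p) :
    (bb p q Q P N x y - bb p q Q P N x' y ≤ 1 ∧ -(bb p q Q P N x y - bb p q Q P N x' y) ≤ 1) ∧
    (0 < bb p q Q P N x y - bb p q Q P N x' y →
      x ∈ Finset.range Q ∪ Finset.Ico (Q + R) p ∧
      x ∈ Finset.range Q ∪ Finset.Ioc (N / q) (N / q + (Q + R))) ∧
    (0 < -(bb p q Q P N x y - bb p q Q P N x' y) →
      x ∈ Finset.Ico Q (R + Q) ∧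
      x ∈ Finset.Ico R (R + Q) ∪ Finset.Ico (N / q + 1 - (p - R)) (N / q + 1 + Q)) := by
  have hk1 : N / q * q ≤ N := Nat.div_mul_le_self N q
  have hk2 : N < (N / q + 1) * q := by
    have := Nat.lt_div_mul_add (a := N) hq
    nlinarith
  generalize N / q = k at *
  have hyp : y * p + p ≤ p * q := by nlinarith
  -- general facts
  have f1 : ∀ z, N + p * q < z * q + y * p → k < z := by
    intro z hz
    by_contra hc
    have : z * q ≤ k * q := Nat.mul_le_mul_right _ (by omega)
    omega
  have f2 : ∀ z, P ≤ y → z * q + y * p ≤ N + p * q → z < k + 1 + Q := by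
    intro z hy hz
    by_contra hc
    have h1 : (k + 1 + Q) * q ≤ z * q := Nat.mul_le_mul_right _ (by omega)
    have h2 : P * p ≤ y * p := Nat.mul_le_mul_right _ hy
    rw [add_mul _ Q] at h1
    omega
  have f3 : ∀ z w, z ≤ w → z * q ≤ w * q := fun z w h => Nat.mul_le_mul_right _ h
  have m1 := f3 x x'
  have m2 := f3 x' x
  have f1a := f1 x
  have f1b := f1 x'
  have f2a := f2 x
  have f2b := f2 x'
  simp only [Finset.mem_union, Finset.mem_range, Finset.mem_Ico, Finset.mem_Ioc]
  clear f1 f2 f3 hk1 hk2 hQP hyp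
  unfold bb
  generalize x * q = u at *
  generalize x' * q = u' at *
  generalize y * p = v at *
  generalize p * q = w at *
  by_cases c3 : y < P
  · have c3' : ¬ P ≤ y := by omega
    clear f1a f1b f2a f2b
    simp only [c3, c3', true_and, false_and, and_false, if_false, sub_zero]
    split_ifs <;> omega
  · have c3' : P ≤ y := by omega
    simp only [c3, c3', true_and, false_and, and_false, if_false, zero_sub, forall_true_left] at *
    split_ifs <;> omega

set_option maxHeartbeats 2000000 in
lemma bb_bound2 (hq : 0 < q) (hp : 0 < p) (hQP : Q * q + P * p = 1 + p * q) (hx : x < p) (hx' : x' < p) (hy : y < q)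
    (hR : R < p) (hQ : Q < p) (hxx : x' + R = x ∨ x' + R = x + p) (hQR : R ≤ Q) (hs : p ≤ Q + R) :
    (bb p q Q P N x y - bb p q Q P N x' y ≤ 1 ∧ -(bb p q Q P N x y - bb p q Q P N x' y) ≤ 1) ∧
    (0 < bb p q Q P N x y - bb p q Q P N x' y →
      x ∈ Finset.range R ∧
      x ∈ Finset.Ico (Q + R - p) R ∪ Finset.Ico (N / q + 1 - ((p - Q) + (p - R))) (N / q + 1)) ∧
    (0 < -(bb p q Q P N x y - bb p q Q P N x' y) →
      x ∈ Finset.Ico R p ∧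
      x ∈ Finset.Ico Q p ∪ Finset.Ico (N / q + 1 - (p - Q)) (N / q + 1 + R)) := by
  have hk1 : N / q * q ≤ N := Nat.div_mul_le_self N q
  have hk2 : N < (N / q + 1) * q := by
    have := Nat.lt_div_mul_add (a := N) hq
    nlinarith
  generalize N / q = k at *
  have f1 : ∀ z, y < P → N < z * q + y * p → k < z + (p - Q) := by
    intro z hy hz
    by_contra hc
    have h1 : (z + (p - Q)) * q ≤ k * q := Nat.mul_le_mul_right _ (by omega)
    have h2 : (y + 1) * p ≤ P * p := Nat.mul_le_mul_right _ hy
    have h3 : (p - Q) * q + Q * q = p * q := by rw [← add_mul]; congr 1; omega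
    rw [add_mul] at h1 h2
    omega
  have f2 : ∀ z, z * q + y * p ≤ N → z < k + 1 := by
    intro z hz
    by_contra hc
    have h1 : (k + 1) * q ≤ z * q := Nat.mul_le_mul_right _ (by omega)
    omega
  have f3 : ∀ z w, z ≤ w → z * q ≤ w * q := fun z w h => Nat.mul_le_mul_right _ h
  have m1 := f3 x x'
  have m2 := f3 x' x
  have f1a := f1 x
  have f1b := f1 x'
  have f2a := f2 x
  have f2b := f2 x'
  simp only [Finset.mem_union, Finset.mem_range, Finset.mem_Ico]
  clear f1 f2 f3 hk1 hk2 hQP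
  unfold bb
  generalize x * q = u at *
  generalize x' * q = u' at *
  generalize y * p = v at *
  generalize p * q = w at *
  by_cases c3 : y < P
  · have c3' : ¬ P ≤ y := by omega
    simp only [c3, c3', true_and, false_and, and_false, if_false, sub_zero, forall_true_left] at *
    split_ifs <;> omega
  · have c3' : P ≤ y := by omega
    clear f1a f1b f2a f2b
    simp only [c3, c3', true_and, false_and, and_false, if_false, zero_sub]
    split_ifs <;> omega

end key

lemma cyc_two (p q : ℕ) (hp : p.Prime) (hq : q.Prime) (hne : p ≠ q) :
    cyclotomic (p * q) ℤ * ((X ^ q - 1) * (X ^ p - 1)) = (X ^ (p * q) - 1) * (X - 1) := by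
  have h1 := cyclotomic_prime_mul_X_sub_one ℤ q (hn := ⟨hq⟩)
  have h2 := cyclotomic_expand_eq_cyclotomic_mul (n := q) hp
    (fun h => hne ((Nat.prime_dvd_prime_iff_eq hp hq).1 h)) ℤ
  have h3 := congrArg (expand ℤ p) h1
  simp only [map_mul, map_sub, expand_X, map_one, map_pow] at h3
  rw [h2, ← pow_mul, mul_comm q p] at h3
  rw [← h3, ← h1]
  ring

lemma cyc_three (p q r : ℕ) (hp : p.Prime) (hq : q.Prime) (hr : r.Prime) (hpq : p ≠ q) (hpr : p ≠ r)
    (hqr : q ≠ r) :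
    cyclotomic (p * q * r) ℤ * (1 - X ^ (p * q)) =
      expand ℤ r (cyclotomic (p * q) ℤ) * ((∑ m ∈ Finset.range p, X ^ m) * (1 - X ^ q)) := by
  have h2 := cyclotomic_expand_eq_cyclotomic_mul (n := p * q) hr (by
    rw [hr.dvd_mul, Nat.prime_dvd_prime_iff_eq hr hp, Nat.prime_dvd_prime_iff_eq hr hq]
    tauto) ℤ
  have h1 := cyc_two p q hp hq hpq
  have h4 : (∑ m ∈ Finset.range p, (X : ℤ[X]) ^ m) * (X - 1) = X ^ p - 1 := geom_sum_mul X p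
  have hX : (X - 1 : ℤ[X]) ≠ 0 := X_sub_C_ne_zero 1
  apply mul_right_cancel₀ hX
  rw [h2]
  linear_combination (cyclotomic (p * q * r) ℤ) * h1 -
    cyclotomic (p * q * r) ℤ * cyclotomic (p * q) ℤ * (1 - X ^ q) * h4

lemma cyc_two_formula (p q Q P : ℕ) (hp : p.Prime) (hq : q.Prime) (hne : p ≠ q) (hQ : Q ≤ p) (hP : P ≤ q)
    (hQP : Q * q + P * p = 1 + p * q) :
    cyclotomic (p * q) ℤ = (∑ i ∈ Finset.range Q, ∑ j ∈ Finset.range P, X ^ (i * q + j * p)) -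
      ∑ i ∈ Finset.Ico Q p, ∑ j ∈ Finset.Ico P q, X ^ (i * q + j * p - p * q) := by
  have hX : ∀ n : ℕ, 0 < n → (X ^ n - 1 : ℤ[X]) ≠ 0 := fun n hn => X_pow_sub_C_ne_zero hn 1
  have hA : (X ^ (p * q) * ((X ^ q - 1) * (X ^ p - 1)) : ℤ[X]) ≠ 0 :=
    mul_ne_zero (pow_ne_zero _ X_ne_zero) (mul_ne_zero (hX _ hq.pos) (hX _ hp.pos))
  apply mul_left_cancel₀ hA
  have e1 : (∑ i ∈ Finset.range Q, ∑ j ∈ Finset.range P, (X : ℤ[X]) ^ (i * q + j * p)) =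
      (∑ i ∈ Finset.range Q, (X ^ q) ^ i) * (∑ j ∈ Finset.range P, (X ^ p) ^ j) := by
    rw [Finset.sum_mul_sum]
    refine Finset.sum_congr rfl fun i _ => Finset.sum_congr rfl fun j _ => ?_
    rw [← pow_mul, ← pow_mul, ← pow_add, mul_comm i, mul_comm j]
  have e2 : X ^ (p * q) * (∑ i ∈ Finset.Ico Q p, ∑ j ∈ Finset.Ico P q, (X : ℤ[X]) ^ (i * q + j * p - p * q)) =
      (∑ i ∈ Finset.Ico Q p, (X ^ q) ^ i) * (∑ j ∈ Finset.Ico P q, (X ^ p) ^ j) := by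
    rw [Finset.sum_mul_sum, Finset.mul_sum]
    refine Finset.sum_congr rfl fun i hi => ?_
    rw [Finset.mul_sum]
    refine Finset.sum_congr rfl fun j hj => ?_
    rw [Finset.mem_Ico] at hi hj
    rw [← pow_mul, ← pow_mul, ← pow_add, ← pow_add]
    congr 1
    have h1 := Nat.mul_le_mul_right q hi.1
    have h2 := Nat.mul_le_mul_right p hj.1
    rw [mul_comm q i, mul_comm p j]
    omega
  have g1 := geom_sum_mul ((X : ℤ[X]) ^ q) Q
  have g2 := geom_sum_mul ((X : ℤ[X]) ^ p) P
  have g3 := geom_sum_Ico_mul ((X : ℤ[X]) ^ q) hQ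
  have g4 := geom_sum_Ico_mul ((X : ℤ[X]) ^ p) hP
  have h1 := cyc_two p q hp hq hne
  have e3 : ∀ a b c d : ℤ[X], a * b * (c - d) = a * b * c - b * (a * d) := fun a b c d => by ring
  rw [e1, e3, e2]
  clear e1 e2 e3
  have hpw : (X ^ q) ^ Q * (X ^ p) ^ P = (X * X ^ (p * q) : ℤ[X]) := by
    rw [← pow_mul, ← pow_mul, ← pow_add, mul_comm q, mul_comm p P, hQP]; ring
  have c1 : ((X : ℤ[X]) ^ q) ^ p = X ^ (p * q) := by rw [← pow_mul, mul_comm]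
  have c2 : ((X : ℤ[X]) ^ p) ^ q = X ^ (p * q) := by rw [← pow_mul]
  rw [c1] at g3
  rw [c2] at g4
  generalize (∑ i ∈ Finset.range Q, ((X : ℤ[X]) ^ q) ^ i) = S1 at *
  generalize (∑ i ∈ Finset.range P, ((X : ℤ[X]) ^ p) ^ i) = S2 at *
  generalize (∑ i ∈ Finset.Ico Q p, ((X : ℤ[X]) ^ q) ^ i) = S3 at *
  generalize (∑ i ∈ Finset.Ico P q, ((X : ℤ[X]) ^ p) ^ i) = S4 at *
  generalize ((X : ℤ[X]) ^ q) ^ Q = A at *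
  generalize ((X : ℤ[X]) ^ p) ^ P = B at *
  generalize (X : ℤ[X]) ^ (p * q) = C at *
  generalize (X : ℤ[X]) ^ p = Z at *
  generalize (X : ℤ[X]) ^ q = W at *
  calc _ = C * ((C - 1) * (X - 1)) := by rw [← h1]; ring
    _ = C * ((A - 1) * (B - 1)) - (C - A) * (C - B) := by linear_combination (1 - C) * hpw
    _ = _ := by rw [← g1, ← g2, ← g3, ← g4]; ring

/-- sum of the coefficients at indices `k ≤ n`, `k ≡ n` modulo `M` -/
noncomputable def SS (M n : ℕ) : ℤ[X] →ₗ[ℤ] ℤ :=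
  ∑ k ∈ (Finset.range (n + 1)).filter (fun k => k ≡ n [MOD M]), lcoeff ℤ k

lemma SS_X (M n e : ℕ) : SS M n (X ^ e) = if e ≤ n ∧ e ≡ n [MOD M] then 1 else 0 := by
  unfold SS
  simp only [LinearMap.coe_sum, Finset.sum_apply, lcoeff_apply, coeff_X_pow]
  rw [Finset.sum_ite_eq']
  simp [Nat.lt_succ_iff]

lemma SS_cut (M n : ℕ) (hM : 0 < M) (F : ℤ[X]) : SS M n (F * (1 - X ^ M)) = F.coeff n := by
  induction F using Polynomial.induction_on' with
  | add f g hf hg => rw [add_mul, map_add, hf, hg, coeff_add]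
  | monomial e a =>
    rw [← C_mul_X_pow_eq_monomial, coeff_C_mul, mul_assoc, ← smul_eq_C_mul, map_smul, smul_eq_mul, mul_sub, mul_one,
      ← pow_add, map_sub, SS_X, SS_X, coeff_X_pow]
    congr 1
    have h : e + M ≡ n [MOD M] ↔ e ≡ n [MOD M] := by simp [Nat.ModEq]
    simp only [h]
    by_cases h1 : e ≡ n [MOD M]
    · by_cases h2 : e + M ≤ n
      · have h3 : e ≤ n := by omega
        have h4 : n ≠ e := by omega
        simp [h1, h2, h3, h4]
      · by_cases h3 : e ≤ n
        · have h4 : n = e := by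
            have h5 := (Nat.modEq_iff_dvd' h3).1 h1
            have := Nat.eq_zero_of_dvd_of_lt h5 (by omega)
            omega
          subst h4
          simp [h1, h2]
        · have h4 : n ≠ e := by omega
          simp [h2, h3, h4]
    · have h4 : n ≠ e := by rintro rfl; exact h1 rfl
      simp [h1, h4]

lemma coord_unique (p q r c n x y i j : ℕ) (hp : p.Prime) (hq : q.Prime) (hr : r.Prime) (hpq : p ≠ q)
    (hpr : p ≠ r) (hqr : q ≠ r) (hx : x < p) (hy : y < q) (hi : i < p) (hj : j < q)
    (h : c + r * (x * q + y * p) ≡ n [MOD p * q]) (h' : c + r * (i * q + j * p) ≡ n [MOD p * q]) :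
    i = x ∧ j = y := by
  have h0 : r * (i * q + j * p) ≡ r * (x * q + y * p) [MOD p * q] :=
    Nat.ModEq.add_left_cancel' c (h'.trans h.symm)
  have cpr := (Nat.coprime_primes hp hr).2 hpr
  have cqr := (Nat.coprime_primes hq hr).2 hqr
  have cpq := (Nat.coprime_primes hp hq).2 hpq
  have h1 : i * q + j * p ≡ x * q + y * p [MOD p * q] :=
    Nat.ModEq.cancel_left_of_coprime (Nat.Coprime.mul_left cpr cqr) h0
  constructor
  · have h2 : i * q + j * p ≡ x * q + y * p [MOD p] := h1.of_mul_right q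
    have h3 : i * q ≡ x * q [MOD p] := by
      simpa [Nat.ModEq] using h2
    exact Nat.ModEq.eq_of_lt_of_lt (Nat.ModEq.cancel_right_of_coprime cpq h3) hi hx
  · have h2 : i * q + j * p ≡ x * q + y * p [MOD q] := h1.of_mul_left p
    have h3 : j * p ≡ y * p [MOD q] := by
      simpa [Nat.ModEq] using h2
    exact Nat.ModEq.eq_of_lt_of_lt (Nat.ModEq.cancel_right_of_coprime cpq.symm h3) hj hy

lemma cutoff (M r c n e : ℕ) (hc : c < M) (hr : 0 < r) (h : c + r * e ≡ n [MOD M]) :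
    c + r * e ≤ n ↔ e ≤ n / r := by
  rw [Nat.le_div_iff_mul_le hr, mul_comm e]
  constructor
  · omega
  · intro h1
    by_contra h2
    have h5 := (Nat.modEq_iff_dvd' (by omega : n ≤ c + r * e)).1 h.symm
    have := Nat.eq_zero_of_dvd_of_lt h5 (by omega)
    omega

lemma SS_G (p q r Q P c n x y : ℕ) (hp : p.Prime) (hq : q.Prime) (hr : r.Prime) (hpq : p ≠ q)
    (hpr : p ≠ r) (hqr : q ≠ r) (hQ : Q ≤ p) (hP : P ≤ q) (hQP : Q * q + P * p = 1 + p * q)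
    (hx : x < p) (hy : y < q) (hc : c < p * q)
    (h : c + r * (x * q + y * p) ≡ n [MOD p * q]) :
    SS (p * q) n (X ^ c * expand ℤ r (cyclotomic (p * q) ℤ)) = bb p q Q P (n / r) x y := by
  rw [cyc_two_formula p q Q P hp hq hpq hQ hP hQP]
  simp only [map_sub, map_sum, map_pow, expand_X, mul_sub, Finset.mul_sum, ← pow_mul, ← pow_add, SS_X]
  have uniq := fun i j hi hj => coord_unique p q r c n x y i j hp hq hr hpq hpr hqr hx hy hi hj h
  unfold bb
  congr 1
  · by_cases hh : x < Q ∧ y < P ∧ x * q + y * p ≤ n / r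
    · rw [if_pos hh, Finset.sum_eq_single_of_mem x (Finset.mem_range.2 hh.1),
        Finset.sum_eq_single_of_mem y (Finset.mem_range.2 hh.2.1), if_pos]
      · exact ⟨(cutoff (p * q) r c n _ hc hr.pos h).2 hh.2.2, h⟩
      · intro j hj hne
        rw [if_neg]
        rintro ⟨-, h2⟩
        exact hne (uniq x j hx ((Finset.mem_range.1 hj).trans_le hP) h2).2
      · intro i hi hne
        refine Finset.sum_eq_zero fun j hj => ?_
        rw [if_neg]
        rintro ⟨-, h2⟩
        exact hne (uniq i j ((Finset.mem_range.1 hi).trans_le hQ) ((Finset.mem_range.1 hj).trans_le hP) h2).1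
    · rw [if_neg hh]
      refine Finset.sum_eq_zero fun i hi => Finset.sum_eq_zero fun j hj => ?_
      rw [Finset.mem_range] at hi hj
      rw [if_neg]
      rintro ⟨h1, h2⟩
      obtain ⟨rfl, rfl⟩ := uniq i j (hi.trans_le hQ) (hj.trans_le hP) h2
      exact hh ⟨hi, hj, (cutoff (p * q) r c n _ hc hr.pos h).1 h1⟩
  · have shift : ∀ i j, Q ≤ i → P ≤ j → ∃ e, i * q + j * p = e + p * q ∧ i * q + j * p - p * q = e ∧
        (c + r * e ≡ n [MOD p * q] ↔ c + r * (i * q + j * p) ≡ n [MOD p * q]) := by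
      intro i j hi hj
      have h1 := Nat.mul_le_mul_right q hi
      have h2 := Nat.mul_le_mul_right p hj
      refine ⟨i * q + j * p - p * q, by omega, rfl, ?_⟩
      obtain ⟨e, he⟩ : ∃ e, i * q + j * p = e + p * q := ⟨i * q + j * p - p * q, by omega⟩
      rw [he, Nat.add_sub_cancel, mul_add, ← add_assoc]
      simp [Nat.ModEq]
    by_cases hh : Q ≤ x ∧ P ≤ y ∧ x * q + y * p ≤ n / r + p * q
    · rw [if_pos hh, Finset.sum_eq_single_of_mem x (Finset.mem_Ico.2 ⟨hh.1, hx⟩),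
        Finset.sum_eq_single_of_mem y (Finset.mem_Ico.2 ⟨hh.2.1, hy⟩), if_pos]
      · obtain ⟨e, he1, he2, he3⟩ := shift x y hh.1 hh.2.1
        rw [he2]
        exact ⟨(cutoff (p * q) r c n _ hc hr.pos (he3.2 h)).2 (by omega), he3.2 h⟩
      · intro j hj hne
        rw [if_neg]
        rintro ⟨-, h2⟩
        rw [Finset.mem_Ico] at hj
        obtain ⟨e, he1, he2, he3⟩ := shift x j hh.1 hj.1
        rw [he2] at h2
        exact hne (uniq x j hx hj.2 (he3.1 h2)).2
      · intro i hi hne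
        refine Finset.sum_eq_zero fun j hj => ?_
        rw [if_neg]
        rintro ⟨-, h2⟩
        rw [Finset.mem_Ico] at hi hj
        obtain ⟨e, he1, he2, he3⟩ := shift i j hi.1 hj.1
        rw [he2] at h2
        exact hne (uniq i j hi.2 hj.2 (he3.1 h2)).1
    · rw [if_neg hh]
      refine Finset.sum_eq_zero fun i hi => Finset.sum_eq_zero fun j hj => ?_
      rw [Finset.mem_Ico] at hi hj
      rw [if_neg]
      rintro ⟨h1, h2⟩
      obtain ⟨e, he1, he2, he3⟩ := shift i j hi.1 hj.1
      rw [he2] at h1 h2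
      obtain ⟨rfl, rfl⟩ := uniq i j hi.2 hj.2 (he3.1 h2)
      have := (cutoff (p * q) r c n _ hc hr.pos h2).1 h1
      exact hh ⟨hi.1, hj.1, by omega⟩

lemma formula (p q r Q R P n : ℕ) (hp : p.Prime) (hq : q.Prime) (hr : r.Prime) (hpq : p < q)
    (hpr : p ≠ r) (hqr : q ≠ r) (hQ : Q ≤ p) (hP : P ≤ q) (hQP : Q * q + P * p = 1 + p * q)
    (hR : R < p) (hR1 : r * R ≡ 1 [MOD p]) :
    ∃ x x' y : ℕ → ℕ, (∀ m < p, x m < p ∧ x' m < p ∧ y m < q ∧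
        (x' m + R = x m ∨ x' m + R = x m + p)) ∧ Set.InjOn x (Finset.range p : Finset ℕ) ∧
      (cyclotomic (p * q * r) ℤ).coeff n = ∑ m ∈ Finset.range p,
        (bb p q Q P (n / r) (x m) (y m) - bb p q Q P (n / r) (x' m) (y m)) := by
  have cpr := (Nat.coprime_primes hp hr).2 hpr
  have cqr := (Nat.coprime_primes hq hr).2 hqr
  have cpq := (Nat.coprime_primes hp hq).2 hpq.ne
  have hM : 0 < p * q := Nat.mul_pos hp.pos hq.pos
  have ex1 : ∀ m, ∃ x < p, m + r * (x * q) ≡ n [MOD p] := by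
    intro m
    have : Fact p.Prime := ⟨hp⟩
    refine ⟨(((n : ZMod p) - m) / (r * q)).val, ZMod.val_lt _, ?_⟩
    rw [← ZMod.natCast_eq_natCast_iff]
    have h1 : (r : ZMod p) ≠ 0 := by
      rw [Ne, ZMod.natCast_eq_zero_iff]; exact fun h => hpr ((Nat.prime_dvd_prime_iff_eq hp hr).1 h)
    have h2 : (q : ZMod p) ≠ 0 := by
      rw [Ne, ZMod.natCast_eq_zero_iff]; exact fun h => hpq.ne ((Nat.prime_dvd_prime_iff_eq hp hq).1 h)
    push_cast
    rw [ZMod.natCast_zmod_val]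
    field_simp
    ring
  have ex2 : ∀ m, ∃ y < q, m + r * (y * p) ≡ n [MOD q] := by
    intro m
    have : Fact q.Prime := ⟨hq⟩
    refine ⟨(((n : ZMod q) - m) / (r * p)).val, ZMod.val_lt _, ?_⟩
    rw [← ZMod.natCast_eq_natCast_iff]
    have h1 : (r : ZMod q) ≠ 0 := by
      rw [Ne, ZMod.natCast_eq_zero_iff]; exact fun h => hqr ((Nat.prime_dvd_prime_iff_eq hq hr).1 h)
    have h2 : (p : ZMod q) ≠ 0 := by
      rw [Ne, ZMod.natCast_eq_zero_iff]; exact fun h => hpq.ne' ((Nat.prime_dvd_prime_iff_eq hq hp).1 h)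
    push_cast
    rw [ZMod.natCast_zmod_val]
    field_simp
    ring
  choose x hxp hx using ex1
  choose y hyq hy using ex2
  have hxy : ∀ m, m + r * (x m * q + y m * p) ≡ n [MOD p * q] := by
    intro m
    rw [← Nat.modEq_and_modEq_iff_modEq_mul cpq]
    constructor
    · refine Nat.ModEq.trans ?_ (hx m)
      rw [mul_add, ← add_assoc, ← mul_assoc r (y m) p]
      simp [Nat.ModEq]
    · refine Nat.ModEq.trans ?_ (hy m)
      rw [mul_add, add_left_comm, ← mul_assoc r (x m) q]
      simp [Nat.ModEq]
  have hx' : ∀ m, ∃ x' < p, x' + R = x m ∨ x' + R = x m + p := by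
    intro m
    have := hxp m
    by_cases h : R ≤ x m
    · exact ⟨x m - R, by omega, by omega⟩
    · exact ⟨x m + p - R, by omega, by omega⟩
  choose x' hx'p hx'R using hx'
  have hxy' : ∀ m, (m + q) + r * (x' m * q + y m * p) ≡ n [MOD p * q] := by
    intro m
    refine Nat.ModEq.trans ?_ (hxy m)
    obtain ⟨t, ht⟩ := (Nat.modEq_iff_dvd.1 hR1)
    rw [Nat.modEq_iff_dvd]
    push_cast at ht ⊢
    rcases hx'R m with h | h
    · refine ⟨-t, ?_⟩
      rw [← h]; push_cast
      linear_combination (-(q : ℤ)) * ht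
    · refine ⟨-t - r, ?_⟩
      have h : (x' m : ℤ) + R = x m + p := by exact_mod_cast h
      linear_combination (-(q : ℤ)) * ht - (r : ℤ) * q * h
  refine ⟨x, x', y, fun m _ => ⟨hxp m, hx'p m, hyq m, hx'R m⟩, ?_, ?_⟩
  · intro m hm m' hm' he
    simp only [Finset.coe_range, Set.mem_Iio] at hm hm'
    have h1 := (hx m).trans (hx m').symm
    rw [he] at h1
    exact Nat.ModEq.eq_of_lt_of_lt (Nat.ModEq.add_right_cancel' _ h1) hm hm'
  · rw [← SS_cut (p * q) n hM, cyc_three p q r hp hq hr hpq.ne hpr hqr, Finset.sum_mul, Finset.mul_sum,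
      map_sum]
    refine Finset.sum_congr rfl fun m hm => ?_
    have hm := Finset.mem_range.1 hm
    have hlt : m + q < p * q := by nlinarith [hp.two_le]
    rw [← SS_G p q r Q P m n (x m) (y m) hp hq hr hpq.ne hpr hqr hQ hP hQP (hxp m) (hyq m) (by omega) (hxy m),
      ← SS_G p q r Q P (m + q) n (x' m) (y m) hp hq hr hpq.ne hpr hqr hQ hP hQP (hx'p m) (hyq m) hlt (hxy' m),
      ← map_sub]
    congr 1
    ring

lemma bound_half (p q r Q R n a d : ℕ) (hp : p.Prime) (hq : q.Prime) (hr : r.Prime) (hp3 : 3 ≤ p) (hpq : p < q)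
    (hpr : p ≠ r) (hqr : q ≠ r) (hQ1 : 1 ≤ Q) (hQ : Q < p) (hQinv : q * Q ≡ 1 [MOD p])
    (hR : R < p) (hR1 : r * R ≡ 1 [MOD p])
    (had : (a = Q ∧ d = R ∧ Q ≤ R ∧ Q + R ≤ p) ∨ (a = p - Q ∧ d = p - R ∧ R ≤ Q ∧ p ≤ Q + R)) :
    -(min (((p : ℤ) - 1) / 2 + (a : ℤ)) (d : ℤ)) ≤ (cyclotomic (p * q * r) ℤ).coeff n ∧
        (cyclotomic (p * q * r) ℤ).coeff n ≤ min (((p : ℤ) - 1) / 2 + (a : ℤ)) ((p : ℤ) - (d : ℤ)) := by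
  obtain ⟨P, hP, hQP⟩ : ∃ P ≤ q, Q * q + P * p = 1 + p * q := by
    have h1 : Q * q ≤ 1 + p * q := by nlinarith
    have h2 : Q * q ≡ 1 + p * q [MOD p] := by
      rw [mul_comm]; refine hQinv.trans ?_; simp [Nat.ModEq]
    obtain ⟨P, hP⟩ := (Nat.modEq_iff_dvd' h1).1 h2
    have h3 : Q * q + P * p = 1 + p * q := by rw [mul_comm P]; omega
    refine ⟨P, ?_, h3⟩
    by_contra hc
    nlinarith [hq.two_le]
  obtain ⟨x, x', y, hxy, hinj, hs⟩ := formula p q r Q R P n hp hq hr hpq hpr hqr hQ.le hP hQP hR hR1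
  rw [hs]
  have hodd := hp.eq_two_or_odd
  have hneg : ∀ T : ℕ → ℤ, ∑ m ∈ Finset.range p, -T m = -∑ m ∈ Finset.range p, T m :=
    fun T => Finset.sum_neg_distrib ..
  rcases had with ⟨rfl, rfl, h1, h2⟩ | ⟨rfl, rfl, h1, h2⟩
  · have key := fun m hm => bb_bound1 p q a P d (n / r) (x m) (x' m) (y m) hq.pos hp.pos hQP (hxy m hm).1
      (hxy m hm).2.1 (hxy m hm).2.2.1 hR (hxy m hm).2.2.2 h1 h2
    have u1 := count_upper x hinj _ _ (fun m hm => (key m hm).1.1) (fun m hm h => ((key m hm).2.1 h).1)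
    have u2 := count_upper x hinj _ _ (fun m hm => (key m hm).1.1) (fun m hm h => ((key m hm).2.1 h).2)
    have l1 := count_upper x hinj _ _ (fun m hm => (key m hm).1.2) (fun m hm h => ((key m hm).2.2 h).1)
    have l2 := count_upper x hinj _ _ (fun m hm => (key m hm).1.2) (fun m hm h => ((key m hm).2.2 h).2)
    rw [hneg] at l1 l2
    have cu1 := Finset.card_union_le (Finset.range a) (Finset.Ico (a + d) p)
    have cu2 := Finset.card_union_le (Finset.range a) (Finset.Ioc (n / r / q) (n / r / q + (a + d)))
    have cl2 := Finset.card_union_le (Finset.Ico d (d + a))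
      (Finset.Ico (n / r / q + 1 - (p - d)) (n / r / q + 1 + a))
    simp only [Finset.card_range, Nat.card_Ico, Nat.card_Ioc] at cu1 cu2 cl2 l1
    generalize n / r / q = k at *
    omega
  · have key := fun m hm => bb_bound2 p q Q P R (n / r) (x m) (x' m) (y m) hq.pos hp.pos hQP (hxy m hm).1
      (hxy m hm).2.1 (hxy m hm).2.2.1 hR hQ (hxy m hm).2.2.2 h1 h2
    have u1 := count_upper x hinj _ _ (fun m hm => (key m hm).1.1) (fun m hm h => ((key m hm).2.1 h).1)
    have u2 := count_upper x hinj _ _ (fun m hm => (key m hm).1.1) (fun m hm h => ((key m hm).2.1 h).2)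
    have l1 := count_upper x hinj _ _ (fun m hm => (key m hm).1.2) (fun m hm h => ((key m hm).2.2 h).1)
    have l2 := count_upper x hinj _ _ (fun m hm => (key m hm).1.2) (fun m hm h => ((key m hm).2.2 h).2)
    rw [hneg] at l1 l2
    have cu2 := Finset.card_union_le (Finset.Ico (Q + R - p) R)
      (Finset.Ico (n / r / q + 1 - ((p - Q) + (p - R))) (n / r / q + 1))
    have cl2 := Finset.card_union_le (Finset.Ico Q p)
      (Finset.Ico (n / r / q + 1 - (p - Q)) (n / r / q + 1 + R))
    simp only [Finset.card_range, Nat.card_Ico] at cu2 cl2 l1 u1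
    generalize n / r / q = k at *
    omega

lemma d_eq (p q r Q R a d e : ℕ) (hp : p.Prime) (hQinv : q * Q ≡ 1 [MOD p]) (hRinv : r * R ≡ 1 [MOD p])
    (hd1 : 1 ≤ d) (hd2 : d ≤ p - 1) (he : e < p) (hdinv : a * d * q * r ≡ 1 [MOD p])
    (hae : a * e ≡ Q * R [MOD p]) : d = e := by
  have : Fact p.Prime := ⟨hp⟩
  rw [← ZMod.natCast_eq_natCast_iff] at *
  push_cast at *
  have hd : (d : ZMod p) = e := by
    have h1 : (a : ZMod p) * e * q * r = 1 := by
      rw [hae]; linear_combination r * R * hQinv + hRinv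
    have h2 : (a : ZMod p) * q * r * (d - e) = 0 := by linear_combination hdinv - h1
    rcases mul_eq_zero.1 h2 with h | h
    · exfalso
      have : (1 : ZMod p) = 0 := by linear_combination e * h - h1
      exact one_ne_zero this
    · exact sub_eq_zero.1 h
  rw [ZMod.natCast_eq_natCast_iff] at hd
  exact Nat.ModEq.eq_of_lt_of_lt hd (by have := hp.pos; omega) he

lemma d_eq' (p q r Q R d : ℕ) (hp : p.Prime) (hQinv : q * Q ≡ 1 [MOD p]) (hRinv : r * R ≡ 1 [MOD p])
    (hd1 : 1 ≤ d) (hd2 : d ≤ p - 1) (hR0 : 1 ≤ R) (hR : R ≤ p) (hQ : Q ≤ p)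
    (hdinv : (p - Q) * d * q * r ≡ 1 [MOD p]) : d = p - R := by
  refine d_eq p q r Q R (p - Q) d (p - R) hp hQinv hRinv hd1 hd2 (by omega) hdinv ?_
  rw [← ZMod.natCast_eq_natCast_iff]
  push_cast [hR, hQ]
  simp

theorem bachman_bound (p q r : ℕ) (hp : p.Prime) (hq : q.Prime) (hr : r.Prime)
    (hp3 : 3 ≤ p) (hpq : p < q) (hqr : q < r)
    (qs rs : ℕ)
    (hqs1 : 1 ≤ qs) (hqs2 : qs ≤ p - 1) (hqsinv : q * qs ≡ 1 [MOD p])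
    (hrs1 : 1 ≤ rs) (hrs2 : rs ≤ p - 1) (hrsinv : r * rs ≡ 1 [MOD p])
    (a : ℕ) (ha : a = min (min qs rs) (min (p - qs) (p - rs)))
    (d : ℕ) (hd1 : 1 ≤ d) (hd2 : d ≤ p - 1) (hdinv : a * d * q * r ≡ 1 [MOD p]) :
    ∀ k : ℕ,
      -(min (((p : ℤ) - 1) / 2 + (a : ℤ)) (d : ℤ)) ≤
          (Polynomial.cyclotomic (p * q * r) ℤ).coeff k ∧
        (Polynomial.cyclotomic (p * q * r) ℤ).coeff k ≤
          min (((p : ℤ) - 1) / 2 + (a : ℤ)) ((p : ℤ) - (d : ℤ)) := by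
  intro k
  have hdinv' : a * d * r * q ≡ 1 [MOD p] := by rw [mul_right_comm]; exact hdinv
  have hcases : (a = qs ∧ qs ≤ rs ∧ qs + rs ≤ p) ∨ (a = p - qs ∧ rs ≤ qs ∧ p ≤ qs + rs) ∨
      (a = rs ∧ rs ≤ qs ∧ rs + qs ≤ p) ∨ (a = p - rs ∧ qs ≤ rs ∧ p ≤ rs + qs) := by omega
  rcases hcases with ⟨h1, h2, h3⟩ | ⟨h1, h2, h3⟩ | ⟨h1, h2, h3⟩ | ⟨h1, h2, h3⟩
  · have hd : d = rs := d_eq p q r qs rs a d rs hp hqsinv hrsinv hd1 hd2 (by omega) hdinv (by rw [h1])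
    exact bound_half p q r qs rs k a d hp hq hr hp3 hpq (by omega) (by omega) hqs1 (by omega) hqsinv
      (by omega) hrsinv (Or.inl ⟨h1, hd, h2, h3⟩)
  · have hd : d = p - rs := d_eq' p q r qs rs d hp hqsinv hrsinv hd1 hd2 (by omega) (by omega) (by omega)
      (by rw [← h1]; exact hdinv)
    exact bound_half p q r qs rs k a d hp hq hr hp3 hpq (by omega) (by omega) hqs1 (by omega) hqsinv
      (by omega) hrsinv (Or.inr ⟨h1, hd, h2, h3⟩)
  · rw [mul_right_comm p q r]
    have hd : d = qs := d_eq p r q rs qs a d qs hp hrsinv hqsinv hd1 hd2 (by omega) hdinv' (by rw [h1])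
    exact bound_half p r q rs qs k a d hp hr hq hp3 (by omega) (by omega) (by omega) hrs1 (by omega) hrsinv
      (by omega) hqsinv (Or.inl ⟨h1, hd, h2, h3⟩)
  · rw [mul_right_comm p q r]
    have hd : d = p - qs := d_eq' p r q rs qs d hp hrsinv hqsinv hd1 hd2 (by omega) (by omega) (by omega)
      (by rw [← h1]; exact hdinv')
    exact bound_half p r q rs qs k a d hp hr hq hp3 (by omega) (by omega) (by omega) hrs1 (by omega) hrsinv
      (by omega) hqsinv (Or.inr ⟨h1, hd, h2, h3⟩)
end
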